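/- Let u ∈ BV(X). Then for H-almost every x ∈ X there exists a set A_x containing x with lim_{r→0⁺} r · H₁(B(x,r)∖A_x)/μ(B(x,r)) = 0 such that whenever y_k → x with y_k ∈ A_x, one has min_{l₂ ∈ {1,...,n}} |u^{l₁}(y_k) − u^{l₂}(x)| → 0 for each l₁ = 1,...,n. -/

import Mathlib

open MeasureTheory Metric Set Filter Topology ENNReal NNReal

noncomputable section

namespace FineBV

variable {X : Type*} [MetricSpace X] [MeasurableSpace X]

/-- `g` is an upper gradient of `u` on `Ω`: for every `1`-Lipschitz
(arclength-parametrized) curve `γ : [0, ℓ] → X` with image in `Ω`,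
`|u (γ ℓ) - u (γ 0)| ≤ ∫_0^ℓ g (γ t) dt`. -/
def IsUpperGradientOn (g : X → ℝ≥0∞) (u : X → ℝ) (Ω : Set X) : Prop :=
  Measurable g ∧
    ∀ (ℓ : ℝ), 0 ≤ ℓ → ∀ γ : ℝ → X, LipschitzOnWith 1 γ (Icc 0 ℓ) →
      (∀ t ∈ Icc (0:ℝ) ℓ, γ t ∈ Ω) →
      ENNReal.ofReal |u (γ ℓ) - u (γ 0)| ≤ ∫⁻ t in Icc (0:ℝ) ℓ, g (γ t)

/-- `g` is an upper gradient of `u` on all of `X`. -/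
def IsUpperGradient (g : X → ℝ≥0∞) (u : X → ℝ) : Prop :=
  IsUpperGradientOn g u univ

/-- The (extended) `L¹` norm. -/
def eL1Norm (μ : Measure X) (u : X → ℝ) : ℝ≥0∞ :=
  ∫⁻ x, ENNReal.ofReal |u x| ∂μ

/-- The (extended) Newtonian `N^{1,1}` norm. -/
def eN11Norm (μ : Measure X) (u : X → ℝ) : ℝ≥0∞ :=
  eL1Norm μ u + ⨅ (g : X → ℝ≥0∞) (_ : IsUpperGradient g u), ∫⁻ x, g x ∂μ

/-- Membership in the Newtonian space `N^{1,1}(X)`. -/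
def MemN11 (μ : Measure X) (u : X → ℝ) : Prop :=
  Measurable u ∧ eN11Norm μ u < ⊤

/-- The `1`-capacity of a set. -/
def capacity1 (μ : Measure X) (A : Set X) : ℝ≥0∞ :=
  ⨅ (u : X → ℝ) (_ : MemN11 μ u) (_ : ∀ x ∈ A, 1 ≤ u x), eN11Norm μ u

/-- The relative (variational) `1`-capacity of `A` with respect to `Ω`. -/
def relCapacity1 (μ : Measure X) (A Ω : Set X) : ℝ≥0∞ :=
  ⨅ (u : X → ℝ) (_ : MemN11 μ u) (g : X → ℝ≥0∞) (_ : IsUpperGradient g u)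
    (_ : ∀ x ∈ A, 1 ≤ u x) (_ : ∀ x, x ∉ Ω → u x = 0),
    ∫⁻ x in Ω, g x ∂μ

/-- `A` is `1`-thin at `x`. -/
def OneThinAt (μ : Measure X) (A : Set X) (x : X) : Prop :=
  Tendsto (fun r : ℝ =>
      ENNReal.ofReal r * relCapacity1 μ (A ∩ ball x r) (ball x (2 * r)) / μ (ball x r))
    (𝓝[>] 0) (𝓝 0)

/-- `U` is `1`-finely open. -/
def OneFinelyOpen (μ : Measure X) (U : Set X) : Prop :=
  ∀ x ∈ U, OneThinAt μ Uᶜ x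

/-- `F` is `1`-finely closed. -/
def OneFinelyClosed (μ : Measure X) (F : Set X) : Prop :=
  OneFinelyOpen μ Fᶜ

/-- The `1`-fine closure: the smallest `1`-finely closed set containing `G`. -/
def oneFineClosure (μ : Measure X) (G : Set X) : Set X :=
  ⋂₀ {F : Set X | G ⊆ F ∧ OneFinelyClosed μ F}

/-- `μ` is doubling with constant `Cd`: balls have positive finite measure and
`μ(B(x,2r)) ≤ Cd · μ(B(x,r))`. -/
def DoublingWith (μ : Measure X) (Cd : ℝ≥0) : Prop :=
  ∀ (x : X) (r : ℝ), 0 < r →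
    0 < μ (ball x r) ∧ μ (ball x (2 * r)) ≤ (Cd : ℝ≥0∞) * μ (ball x r) ∧ μ (ball x r) < ⊤

/-- `u` is Lipschitz on compact subsets of `Ω` (locally Lipschitz in `Ω`). -/
def LocLipschitzOn (u : X → ℝ) (Ω : Set X) : Prop :=
  ∀ K : Set X, K ⊆ Ω → IsCompact K → ∃ L : ℝ≥0, LipschitzOnWith L u K

/-- The total variation `‖Du‖(Ω)`. -/
def totalVariation (μ : Measure X) (u : X → ℝ) (Ω : Set X) : ℝ≥0∞ :=
  ⨅ (v : ℕ → X → ℝ) (g : ℕ → X → ℝ≥0∞)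
    (_ : ∀ i, LocLipschitzOn (v i) Ω)
    (_ : ∀ i, IsUpperGradientOn (g i) (v i) Ω)
    (_ : ∀ K : Set X, K ⊆ Ω → IsCompact K →
        Tendsto (fun i => ∫⁻ x in K, ENNReal.ofReal |v i x - u x| ∂μ) atTop (𝓝 0)),
    Filter.atTop.liminf fun i => ∫⁻ x in Ω, g i x ∂μ

/-- The perimeter `P(E,Ω) = ‖Dχ_E‖(Ω)`. -/
def perimeter (μ : Measure X) (E Ω : Set X) : ℝ≥0∞ :=
  totalVariation μ (Set.indicator E fun _ => (1 : ℝ)) Ω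

/-- `u ∈ BV(X)`. -/
def MemBV (μ : Measure X) (u : X → ℝ) : Prop :=
  Integrable u μ ∧ totalVariation μ u univ < ⊤

/-- The (extended) `BV` norm. -/
def eBVNorm (μ : Measure X) (u : X → ℝ) : ℝ≥0∞ :=
  eL1Norm μ u + totalVariation μ u univ

/-- The `(1,1)`-Poincaré inequality with constants `CP`, `lam`. -/
def PoincareIneq (μ : Measure X) (CP lam : ℝ) : Prop :=
  ∀ (x : X) (r : ℝ), 0 < r → ∀ (u : X → ℝ) (g : X → ℝ≥0∞),
    LocallyIntegrable u μ → IsUpperGradient g u →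
    (∫⁻ y in ball x r, ENNReal.ofReal |u y - ⨍ z in ball x r, u z ∂μ| ∂μ) / μ (ball x r)
      ≤ ENNReal.ofReal (CP * r) * ((∫⁻ y in ball x (lam * r), g y ∂μ) / μ (ball x (lam * r)))

/-- The restricted spherical Hausdorff content of codimension 1, at scale `R`. -/
def codimHContent (μ : Measure X) (R : ℝ) (A : Set X) : ℝ≥0∞ :=
  ⨅ (c : ℕ → X) (r : ℕ → ℝ) (_ : ∀ i, 0 < r i ∧ r i ≤ R)
    (_ : A ⊆ ⋃ i, ball (c i) (r i)),
    ∑' i, μ (ball (c i) (r i)) / ENNReal.ofReal (r i)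

/-- The codimension 1 Hausdorff measure `H(A) = lim_{R→0⁺} H_R(A)`. -/
def codimH (μ : Measure X) (A : Set X) : ℝ≥0∞ :=
  ⨆ (R : ℝ) (_ : 0 < R), codimHContent μ R A

/-- The measure-theoretic interior `I_E`. -/
def measInterior (μ : Measure X) (E : Set X) : Set X :=
  {x | Tendsto (fun r : ℝ => μ (ball x r \ E) / μ (ball x r)) (𝓝[>] 0) (𝓝 0)}

/-- The measure-theoretic boundary `∂*E`. -/
def measBoundary (μ : Measure X) (E : Set X) : Set X :=
  {x | 0 < limsup (fun r : ℝ => μ (ball x r ∩ E) / μ (ball x r)) (𝓝[>] 0) ∧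
       0 < limsup (fun r : ℝ => μ (ball x r \ E) / μ (ball x r)) (𝓝[>] 0)}

/-- The lower approximate limit `u^∧`. -/
def lowerApprox (μ : Measure X) (u : X → ℝ) (x : X) : EReal :=
  sSup {t : EReal |
    Tendsto (fun r : ℝ => μ (ball x r ∩ {y | (u y : EReal) < t}) / μ (ball x r))
      (𝓝[>] 0) (𝓝 0)}

/-- The upper approximate limit `u^∨`. -/
def upperApprox (μ : Measure X) (u : X → ℝ) (x : X) : EReal :=
  sInf {t : EReal |
    Tendsto (fun r : ℝ => μ (ball x r ∩ {y | t < (u y : EReal)}) / μ (ball x r))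
      (𝓝[>] 0) (𝓝 0)}

/-- The next jump value after the value `p` at `x`. -/
def jumpNext (μ : Measure X) (u : X → ℝ) (p : EReal) (x : X) : EReal :=
  sSup {t : EReal | ∀ δ : ℝ, 0 < δ →
    Tendsto (fun r : ℝ =>
        μ (ball x r ∩ {y | p + (δ : EReal) < (u y : EReal) ∧ (u y : EReal) < t}) /
          μ (ball x r))
      (𝓝[>] 0) (𝓝 0)}

/-- Auxiliary jump values: `jumpAux μ u (l-1)` is the `l`-th jump value for `l < n`. -/
def jumpAux (μ : Measure X) (u : X → ℝ) : ℕ → X → EReal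
  | 0 => lowerApprox μ u
  | (l + 1) => fun x =>
      if jumpAux μ u l x < upperApprox μ u x then jumpNext μ u (jumpAux μ u l x) x
      else upperApprox μ u x

/-- The jump values `u^l`, `l = 1, …, n`, with `u^1 = u^∧` and `u^n = u^∨`. -/
def jumpVal (μ : Measure X) (u : X → ℝ) (n l : ℕ) : X → EReal :=
  if l = n then upperApprox μ u else jumpAux μ u (l - 1)

/-- The extended absolute difference `|a - b|` of two extended reals, with the
convention that it is `∞` whenever exactly one of them is infinite or they are
distinct infinities, and `0` when `a = b`. -/
def eAbsDiff (a b : EReal) : ℝ≥0∞ :=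
  if a = b then 0
  else if a = ⊤ ∨ a = ⊥ ∨ b = ⊤ ∨ b = ⊥ then ⊤
  else ENNReal.ofReal |a.toReal - b.toReal|

/-- `γ` satisfies the density-bound property: for every set of finite perimeter `E`,
`H`-a.e. point of `∂*E` has lower density `≥ γ` and upper density `≤ 1 - γ`. -/
def GammaDensityProperty (μ : Measure X) (γ : ℝ) : Prop :=
  ∀ E : Set X, MeasurableSet E → perimeter μ E univ < ⊤ →
    codimH μ {x ∈ measBoundary μ E |
      ¬ (ENNReal.ofReal γ ≤
            Filter.liminf (fun r : ℝ => μ (ball x r ∩ E) / μ (ball x r)) (𝓝[>] 0) ∧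
          Filter.limsup (fun r : ℝ => μ (ball x r ∩ E) / μ (ball x r)) (𝓝[>] 0) ≤
            ENNReal.ofReal (1 - γ))} = 0

/-- `v` is a discrete convolution of `u` at scale `R` (with dilation parameter `lam`). -/
def IsDiscreteConvolution (μ : Measure X) (lam R : ℝ) (u v : X → ℝ) : Prop :=
  ∃ (c : ℕ → X) (φ : ℕ → X → ℝ),
    (∀ z : X, ∃ j, z ∈ ball (c j) R) ∧
    (∃ C₀ : ℕ, ∀ k : ℕ,
      {j : ℕ | (ball (c j) (10 * lam * R) ∩ ball (c k) (10 * lam * R)).Nonempty}.Finite ∧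
      {j : ℕ | (ball (c j) (10 * lam * R) ∩ ball (c k) (10 * lam * R)).Nonempty}.ncard ≤ C₀) ∧
    (∀ j z, 0 ≤ φ j z ∧ φ j z ≤ 1) ∧
    (∃ L : ℝ≥0, ∀ j, LipschitzWith (L * (Real.toNNReal R)⁻¹) (φ j)) ∧
    (∀ j, tsupport (φ j) ⊆ ball (c j) (2 * R)) ∧
    (∀ z : X, HasSum (fun j => φ j z) 1) ∧
    (∀ z : X, v z = ∑' j, (⨍ y in ball (c j) (5 * R), u y ∂μ) * φ j z)




/-! ### Doubling measures -/

section Doubling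

variable {μ : Measure X} {Cd : ℝ≥0}

lemma DoublingWith.measure_ball_ne_zero (h : DoublingWith μ Cd) {x : X} {r : ℝ} (hr : 0 < r) :
    μ (ball x r) ≠ 0 := (h x r hr).1.ne'

lemma DoublingWith.measure_ball_ne_top (h : DoublingWith μ Cd) (x : X) (r : ℝ) :
    μ (ball x r) ≠ ⊤ := by
  rcases le_or_gt r 0 with hr | hr
  · simp [ball_eq_empty.2 hr]
  · exact (h x r hr).2.2.ne

lemma DoublingWith.exists_ball_mul_le (h : DoublingWith μ Cd) (A : ℝ) :
    ∃ C : ℝ≥0, ∀ (x : X) (r : ℝ), 0 < r → μ (ball x (A * r)) ≤ C * μ (ball x r) := by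
  have key : ∀ k : ℕ, ∀ (x : X) (r : ℝ), 0 < r →
      μ (ball x (2 ^ k * r)) ≤ ((Cd ^ k : ℝ≥0) : ℝ≥0∞) * μ (ball x r) := by
    intro k
    induction k with
    | zero => intro x r _; simp
    | succ k ih =>
      intro x r hr
      have h1 := (h x (2 ^ k * r) (by positivity)).2.1
      calc μ (ball x (2 ^ (k + 1) * r)) = μ (ball x (2 * (2 ^ k * r))) := by
            congr 2; ring
        _ ≤ Cd * (((Cd ^ k : ℝ≥0) : ℝ≥0∞) * μ (ball x r)) := h1.trans (by gcongr; exact ih x r hr)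
        _ = _ := by push_cast; ring
  obtain ⟨k, hk⟩ := pow_unbounded_of_one_lt A (one_lt_two : (1 : ℝ) < 2)
  refine ⟨Cd ^ k, fun x r hr => (measure_mono (ball_subset_ball ?_)).trans (key k x r hr)⟩
  gcongr

lemma DoublingWith.isLocallyFiniteMeasure (h : DoublingWith μ Cd) : IsLocallyFiniteMeasure μ :=
  ⟨fun x => ⟨ball x 1, ball_mem_nhds x one_pos, (h.measure_ball_ne_top x 1).lt_top⟩⟩

lemma DoublingWith.measure_closedBall_ne_top (h : DoublingWith μ Cd) (x : X) (r : ℝ) :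
    μ (closedBall x r) ≠ ⊤ :=
  ne_top_of_le_ne_top (h.measure_ball_ne_top x (r + 1))
    (measure_mono (closedBall_subset_ball (by linarith)))

lemma DoublingWith.isUnifLocDoublingMeasure (h : DoublingWith μ Cd) :
    IsUnifLocDoublingMeasure μ := by
  obtain ⟨C, hC⟩ := h.exists_ball_mul_le 3
  refine ⟨C, ?_⟩
  filter_upwards [self_mem_nhdsWithin] with r hr x
  have hr : 0 < r := hr
  calc μ (closedBall x (2 * r)) ≤ μ (ball x (3 * r)) :=
        measure_mono (closedBall_subset_ball (by linarith))
    _ ≤ C * μ (ball x r) := hC x r hr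
    _ ≤ C * μ (closedBall x r) := by gcongr; exact ball_subset_closedBall

/-- The measures of the balls of radius `s` with centers in a bounded set are bounded below. -/
lemma DoublingWith.exists_le_measure_ball (h : DoublingWith μ Cd) (x : X) {M s : ℝ}
    (hM : 0 < M) (hs : 0 < s) :
    ∃ c : ℝ≥0∞, c ≠ 0 ∧ ∀ y ∈ closedBall x M, c ≤ μ (ball y s) := by
  obtain ⟨C, hC⟩ := h.exists_ball_mul_le (2 * M / s)
  refine ⟨μ (ball x M) / C, ?_, fun y hy => ?_⟩
  · exact ENNReal.div_ne_zero.2 ⟨h.measure_ball_ne_zero hM, ENNReal.coe_ne_top⟩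
  · refine ENNReal.div_le_of_le_mul' ((measure_mono ?_).trans (hC y s hs))
    rw [div_mul_cancel₀ _ hs.ne']
    refine ball_subset_ball' ?_
    rw [mem_closedBall, dist_comm] at hy
    linarith

lemma DoublingWith.properSpace [CompleteSpace X] [BorelSpace X] (h : DoublingWith μ Cd) :
    ProperSpace X := by
  refine ⟨fun x r => ?_⟩
  rcases lt_or_ge r 0 with hr | hr
  · simp [closedBall_eq_empty.2 hr]
  refine isCompact_iff_totallyBounded_isComplete.2
    ⟨Metric.totallyBounded_iff.2 fun ε hε => ?_, isClosed_closedBall.isComplete⟩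
  obtain ⟨u, hu, hdisj, hcov⟩ := Vitali.exists_disjoint_subfamily_covering_enlargement_closedBall
    (closedBall x r) id (fun _ => ε / 8) (ε / 8) (fun _ _ => le_rfl) 4 (by norm_num)
  obtain ⟨c, hc0, hc⟩ := h.exists_le_measure_ball x (M := r + 1) (s := ε / 8) (by linarith)
    (by positivity)
  have hfin : u.Finite := by
    have := Measure.finite_const_le_meas_of_disjoint_iUnion μ (pos_iff_ne_zero.2 hc0)
      (As := fun y : u => closedBall (y : X) (ε / 8)) (fun _ => measurableSet_closedBall)
      (fun a b hab => hdisj a.2 b.2 (fun e => hab (Subtype.ext e)))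
      (ne_top_of_le_ne_top (h.measure_closedBall_ne_top x (r + ε / 8)) (measure_mono ?_))
    · rw [← Set.finite_coe_iff]
      refine Set.finite_univ_iff.1 (this.subset fun y _ => ?_)
      refine (hc y (closedBall_subset_closedBall (by linarith) (hu y.2))).trans
        (measure_mono ball_subset_closedBall)
    · refine iUnion_subset fun y => closedBall_subset_closedBall' ?_
      have := mem_closedBall.1 (hu y.2)
      linarith
  refine ⟨u, hfin, fun y hy => ?_⟩
  obtain ⟨b, hb, hsub⟩ := hcov y hy
  refine mem_iUnion₂.2 ⟨b, hb, ?_⟩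
  have := hsub (mem_closedBall_self (by positivity))
  simp only [id, mem_closedBall] at this
  rw [mem_ball]; linarith

end Doubling


/-! ### Calculus of upper gradients -/

section UpperGradient

lemma IsUpperGradientOn.mono_set {g : X → ℝ≥0∞} {u : X → ℝ} {Ω Ω' : Set X}
    (h : IsUpperGradientOn g u Ω) (hsub : Ω' ⊆ Ω) : IsUpperGradientOn g u Ω' :=
  ⟨h.1, fun ℓ hℓ γ hγ hΩ => h.2 ℓ hℓ γ hγ fun t ht => hsub (hΩ t ht)⟩

lemma IsUpperGradientOn.le_setLIntegral_Icc {g : X → ℝ≥0∞} {u : X → ℝ} {Ω : Set X}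
    (h : IsUpperGradientOn g u Ω) {a b : ℝ} (hab : a ≤ b) {γ : ℝ → X}
    (hγ : LipschitzOnWith 1 γ (Icc a b)) (hΩ : ∀ t ∈ Icc a b, γ t ∈ Ω) :
    ENNReal.ofReal |u (γ b) - u (γ a)| ≤ ∫⁻ t in Icc a b, g (γ t) := by
  have hmaps : MapsTo (fun t => a + t) (Icc 0 (b - a)) (Icc a b) := fun t ht =>
    ⟨by linarith [ht.1], by linarith [ht.2]⟩
  have h1 := h.2 (b - a) (by linarith) (fun t => γ (a + t)) ?_ fun t ht => hΩ _ (hmaps ht)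
  · have h2 := (measurePreserving_add_left (volume : Measure ℝ) a).setLIntegral_comp_emb
      (measurableEmbedding_addLeft a) (fun t => g (γ t)) (Icc 0 (b - a))
    have h3 : (fun t => a + t) '' Icc 0 (b - a) = Icc a b := by
      rw [Set.image_const_add_Icc]; simp
    rw [h3] at h2
    simpa [h2] using h1
  · intro x hx y hy
    simpa using hγ (hmaps hx) (hmaps hy)

/-- Being an upper gradient is a local property. -/
lemma isUpperGradient_of_locally {G : X → ℝ≥0∞} {f : X → ℝ} (hG : Measurable G)
    (h : ∀ x, ∃ ρ > 0, IsUpperGradientOn G f (ball x ρ)) : IsUpperGradient G f := by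
  refine ⟨hG, fun ℓ hℓ γ hγ _ => ?_⟩
  choose ρ hρ hug using h
  have hcont : Continuous fun t : Icc (0 : ℝ) ℓ => γ t :=
    continuousOn_iff_continuous_domRestrict.1 hγ.continuousOn
  obtain ⟨t, ht0, hmono, ⟨m, hm⟩, hsub⟩ := exists_monotone_Icc_subset_open_cover_Icc hℓ
    (c := fun x => {t : Icc (0 : ℝ) ℓ | γ t ∈ ball x (ρ x)})
    (fun x => isOpen_ball.preimage hcont)
    (fun s _ => mem_iUnion.2 ⟨γ s, mem_ball_self (hρ _)⟩)
  have key : ∀ n, ENNReal.ofReal |f (γ (t n)) - f (γ 0)| ≤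
      ∫⁻ s in Icc (0 : ℝ) (t n), G (γ s) := by
    intro n
    induction n with
    | zero => simp [ht0]
    | succ n ih =>
      obtain ⟨x, hx⟩ := hsub n
      have hle : (t n : ℝ) ≤ t (n + 1) := hmono (Nat.le_succ n)
      have hI : Icc (t n : ℝ) (t (n + 1)) ⊆ Icc 0 ℓ :=
        Icc_subset_Icc (t n).2.1 (t (n + 1)).2.2
      have h1 := (hug x).le_setLIntegral_Icc hle (hγ.mono hI)
        (fun s hs => hx (a := ⟨s, hI hs⟩) ⟨hs.1, hs.2⟩)
      calc ENNReal.ofReal |f (γ (t (n + 1))) - f (γ 0)|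
          ≤ ENNReal.ofReal (|f (γ (t n)) - f (γ 0)| + |f (γ (t (n + 1))) - f (γ (t n))|) := by
            refine ENNReal.ofReal_le_ofReal ?_
            have := abs_add_le (f (γ (t n)) - f (γ 0)) (f (γ (t (n + 1))) - f (γ (t n)))
            rwa [show f (γ (t n)) - f (γ 0) + (f (γ (t (n + 1))) - f (γ (t n))) =
              f (γ (t (n + 1))) - f (γ 0) by ring] at this
        _ ≤ (∫⁻ s in Icc (0 : ℝ) (t n), G (γ s)) + ∫⁻ s in Icc (t n : ℝ) (t (n + 1)), G (γ s) := by
            rw [ENNReal.ofReal_add (abs_nonneg _) (abs_nonneg _)]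
            exact add_le_add ih h1
        _ = (∫⁻ s in Icc (0 : ℝ) (t n), G (γ s)) + ∫⁻ s in Ioc (t n : ℝ) (t (n + 1)), G (γ s) := by
            rw [setLIntegral_congr Ioc_ae_eq_Icc]
        _ = ∫⁻ s in Icc (0 : ℝ) (t (n + 1)), G (γ s) := by
            rw [← lintegral_union measurableSet_Ioc, Icc_union_Ioc_eq_Icc (t n).2.1 hle]
            exact disjoint_left.2 fun s hs hs' => not_lt.2 hs.2 hs'.1
  simpa [hm m le_rfl] using key m

lemma isUpperGradientOn_const {G : X → ℝ≥0∞} {f : X → ℝ} {Ω : Set X} (hG : Measurable G) {c : ℝ}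
    (h : ∀ x ∈ Ω, f x = c) : IsUpperGradientOn G f Ω :=
  ⟨hG, fun ℓ hℓ γ _ hΩ => by
    simp [h _ (hΩ _ (left_mem_Icc.2 hℓ)), h _ (hΩ _ (right_mem_Icc.2 hℓ))]⟩

lemma IsUpperGradientOn.of_le {g G : X → ℝ≥0∞} {u f : X → ℝ} {Ω : Set X}
    (h : IsUpperGradientOn g u Ω) (hG : Measurable G) (hgG : ∀ x ∈ Ω, g x ≤ G x)
    (hf : ∀ x ∈ Ω, ∀ y ∈ Ω, |f x - f y| ≤ |u x - u y|) : IsUpperGradientOn G f Ω := by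
  refine ⟨hG, fun ℓ hℓ γ hγ hΩ => ?_⟩
  refine (ENNReal.ofReal_le_ofReal (hf _ (hΩ _ (right_mem_Icc.2 hℓ)) _
    (hΩ _ (left_mem_Icc.2 hℓ)))).trans ((h.2 ℓ hℓ γ hγ hΩ).trans ?_)
  exact setLIntegral_mono' measurableSet_Icc fun t ht => hgG _ (hΩ t ht)

lemma IsUpperGradientOn.const_mul {g : X → ℝ≥0∞} {u f : X → ℝ} {Ω : Set X}
    (h : IsUpperGradientOn g u Ω) (L : ℝ≥0)
    (hf : ∀ x ∈ Ω, ∀ y ∈ Ω, |f x - f y| ≤ L * |u x - u y|) :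
    IsUpperGradientOn (fun x => L * g x) f Ω := by
  refine ⟨h.1.const_mul _, fun ℓ hℓ γ hγ hΩ => ?_⟩
  rw [lintegral_const_mul' _ _ ENNReal.coe_ne_top]
  refine (ENNReal.ofReal_le_ofReal (hf _ (hΩ _ (right_mem_Icc.2 hℓ)) _
    (hΩ _ (left_mem_Icc.2 hℓ)))).trans ?_
  rw [ENNReal.ofReal_mul L.coe_nonneg, ENNReal.ofReal_coe_nnreal]
  gcongr
  exact h.2 ℓ hℓ γ hγ hΩ

/-- A general Leibniz-type rule: if the oscillation of `f` is controlled by those of `u` and `v`,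
with coefficients, then so are the upper gradients. -/
lemma IsUpperGradientOn.add_of_le [BorelSpace X] {g h : X → ℝ≥0∞} {u v f : X → ℝ} {Ω : Set X}
    (hu : IsUpperGradientOn g u Ω) (hv : IsUpperGradientOn h v Ω) (a b : ℝ≥0)
    (hf : ∀ x ∈ Ω, ∀ y ∈ Ω, |f x - f y| ≤ a * |u x - u y| + b * |v x - v y|) :
    IsUpperGradientOn (fun x => a * g x + b * h x) f Ω := by
  refine ⟨(hu.1.const_mul _).add (hv.1.const_mul _), fun ℓ hℓ γ hγ hΩ => ?_⟩
  have hγm : AEMeasurable γ (volume.restrict (Icc 0 ℓ)) :=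
    hγ.continuousOn.aemeasurable measurableSet_Icc
  change _ ≤ ∫⁻ t in Icc 0 ℓ, ((a : ℝ≥0∞) * g (γ t) + b * h (γ t))
  rw [lintegral_add_left' (f := fun t => (a : ℝ≥0∞) * g (γ t))
      ((hu.1.comp_aemeasurable hγm).const_mul _),
    lintegral_const_mul' _ _ ENNReal.coe_ne_top, lintegral_const_mul' _ _ ENNReal.coe_ne_top]
  refine (ENNReal.ofReal_le_ofReal (hf _ (hΩ _ (right_mem_Icc.2 hℓ)) _
    (hΩ _ (left_mem_Icc.2 hℓ)))).trans ?_
  rw [ENNReal.ofReal_add (by positivity) (by positivity), ENNReal.ofReal_mul a.coe_nonneg,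
    ENNReal.ofReal_mul b.coe_nonneg, ENNReal.ofReal_coe_nnreal, ENNReal.ofReal_coe_nnreal]
  gcongr
  · exact hu.2 ℓ hℓ γ hγ hΩ
  · exact hv.2 ℓ hℓ γ hγ hΩ

lemma LipschitzWith.isUpperGradientOn {f : X → ℝ} {L : ℝ≥0} (hf : LipschitzWith L f)
    (Ω : Set X) : IsUpperGradientOn (fun _ => (L : ℝ≥0∞)) f Ω := by
  refine ⟨measurable_const, fun ℓ hℓ γ hγ hΩ => ?_⟩
  have h1 := hf.dist_le_mul (γ ℓ) (γ 0)
  have h2 := hγ.dist_le_mul ℓ (right_mem_Icc.2 hℓ) 0 (left_mem_Icc.2 hℓ)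
  simp only [NNReal.coe_one, one_mul, Real.dist_eq, sub_zero, abs_of_nonneg hℓ] at h1 h2
  rw [setLIntegral_const, Real.volume_Icc, sub_zero, ← ENNReal.ofReal_coe_nnreal,
    ← ENNReal.ofReal_mul L.coe_nonneg]
  exact ENNReal.ofReal_le_ofReal (h1.trans (by gcongr))

/-- The Leibniz rule for upper gradients of continuous functions, with an arbitrarily small error
term. -/
lemma IsUpperGradient.mul [BorelSpace X] {g h : X → ℝ≥0∞} {v k : X → ℝ}
    (hv : IsUpperGradient g v) (hk : IsUpperGradient h k) (hvc : Continuous v)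
    (hkc : Continuous k) {ε : ℝ} (hε : 0 < ε) :
    IsUpperGradient (fun x => ENNReal.ofReal (|k x| + ε) * g x + ENNReal.ofReal (|v x| + ε) * h x)
      (fun x => v x * k x) := by
  have hm : Measurable fun x =>
      ENNReal.ofReal (|k x| + ε) * g x + ENNReal.ofReal (|v x| + ε) * h x := by
    have h1 : Continuous fun x => |k x| + ε := by fun_prop
    have h2 : Continuous fun x => |v x| + ε := by fun_prop
    exact (h1.measurable.ennreal_ofReal.mul hv.1).add (h2.measurable.ennreal_ofReal.mul hk.1)
  refine isUpperGradient_of_locally hm fun x => ?_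
  obtain ⟨r₁, hr₁, h₁⟩ := Metric.continuousAt_iff.1 (hvc.continuousAt (x := x)) (ε / 2)
    (half_pos hε)
  obtain ⟨r₂, hr₂, h₂⟩ := Metric.continuousAt_iff.1 (hkc.continuousAt (x := x)) (ε / 2)
    (half_pos hε)
  refine ⟨min r₁ r₂, lt_min hr₁ hr₂, ?_⟩
  have hv' : ∀ y ∈ ball x (min r₁ r₂), |v y - v x| < ε / 2 := fun y hy =>
    h₁ (lt_of_lt_of_le hy (min_le_left _ _))
  have hk' : ∀ y ∈ ball x (min r₁ r₂), |k y - k x| < ε / 2 := fun y hy =>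
    h₂ (lt_of_lt_of_le hy (min_le_right _ _))
  have key := (hv.mono_set (subset_univ (ball x (min r₁ r₂)))).add_of_le
    (hk.mono_set (subset_univ (ball x (min r₁ r₂)))) (f := fun x => v x * k x)
    (Real.toNNReal (|k x| + ε / 2)) (Real.toNNReal (|v x| + ε / 2)) ?_
  · refine key.of_le hm (fun y hy => ?_) fun _ _ _ _ => le_rfl
    change ENNReal.ofReal _ * _ + ENNReal.ofReal _ * _ ≤ _
    refine add_le_add (mul_le_mul_left (ENNReal.ofReal_le_ofReal ?_) _)
      (mul_le_mul_left (ENNReal.ofReal_le_ofReal ?_) _)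
    · have := abs_sub_abs_le_abs_sub (k x) (k y)
      have := hk' y hy
      rw [abs_sub_comm] at this
      linarith
    · have := abs_sub_abs_le_abs_sub (v x) (v y)
      have := hv' y hy
      rw [abs_sub_comm] at this
      linarith
  · intro y hy z hz
    rw [Real.coe_toNNReal _ (by positivity), Real.coe_toNNReal _ (by positivity)]
    have e : v y * k y - v z * k z = k y * (v y - v z) + v z * (k y - k z) := by ring
    rw [e]
    refine (abs_add_le _ _).trans ?_
    rw [abs_mul, abs_mul]
    gcongr
    · have := abs_sub_abs_le_abs_sub (k y) (k x)
      linarith [hk' y hy]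
    · have := abs_sub_abs_le_abs_sub (v z) (v x)
      linarith [hv' z hz]

end UpperGradient


/-! ### Total variation -/

section TotalVariation

lemma LocLipschitzOn.continuous [ProperSpace X] {v : X → ℝ} (h : LocLipschitzOn v univ) :
    Continuous v := by
  refine continuous_iff_continuousAt.2 fun x => ?_
  obtain ⟨L, hL⟩ := h (closedBall x 1) (subset_univ _) (isCompact_closedBall x 1)
  exact hL.continuousOn.continuousAt (closedBall_mem_nhds x one_pos)

lemma LocLipschitzOn.comp_lipschitz {v : X → ℝ} {Ω : Set X} (h : LocLipschitzOn v Ω)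
    {φ : ℝ → ℝ} {L : ℝ≥0} (hφ : LipschitzWith L φ) : LocLipschitzOn (fun x => φ (v x)) Ω :=
  fun K hK hKc => by
    obtain ⟨M, hM⟩ := h K hK hKc
    exact ⟨L * M, hφ.comp_lipschitzOnWith hM⟩

lemma LocLipschitzOn.min {v w : X → ℝ} {Ω : Set X} (hv : LocLipschitzOn v Ω)
    (hw : LocLipschitzOn w Ω) : LocLipschitzOn (fun x => min (v x) (w x)) Ω :=
  fun K hK hKc => by
    obtain ⟨L, hL⟩ := hv K hK hKc
    obtain ⟨M, hM⟩ := hw K hK hKc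
    refine ⟨L ⊔ M, LipschitzOnWith.of_dist_le_mul fun x hx y hy => ?_⟩
    have h1 := hL.dist_le_mul x hx y hy
    have h2 := hM.dist_le_mul x hx y hy
    rw [Real.dist_eq] at *
    refine (abs_min_sub_min_le_max _ _ _ _).trans (max_le (h1.trans ?_) (h2.trans ?_))
    · gcongr; exact le_max_left _ _
    · gcongr; exact le_max_right _ _

lemma LocLipschitzOn.mul {v w : X → ℝ} {Ω : Set X} (hv : LocLipschitzOn v Ω)
    (hw : LocLipschitzOn w Ω) : LocLipschitzOn (fun x => v x * w x) Ω :=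
  fun K hK hKc => by
    obtain ⟨L, hL⟩ := hv K hK hKc
    obtain ⟨M, hM⟩ := hw K hK hKc
    obtain ⟨A, hA⟩ := hKc.exists_bound_of_continuousOn hL.continuousOn
    obtain ⟨B, hB⟩ := hKc.exists_bound_of_continuousOn hM.continuousOn
    refine ⟨Real.toNNReal (|A| * M + |B| * L), LipschitzOnWith.of_dist_le_mul fun x hx y hy => ?_⟩
    have h1 := hL.dist_le_mul x hx y hy
    have h2 := hM.dist_le_mul x hx y hy
    rw [Real.coe_toNNReal _ (by positivity)]
    rw [Real.dist_eq] at *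
    have e : v x * w x - v y * w y = v x * (w x - w y) + w y * (v x - v y) := by ring
    rw [e]
    refine (abs_add_le _ _).trans ?_
    rw [abs_mul, abs_mul]
    have h3 : |v x| ≤ |A| := (hA x hx).trans (le_abs_self A)
    have h4 : |w y| ≤ |B| := (hB y hy).trans (le_abs_self B)
    calc |v x| * |w x - w y| + |w y| * |v x - v y|
        ≤ |A| * (M * dist x y) + |B| * (L * dist x y) := by gcongr
      _ = _ := by ring

lemma exists_of_totalVariation_lt {μ : Measure X} {u : X → ℝ} {c : ℝ≥0∞}
    (h : totalVariation μ u univ < c) {K : Set X} (hK : IsCompact K) {ε : ℝ≥0∞} (hε : ε ≠ 0) :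
    ∃ (v : X → ℝ) (g : X → ℝ≥0∞), LocLipschitzOn v univ ∧ IsUpperGradient g v ∧
      ∫⁻ x, g x ∂μ < c ∧ ∫⁻ x in K, ENNReal.ofReal |v x - u x| ∂μ < ε := by
  simp only [totalVariation, iInf_lt_iff] at h
  obtain ⟨v, g, hv, hg, hconv, hlim⟩ := h
  have h1 := frequently_lt_of_liminf_lt (by isBoundedDefault) hlim
  have h2 := (hconv K (subset_univ K) hK).eventually_lt_const (pos_iff_ne_zero.2 hε)
  obtain ⟨i, hi1, hi2⟩ := (h1.and_eventually h2).exists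
  exact ⟨v i, g i, hv i, hg i, by simpa using hi1, hi2⟩

lemma totalVariation_add_le [ProperSpace X] [Nonempty X] {μ : Measure X} {u : X → ℝ}
    {a c : ℝ≥0∞}
    (h : ∀ K : Set X, IsCompact K → ∀ ε : ℝ≥0∞, ε ≠ 0 → ∃ (v : X → ℝ) (g : X → ℝ≥0∞),
      LocLipschitzOn v univ ∧ IsUpperGradient g v ∧ ∫⁻ x, g x ∂μ + a ≤ c + ε ∧
        ∫⁻ x in K, ENNReal.ofReal |v x - u x| ∂μ ≤ ε) :
    totalVariation μ u univ + a ≤ c := by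
  obtain ⟨x₀⟩ := ‹Nonempty X›
  have hε : ∀ i : ℕ, ((i : ℝ≥0∞) + 1)⁻¹ ≠ 0 := fun i => by simp
  choose v g hv hg hgi hvi using fun i : ℕ =>
    h (closedBall x₀ i) (isCompact_closedBall x₀ i) _ (hε i)
  have hlim : Tendsto (fun i : ℕ => ((i : ℝ≥0∞) + 1)⁻¹) atTop (𝓝 0) := by
    have := ENNReal.tendsto_inv_nat_nhds_zero.comp (tendsto_add_atTop_nat 1)
    refine this.congr fun i => ?_
    simp
  have hle : totalVariation μ u univ ≤ liminf (fun i => ∫⁻ x, g i x ∂μ) atTop := by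
    refine iInf₂_le_of_le v g (iInf_le_of_le hv (iInf_le_of_le hg (iInf_le_of_le ?_ (by simp))))
    intro K _ hK
    refine tendsto_of_tendsto_of_tendsto_of_le_of_le' tendsto_const_nhds hlim
      (Eventually.of_forall fun _ => zero_le) ?_
    obtain ⟨R, hR⟩ := hK.isBounded.subset_closedBall x₀
    filter_upwards [eventually_ge_atTop ⌈R⌉₊] with i hi
    exact (lintegral_mono_set (hR.trans (closedBall_subset_closedBall (Nat.ceil_le.1 hi)))).trans
      (hvi i)
  refine ENNReal.le_of_forall_pos_le_add fun ε hε0 hc => ?_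
  have hac : ∀ᶠ i in atTop, ∫⁻ x, g i x ∂μ + a ≤ c + ε := by
    filter_upwards [hlim.eventually_lt_const (ENNReal.coe_pos.2 hε0)] with i hi
    exact (hgi i).trans (by gcongr)
  have ha : a ≤ c + ε := by
    obtain ⟨i, hi⟩ := hac.exists
    exact le_add_self.trans hi
  have hatop : a ≠ ⊤ := ne_top_of_le_ne_top (by simp [hc.ne]) ha
  have : liminf (fun i => ∫⁻ x, g i x ∂μ) atTop ≤ c + ε - a :=
    liminf_le_of_frequently_le' (hac.mono fun i hi =>
      ENNReal.le_sub_of_add_le_right hatop hi).frequently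
  calc totalVariation μ u univ + a ≤ (c + ε - a) + a := by gcongr; exact hle.trans this
    _ = c + ε := tsub_add_cancel_of_le ha

lemma totalVariation_le [ProperSpace X] [Nonempty X] {μ : Measure X} {u : X → ℝ} {c : ℝ≥0∞}
    (h : ∀ K : Set X, IsCompact K → ∀ ε : ℝ≥0∞, ε ≠ 0 → ∃ (v : X → ℝ) (g : X → ℝ≥0∞),
      LocLipschitzOn v univ ∧ IsUpperGradient g v ∧ ∫⁻ x, g x ∂μ ≤ c + ε ∧
        ∫⁻ x in K, ENNReal.ofReal |v x - u x| ∂μ ≤ ε) :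
    totalVariation μ u univ ≤ c := by
  simpa using totalVariation_add_le (a := 0) (by simpa using h)

lemma perimeter_empty [ProperSpace X] [Nonempty X] (μ : Measure X) :
    perimeter μ (∅ : Set X) univ = 0 := by
  refine le_antisymm (totalVariation_le fun K _ ε _ => ⟨0, 0, ?_, ?_, by simp, by simp⟩) zero_le
  · exact fun K _ _ => ⟨0, (LipschitzWith.const (0 : ℝ)).lipschitzOnWith⟩
  · exact isUpperGradientOn_const measurable_const (c := 0) fun _ _ => rfl

lemma perimeter_compl_le [ProperSpace X] [Nonempty X] (μ : Measure X) (E : Set X) :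
    perimeter μ Eᶜ univ ≤ perimeter μ E univ := by
  rcases eq_or_ne (perimeter μ E univ) ⊤ with h | h
  · simp [h]
  refine totalVariation_le fun K hK ε hε => ?_
  obtain ⟨v, g, hv, hg, hgi, hvi⟩ := exists_of_totalVariation_lt
    (ENNReal.lt_add_right h hε) hK hε
  refine ⟨fun x => 1 - v x, g, ?_, ?_, hgi.le, ?_⟩
  · exact hv.comp_lipschitz (φ := fun t => 1 - t) (L := 1)
      (LipschitzWith.of_dist_le_mul fun a b => by
        rw [Real.dist_eq, Real.dist_eq, show 1 - a - (1 - b) = -(a - b) by ring, abs_neg]; simp)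
  · exact hg.of_le hg.1 (fun _ _ => le_rfl) fun x _ y _ => by
      rw [show 1 - v x - (1 - v y) = -(v x - v y) by ring, abs_neg]
  · refine le_trans (le_of_eq ?_) hvi.le
    congr with x
    by_cases hx : x ∈ E
    · simp [hx, abs_sub_comm]
    · simp only [mem_compl_iff, hx, not_false_eq_true, indicator_of_mem, indicator_of_notMem]
      rw [show 1 - v x - 1 = -(v x - 0) by ring, abs_neg]

lemma perimeter_inter_le [ProperSpace X] [Nonempty X] [BorelSpace X] (μ : Measure X)
    (E F : Set X) (hE : MeasurableSet E) :
    perimeter μ (E ∩ F) univ ≤ perimeter μ E univ + perimeter μ F univ := by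
  rcases eq_or_ne (perimeter μ E univ) ⊤ with h | h
  · simp [h]
  rcases eq_or_ne (perimeter μ F univ) ⊤ with h' | h'
  · simp [h']
  refine totalVariation_le fun K hK ε hε => ?_
  have hε2 : ε / 2 ≠ 0 := by simpa using hε
  obtain ⟨v, g, hv, hg, hgi, hvi⟩ := exists_of_totalVariation_lt
    (ENNReal.lt_add_right h hε2) hK hε2
  obtain ⟨w, k, hw, hk, hki, hwi⟩ := exists_of_totalVariation_lt
    (ENNReal.lt_add_right h' hε2) hK hε2
  have hmin : ∀ a b c d : ℝ, |min a b - min c d| ≤ |a - c| + |b - d| := fun a b c d =>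
    (abs_min_sub_min_le_max a b c d).trans (max_le_add_of_nonneg (abs_nonneg _) (abs_nonneg _))
  refine ⟨fun x => min (v x) (w x), fun x => (1 : ℝ≥0) * g x + (1 : ℝ≥0) * k x, hv.min hw, ?_,
    ?_, ?_⟩
  · exact hg.add_of_le hk 1 1 fun x _ y _ => by simpa using hmin (v x) (w x) (v y) (w y)
  · simp only [ENNReal.coe_one, one_mul]
    rw [lintegral_add_left hg.1]
    calc _ ≤ (totalVariation μ (E.indicator fun _ => (1 : ℝ)) univ + ε / 2) +
          (totalVariation μ (F.indicator fun _ => (1 : ℝ)) univ + ε / 2) :=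
          add_le_add hgi.le hki.le
      _ = _ := by
        rw [add_add_add_comm, ENNReal.add_halves]; rfl
  · calc _ ≤ ∫⁻ x in K, (ENNReal.ofReal |v x - E.indicator (fun _ => (1 : ℝ)) x| +
          ENNReal.ofReal |w x - F.indicator (fun _ => (1 : ℝ)) x|) ∂μ := by
          refine lintegral_mono fun x => ?_
          rw [← ENNReal.ofReal_add (abs_nonneg _) (abs_nonneg _)]
          refine ENNReal.ofReal_le_ofReal (le_trans (le_of_eq ?_) (hmin _ _ _ _))
          congr 2
          by_cases h1 : x ∈ E <;> by_cases h2 : x ∈ F <;> simp [h1, h2]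
      _ ≤ ε := by
          rw [lintegral_add_left]
          · exact (add_le_add hvi.le hwi.le).trans (ENNReal.add_halves ε).le
          · have : Measurable (E.indicator fun _ => (1 : ℝ)) := measurable_const.indicator hE
            exact ((hv.continuous.measurable.sub this).norm).ennreal_ofReal

end TotalVariation

/-! ### Weak limits of measures -/

section WeakLimit

open scoped CompactlySupported

lemma exists_weak_limit [ProperSpace X] [BorelSpace X] (ν : ℕ → Measure X) (M : ℝ≥0)
    (hν : ∀ i, ν i univ ≤ M) :
    ∃ (ω : Filter ℕ) (ν' : Measure X), ω.NeBot ∧ ω ≤ atTop ∧ IsFiniteMeasureOnCompacts ν' ∧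
      ∀ f : X → ℝ, Continuous f → HasCompactSupport f → (∀ x, 0 ≤ f x) →
        Tendsto (fun i => ∫⁻ x, ENNReal.ofReal (f x) ∂(ν i)) ω
          (𝓝 (∫⁻ x, ENNReal.ofReal (f x) ∂ν')) := by
  have hfin : ∀ i, IsFiniteMeasure (ν i) := fun i =>
    ⟨(hν i).trans_lt ENNReal.coe_lt_top⟩
  have hreal : ∀ i, (ν i).real univ ≤ M := fun i => by
    have := ENNReal.toReal_mono ENNReal.coe_ne_top (hν i)
    simpa [Measure.real] using this
  set ω : Ultrafilter ℕ := hyperfilter ℕ with hω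
  have hωle : (ω : Filter ℕ) ≤ atTop := by
    rw [← Nat.cofinite_eq_atTop]; exact hyperfilter_le_cofinite
  have hint : ∀ i (f : C_c(X, ℝ)), Integrable f (ν i) := fun i f =>
    f.continuous.integrable_of_hasCompactSupport f.hasCompactSupport
  have hlim : ∀ f : C_c(X, ℝ), ∃ a : ℝ, Tendsto (fun i => ∫ x, f x ∂(ν i)) ω (𝓝 a) := by
    intro f
    obtain ⟨B, hB⟩ := f.hasCompactSupport.exists_bound_of_continuous f.continuous
    have hcomp : IsCompact (Icc (-(|B| * M)) (|B| * M) : Set ℝ) := isCompact_Icc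
    have hmem : ∀ i, ∫ x, f x ∂(ν i) ∈ Icc (-(|B| * M)) (|B| * M) := by
      intro i
      refine abs_le.1 ?_
      refine (norm_integral_le_of_norm_le_const
        (Eventually.of_forall fun x => (hB x).trans (le_abs_self B))).trans ?_
      gcongr
      exact hreal i
    obtain ⟨a, -, ha⟩ := hcomp.ultrafilter_le_nhds (ω.map fun i => ∫ x, f x ∂(ν i))
      (by rw [le_principal_iff, Ultrafilter.coe_map]; exact mem_map.2 (Eventually.of_forall hmem))
    exact ⟨a, ha⟩
  choose l hl using hlim
  let Λ₀ : C_c(X, ℝ) →ₗ[ℝ] ℝ :=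
    { toFun := l
      map_add' := fun f g => by
        refine tendsto_nhds_unique (hl (f + g)) (((hl f).add (hl g)).congr fun i => ?_)
        rw [← integral_add (hint i f) (hint i g)]
        rfl
      map_smul' := fun c f => by
        refine tendsto_nhds_unique (hl (c • f)) (((hl f).const_smul c).congr fun i => ?_)
        rw [← integral_smul]
        rfl }
  let Λ : C_c(X, ℝ) →ₚ[ℝ] ℝ := PositiveLinearMap.mk₀ Λ₀ fun f hf =>
    ge_of_tendsto' (hl f) fun i => integral_nonneg fun x => hf x
  refine ⟨ω, RealRMK.rieszMeasure Λ, inferInstance, hωle, ?_, fun f hf hfc hf0 => ?_⟩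
  · unfold RealRMK.rieszMeasure; infer_instance
  · have hfm : IsFiniteMeasureOnCompacts (RealRMK.rieszMeasure Λ) := by
      unfold RealRMK.rieszMeasure; infer_instance
    let F : C_c(X, ℝ) := ⟨⟨f, hf⟩, hfc⟩
    have h1 : ∀ (m : Measure X) [IsFiniteMeasureOnCompacts m],
        ∫⁻ x, ENNReal.ofReal (f x) ∂m = ENNReal.ofReal (∫ x, F x ∂m) := fun m _ =>
      (ofReal_integral_eq_lintegral_ofReal (hf.integrable_of_hasCompactSupport hfc)
        (Eventually.of_forall hf0)).symm
    simp only [h1]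
    rw [RealRMK.integral_rieszMeasure]
    exact (ENNReal.continuous_ofReal.tendsto _).comp (hl F)

/-- A Lipschitz function equal to `1` on `ball y ρ` and vanishing off `ball y (2 * ρ)`. -/
def ballCutoff (y : X) (ρ : ℝ) (x : X) : ℝ := max 0 (min 1 (2 - dist x y / ρ))

lemma ballCutoff_nonneg (y : X) (ρ : ℝ) (x : X) : 0 ≤ ballCutoff y ρ x := le_max_left _ _

lemma ballCutoff_le_one (y : X) (ρ : ℝ) (x : X) : ballCutoff y ρ x ≤ 1 :=
  max_le zero_le_one (min_le_left _ _)

lemma ballCutoff_eq_one {y : X} {ρ : ℝ} (hρ : 0 < ρ) {x : X} (hx : x ∈ closedBall y ρ) :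
    ballCutoff y ρ x = 1 := by
  have : dist x y / ρ ≤ 1 := (div_le_one hρ).2 hx
  rw [ballCutoff, min_eq_left (by linarith), max_eq_right zero_le_one]

lemma ballCutoff_eq_zero {y : X} {ρ : ℝ} (hρ : 0 < ρ) {x : X} (hx : x ∉ ball y (2 * ρ)) :
    ballCutoff y ρ x = 0 := by
  have : 2 ≤ dist x y / ρ := by
    rw [le_div_iff₀ hρ]
    simpa using hx
  rw [ballCutoff, max_eq_left]
  exact (min_le_right _ _).trans (by linarith)

lemma lipschitzWith_ballCutoff (y : X) {ρ : ℝ} (hρ : 0 < ρ) :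
    LipschitzWith (Real.toNNReal ρ⁻¹) (ballCutoff y ρ) := by
  refine LipschitzWith.of_dist_le_mul fun a b => ?_
  rw [Real.coe_toNNReal _ (by positivity), Real.dist_eq, ballCutoff, ballCutoff]
  refine (abs_max_sub_max_le_max _ _ _ _).trans (max_le (by simp; positivity) ?_)
  refine (abs_min_sub_min_le_max _ _ _ _).trans (max_le (by simp; positivity) ?_)
  rw [show 2 - dist a y / ρ - (2 - dist b y / ρ) = -(ρ⁻¹ * (dist a y - dist b y)) by ring, abs_neg,
    abs_mul, abs_of_pos (inv_pos.2 hρ)]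
  gcongr
  exact abs_dist_sub_le _ _ _

lemma continuous_ballCutoff (y : X) {ρ : ℝ} (hρ : 0 < ρ) : Continuous (ballCutoff y ρ) :=
  (lipschitzWith_ballCutoff y hρ).continuous

lemma hasCompactSupport_ballCutoff [ProperSpace X] (y : X) {ρ : ℝ} (hρ : 0 < ρ) :
    HasCompactSupport (ballCutoff y ρ) :=
  HasCompactSupport.intro (isCompact_closedBall y (2 * ρ)) fun _ hx =>
    ballCutoff_eq_zero hρ fun h => hx (ball_subset_closedBall h)

lemma isUpperGradient_ballCutoff [BorelSpace X] (y : X) {ρ : ℝ} (hρ : 0 < ρ) :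
    IsUpperGradient ((ball y (3 * ρ)).indicator fun _ => (Real.toNNReal ρ⁻¹ : ℝ≥0∞))
      (ballCutoff y ρ) := by
  have hm : Measurable ((ball y (3 * ρ)).indicator fun _ => (Real.toNNReal ρ⁻¹ : ℝ≥0∞)) :=
    measurable_const.indicator measurableSet_ball
  refine isUpperGradient_of_locally hm fun x => ?_
  by_cases hx : x ∈ ball y (3 * ρ)
  · obtain ⟨δ, hδ, h⟩ := Metric.isOpen_iff.1 isOpen_ball x hx
    refine ⟨δ, hδ, (LipschitzWith.isUpperGradientOn (lipschitzWith_ballCutoff y hρ) _).of_le hm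
      (fun z hz => ?_) fun _ _ _ _ => le_rfl⟩
    rw [indicator_of_mem (h hz)]
  · refine ⟨ρ, hρ, isUpperGradientOn_const hm (c := 0) fun z hz => ballCutoff_eq_zero hρ fun h => ?_⟩
    rw [mem_ball] at *
    have := dist_triangle x z y
    rw [dist_comm z x] at hz
    linarith

lemma le_lintegral_ballCutoff [BorelSpace X] (ν : Measure X) (y : X) {ρ : ℝ} (hρ : 0 < ρ) :
    ν (closedBall y ρ) ≤ ∫⁻ x, ENNReal.ofReal (ballCutoff y ρ x) ∂ν := by
  rw [← lintegral_indicator_one measurableSet_closedBall]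
  refine lintegral_mono fun x => ?_
  by_cases hx : x ∈ closedBall y ρ
  · simp [hx, ballCutoff_eq_one hρ hx]
  · simp [hx]

lemma lintegral_ballCutoff_le [BorelSpace X] (ν : Measure X) (y : X) {ρ : ℝ} (hρ : 0 < ρ) :
    ∫⁻ x, ENNReal.ofReal (ballCutoff y ρ x) ∂ν ≤ ν (ball y (2 * ρ)) := by
  rw [← lintegral_indicator_one measurableSet_ball]
  refine lintegral_mono fun x => ?_
  by_cases hx : x ∈ ball y (2 * ρ)
  · simpa [hx] using ballCutoff_le_one y ρ x
  · simp [hx, ballCutoff_eq_zero hρ hx]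

end WeakLimit

/-! ### A perimeter measure -/

section PerimeterMeasure

/-- A compactly supported Lipschitz cutoff function together with a bounded, compactly supported
upper gradient. -/
structure IsCutoff (η : X → ℝ) (h : X → ℝ≥0∞) : Prop where
  lipschitz : ∃ L : ℝ≥0, LipschitzWith L η
  nonneg : ∀ x, 0 ≤ η x
  le_one : ∀ x, η x ≤ 1
  hasCompactSupport : HasCompactSupport η
  isUpperGradient : IsUpperGradient h η
  bounded : ∃ L : ℝ≥0, ∀ x, h x ≤ L
  compact_support : ∃ K : Set X, IsCompact K ∧ ∀ x ∉ K, h x = 0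

lemma isCutoff_ballCutoff [ProperSpace X] [BorelSpace X] (y : X) {ρ : ℝ} (hρ : 0 < ρ) :
    IsCutoff (ballCutoff y ρ) ((ball y (3 * ρ)).indicator fun _ => (Real.toNNReal ρ⁻¹ : ℝ≥0∞)) where
  lipschitz := ⟨_, lipschitzWith_ballCutoff y hρ⟩
  nonneg := ballCutoff_nonneg y ρ
  le_one := ballCutoff_le_one y ρ
  hasCompactSupport := hasCompactSupport_ballCutoff y hρ
  isUpperGradient := isUpperGradient_ballCutoff y hρ
  bounded := ⟨_, fun x => indicator_le_self' (fun _ _ => zero_le) x⟩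
  compact_support := ⟨closedBall y (3 * ρ), isCompact_closedBall _ _, fun x hx =>
    indicator_of_notMem (fun h => hx (ball_subset_closedBall h)) _⟩

lemma isCutoff_zero [ProperSpace X] [BorelSpace X] : IsCutoff (fun _ : X => (0 : ℝ)) 0 where
  lipschitz := ⟨0, LipschitzWith.const _⟩
  nonneg := fun _ => le_rfl
  le_one := fun _ => zero_le_one
  hasCompactSupport := HasCompactSupport.zero
  isUpperGradient := isUpperGradientOn_const measurable_const (c := 0) fun _ _ => rfl
  bounded := ⟨0, fun _ => by simp⟩
  compact_support := ⟨∅, isCompact_empty, fun _ _ => rfl⟩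

lemma IsCutoff.max [BorelSpace X] {η₁ η₂ : X → ℝ} {h₁ h₂ : X → ℝ≥0∞} (H₁ : IsCutoff η₁ h₁)
    (H₂ : IsCutoff η₂ h₂) : IsCutoff (fun x => max (η₁ x) (η₂ x)) (fun x => h₁ x + h₂ x) where
  lipschitz := by
    obtain ⟨L, hL⟩ := H₁.lipschitz
    obtain ⟨M, hM⟩ := H₂.lipschitz
    exact ⟨_, hL.max hM⟩
  nonneg := fun x => (H₁.nonneg x).trans (le_max_left _ _)
  le_one := fun x => max_le (H₁.le_one x) (H₂.le_one x)
  hasCompactSupport := by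
    refine HasCompactSupport.intro (H₁.hasCompactSupport.isCompact.union
      H₂.hasCompactSupport.isCompact) fun x hx => ?_
    rw [mem_union, not_or] at hx
    simp [image_eq_zero_of_notMem_tsupport hx.1, image_eq_zero_of_notMem_tsupport hx.2]
  isUpperGradient := by
    have := H₁.isUpperGradient.add_of_le H₂.isUpperGradient 1 1
      (f := fun x => Max.max (η₁ x) (η₂ x)) fun x _ y _ => by
        simpa using (abs_max_sub_max_le_max _ _ _ _).trans
          (max_le_add_of_nonneg (abs_nonneg _) (abs_nonneg _))
    simpa [IsUpperGradient] using this
  bounded := by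
    obtain ⟨L, hL⟩ := H₁.bounded
    obtain ⟨M, hM⟩ := H₂.bounded
    exact ⟨L + M, fun x => by push_cast; exact add_le_add (hL x) (hM x)⟩
  compact_support := by
    obtain ⟨K, hK, hK'⟩ := H₁.compact_support
    obtain ⟨M, hM, hM'⟩ := H₂.compact_support
    refine ⟨K ∪ M, hK.union hM, fun x hx => ?_⟩
    rw [mem_union, not_or] at hx
    simp [hK' x hx.1, hM' x hx.2]

lemma exists_perimeter_approx [ProperSpace X] [Nonempty X] [BorelSpace X] (μ : Measure X)
    {F : Set X} (hP : perimeter μ F univ < ⊤) :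
    ∃ (v : ℕ → X → ℝ) (g : ℕ → X → ℝ≥0∞) (ω : Filter ℕ) (ν : Measure X),
      (∀ i, LocLipschitzOn (v i) univ) ∧ (∀ i, IsUpperGradient (g i) (v i)) ∧
      (∀ ε : ℝ≥0∞, ε ≠ 0 → ∀ᶠ i in atTop, ∫⁻ x, g i x ∂μ ≤ perimeter μ F univ + ε) ∧
      (∀ K : Set X, IsCompact K →
        Tendsto (fun i => ∫⁻ x in K, ENNReal.ofReal |v i x - F.indicator (fun _ => (1 : ℝ)) x| ∂μ)
          atTop (𝓝 0)) ∧
      ω.NeBot ∧ ω ≤ atTop ∧ IsFiniteMeasureOnCompacts ν ∧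
      ∀ f : X → ℝ, Continuous f → HasCompactSupport f → (∀ x, 0 ≤ f x) →
        Tendsto (fun i => ∫⁻ x, ENNReal.ofReal (f x) ∂(μ.withDensity (g i))) ω
          (𝓝 (∫⁻ x, ENNReal.ofReal (f x) ∂ν)) := by
  obtain ⟨x₀⟩ := ‹Nonempty X›
  have hε : ∀ i : ℕ, ((i : ℝ≥0∞) + 1)⁻¹ ≠ 0 := fun i => by simp
  have hlim : Tendsto (fun i : ℕ => ((i : ℝ≥0∞) + 1)⁻¹) atTop (𝓝 0) := by
    have := ENNReal.tendsto_inv_nat_nhds_zero.comp (tendsto_add_atTop_nat 1)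
    exact this.congr fun i => by simp
  choose v g hv hg hgi hvi using fun i : ℕ =>
    exists_of_totalVariation_lt (ENNReal.lt_add_right hP.ne (hε i))
      (isCompact_closedBall x₀ i) (hε i)
  obtain ⟨ω, ν, hω, hω', hν, hconv⟩ := exists_weak_limit (fun i => μ.withDensity (g i))
    (perimeter μ F univ + 1).toNNReal fun i => by
      rw [ENNReal.coe_toNNReal (by simp [hP.ne]), withDensity_apply _ MeasurableSet.univ,
        Measure.restrict_univ]
      refine (hgi i).le.trans ?_
      gcongr
      · exact le_rfl
      · exact ENNReal.inv_le_one.2 (by simp)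
  refine ⟨v, g, ω, ν, hv, hg, fun ε hε0 => ?_, fun K hK => ?_, hω, hω', hν, hconv⟩
  · filter_upwards [hlim.eventually_lt_const (pos_iff_ne_zero.2 hε0)] with i hi
    exact (hgi i).le.trans (add_le_add le_rfl hi.le)
  · refine tendsto_of_tendsto_of_tendsto_of_le_of_le' tendsto_const_nhds hlim
      (Eventually.of_forall fun _ => zero_le) ?_
    obtain ⟨R, hR⟩ := hK.isBounded.subset_closedBall x₀
    filter_upwards [eventually_ge_atTop ⌈R⌉₊] with i hi
    exact (lintegral_mono_set (hR.trans (closedBall_subset_closedBall (Nat.ceil_le.1 hi)))).trans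
      (hvi i).le

lemma half_min_measure_le {μ : Measure X} {F B : Set X} (hF : MeasurableSet F)
    (hB : MeasurableSet B) (c : ℝ) :
    min (μ (B ∩ F)) (μ (B \ F)) ≤
      2 * ∫⁻ x in B, ENNReal.ofReal |F.indicator (fun _ => (1 : ℝ)) x - c| ∂μ := by
  have key : ∀ S : Set X, MeasurableSet S → (∀ x ∈ B ∩ S,
      1 / 2 ≤ |F.indicator (fun _ => (1 : ℝ)) x - c|) → μ (B ∩ S) ≤
      2 * ∫⁻ x in B, ENNReal.ofReal |F.indicator (fun _ => (1 : ℝ)) x - c| ∂μ := by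
    intro S hS h
    calc μ (B ∩ S) = 2 * ∫⁻ x in B ∩ S, ENNReal.ofReal (1 / 2) ∂μ := by
          rw [setLIntegral_const, ← mul_assoc, one_div, ENNReal.ofReal_inv_of_pos two_pos,
            ENNReal.ofReal_ofNat, ENNReal.mul_inv_cancel two_ne_zero ENNReal.ofNat_ne_top, one_mul]
      _ ≤ 2 * ∫⁻ x in B ∩ S, ENNReal.ofReal |F.indicator (fun _ => (1 : ℝ)) x - c| ∂μ := by
          gcongr 2 * ?_
          exact setLIntegral_mono' (hB.inter hS) fun x hx => ENNReal.ofReal_le_ofReal (h x hx)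
      _ ≤ _ := by gcongr; exact inter_subset_left
  rcases le_or_gt c (1 / 2) with hc | hc
  · refine (min_le_left _ _).trans (key F hF fun x hx => ?_)
    rw [indicator_of_mem hx.2]
    exact le_abs.2 (Or.inl (by linarith))
  · refine (min_le_right _ _).trans (key Fᶜ hF.compl fun x hx => ?_)
    rw [indicator_of_notMem hx.2]
    exact le_abs.2 (Or.inr (by linarith))

/-- A measure `ν` carrying the relative isoperimetric inequality for `F`, and such that cutting `F`
along small sets does not decrease the perimeter too much. -/
structure IsPerimeterMeasure (μ : Measure X) (CP lam : ℝ) (F : Set X) (ν : Measure X) : Prop where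
  finite : IsFiniteMeasure ν
  univ_le : ν univ ≤ perimeter μ F univ
  isoperimetric : ∀ (x : X) (r : ℝ), 0 < r → min (μ (ball x r ∩ F)) (μ (ball x r \ F)) ≤
    2 * (ENNReal.ofReal (CP * r) * ν (closedBall x (2 * lam * r)))
  cutting : ∀ a b : ℝ≥0∞, (∀ ε : ℝ≥0∞, ε ≠ 0 → ∃ (η : X → ℝ) (h : X → ℝ≥0∞), IsCutoff η h ∧
    ∫⁻ x in F, ENNReal.ofReal (η x) ∂μ ≤ ε ∧ a ≤ ∫⁻ x, ENNReal.ofReal (η x) ∂ν ∧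
      ∫⁻ x in F, h x ∂μ ≤ b) → a ≤ b

lemma isoperimetric_of_approx [ProperSpace X] [BorelSpace X] {μ ν : Measure X}
    {Cd : ℝ≥0} (hdbl : DoublingWith μ Cd) {CP lam : ℝ} (hlam : 1 ≤ lam)
    (hPI : PoincareIneq μ CP lam) {F : Set X} (hF : MeasurableSet F)
    {v : ℕ → X → ℝ} {g : ℕ → X → ℝ≥0∞} {ω : Filter ℕ} [ω.NeBot]
    (hv : ∀ i, LocLipschitzOn (v i) univ) (hg : ∀ i, IsUpperGradient (g i) (v i))
    (hconv : ∀ K : Set X, IsCompact K →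
      Tendsto (fun i => ∫⁻ x in K, ENNReal.ofReal |v i x - F.indicator (fun _ => (1 : ℝ)) x| ∂μ)
        ω (𝓝 0))
    (hν : ∀ f : X → ℝ, Continuous f → HasCompactSupport f → (∀ x, 0 ≤ f x) →
        Tendsto (fun i => ∫⁻ x, ENNReal.ofReal (f x) ∂(μ.withDensity (g i))) ω
          (𝓝 (∫⁻ x, ENNReal.ofReal (f x) ∂ν))) (x : X) {r : ℝ} (hr : 0 < r) :
    min (μ (ball x r ∩ F)) (μ (ball x r \ F)) ≤
      2 * (ENNReal.ofReal (CP * r) * ν (closedBall x (2 * lam * r))) := by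
  have := hdbl.isLocallyFiniteMeasure
  have hlr : 0 < lam * r := by positivity
  have hm : Measurable (F.indicator fun _ => (1 : ℝ)) := measurable_const.indicator hF
  have hi : ∀ i, min (μ (ball x r ∩ F)) (μ (ball x r \ F)) ≤
      2 * (∫⁻ y in closedBall x r, ENNReal.ofReal |v i y - F.indicator (fun _ => (1 : ℝ)) y| ∂μ +
        ENNReal.ofReal (CP * r) *
          ∫⁻ y, ENNReal.ofReal (ballCutoff x (lam * r) y) ∂(μ.withDensity (g i))) := by
    intro i
    have hvc := (hv i).continuous
    set c := ⨍ z in ball x r, v i z ∂μ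
    have hP : ∫⁻ y in ball x r, ENNReal.ofReal |v i y - c| ∂μ ≤
        ENNReal.ofReal (CP * r) * ∫⁻ y in ball x (lam * r), g i y ∂μ := by
      have h1 := hPI x r hr (v i) (g i) hvc.locallyIntegrable (hg i)
      have h2 := (ENNReal.div_le_iff (hdbl.measure_ball_ne_zero hr)
        (hdbl.measure_ball_ne_top x r)).1 h1
      refine h2.trans ?_
      rw [mul_assoc]
      gcongr
      rw [ENNReal.div_eq_inv_mul, mul_right_comm]
      refine mul_le_of_le_one_left zero_le ?_
      rw [mul_comm, ← div_eq_mul_inv]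
      refine ENNReal.div_le_of_le_mul ?_
      rw [one_mul]
      exact measure_mono (ball_subset_ball (by nlinarith))
    refine (half_min_measure_le hF measurableSet_ball c).trans ?_
    gcongr 2 * ?_
    calc ∫⁻ y in ball x r, ENNReal.ofReal |F.indicator (fun _ => (1 : ℝ)) y - c| ∂μ
        ≤ ∫⁻ y in ball x r, (ENNReal.ofReal |v i y - F.indicator (fun _ => (1 : ℝ)) y| +
            ENNReal.ofReal |v i y - c|) ∂μ := by
          refine lintegral_mono fun y => ?_
          rw [← ENNReal.ofReal_add (abs_nonneg _) (abs_nonneg _)]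
          refine ENNReal.ofReal_le_ofReal ?_
          rw [abs_sub_comm (v i y)]
          exact abs_sub_le _ _ _
      _ = ∫⁻ y in ball x r, ENNReal.ofReal |v i y - F.indicator (fun _ => (1 : ℝ)) y| ∂μ +
            ∫⁻ y in ball x r, ENNReal.ofReal |v i y - c| ∂μ :=
          lintegral_add_left ((hvc.measurable.sub hm).norm).ennreal_ofReal _
      _ ≤ _ := by
          refine add_le_add (lintegral_mono_set ball_subset_closedBall) (hP.trans ?_)
          gcongr ENNReal.ofReal (CP * r) * ?_
          rw [← withDensity_apply _ measurableSet_ball]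
          exact (measure_mono ball_subset_closedBall).trans (le_lintegral_ballCutoff _ x hlr)
  have hlim : Tendsto (fun i =>
      2 * (∫⁻ y in closedBall x r, ENNReal.ofReal |v i y - F.indicator (fun _ => (1 : ℝ)) y| ∂μ +
        ENNReal.ofReal (CP * r) *
          ∫⁻ y, ENNReal.ofReal (ballCutoff x (lam * r) y) ∂(μ.withDensity (g i)))) ω
      (𝓝 (2 * (0 + ENNReal.ofReal (CP * r) *
        ∫⁻ y, ENNReal.ofReal (ballCutoff x (lam * r) y) ∂ν))) :=
    ENNReal.Tendsto.const_mul ((hconv _ (isCompact_closedBall x r)).add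
      (ENNReal.Tendsto.const_mul (hν _ (continuous_ballCutoff x hlr)
        (hasCompactSupport_ballCutoff x hlr) (ballCutoff_nonneg x _))
        (Or.inr ENNReal.ofReal_ne_top))) (Or.inr (by simp))
  refine (ge_of_tendsto' hlim hi).trans ?_
  rw [zero_add]
  gcongr
  refine (lintegral_ballCutoff_le ν x hlr).trans (measure_mono ?_)
  rw [← mul_assoc]
  exact ball_subset_closedBall

lemma cutting_of_approx [ProperSpace X] [Nonempty X] [BorelSpace X] {μ ν : Measure X}
    [IsLocallyFiniteMeasure μ] [IsFiniteMeasureOnCompacts ν] {F : Set X} (hF : MeasurableSet F)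
    (hP : perimeter μ F univ < ⊤)
    {v : ℕ → X → ℝ} {g : ℕ → X → ℝ≥0∞} {ω : Filter ℕ} [ω.NeBot]
    (hv : ∀ i, LocLipschitzOn (v i) univ) (hg : ∀ i, IsUpperGradient (g i) (v i))
    (hgi : ∀ ε : ℝ≥0∞, ε ≠ 0 → ∀ᶠ i in ω, ∫⁻ x, g i x ∂μ ≤ perimeter μ F univ + ε)
    (hconv : ∀ K : Set X, IsCompact K →
      Tendsto (fun i => ∫⁻ x in K, ENNReal.ofReal |v i x - F.indicator (fun _ => (1 : ℝ)) x| ∂μ)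
        ω (𝓝 0))
    (hν : ∀ f : X → ℝ, Continuous f → HasCompactSupport f → (∀ x, 0 ≤ f x) →
        Tendsto (fun i => ∫⁻ x, ENNReal.ofReal (f x) ∂(μ.withDensity (g i))) ω
          (𝓝 (∫⁻ x, ENNReal.ofReal (f x) ∂ν))) {a b : ℝ≥0∞}
    (hab : ∀ ε : ℝ≥0∞, ε ≠ 0 → ∃ (η : X → ℝ) (h : X → ℝ≥0∞), IsCutoff η h ∧
      ∫⁻ x in F, ENNReal.ofReal (η x) ∂μ ≤ ε ∧ a ≤ ∫⁻ x, ENNReal.ofReal (η x) ∂ν ∧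
        ∫⁻ x in F, h x ∂μ ≤ b) : a ≤ b := by
  have hm : Measurable (F.indicator fun _ => (1 : ℝ)) := measurable_const.indicator hF
  refine (ENNReal.add_le_add_iff_left hP.ne).1 (totalVariation_add_le fun K hK ε hε => ?_)
  wlog hε1 : ε ≤ 1 generalizing ε
  · obtain ⟨w, G, h1, h2, h3, h4⟩ := this (min ε 1) (by simp [hε]) (min_le_right _ _)
    exact ⟨w, G, h1, h2, h3.trans (by gcongr; exact min_le_left _ _), h4.trans (min_le_left _ _)⟩
  have hεtop : ε ≠ ⊤ := ne_top_of_le_ne_top ENNReal.one_ne_top hε1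
  set δ := ε / 2 / 2 with hδ
  have hδ0 : δ ≠ 0 := by simp [hδ, hε]
  have hδtop : δ ≠ ⊤ := by
    simp [hδ, ENNReal.div_eq_top, hεtop]
  have hδε : δ + δ + δ + δ = ε := by
    rw [hδ, add_assoc, ENNReal.add_halves, ENNReal.add_halves]
  obtain ⟨η, h, hc, hη1, hη2, hη3⟩ := hab δ hδ0
  obtain ⟨Lh, hLh⟩ := hc.bounded
  obtain ⟨Kh, hKh, hKh0⟩ := hc.compact_support
  obtain ⟨Lη, hLη⟩ := hc.lipschitz
  have hhm : Measurable h := hc.isUpperGradient.1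
  have hηm : Measurable η := hLη.continuous.measurable
  have hhint : ∀ φ : X → ℝ≥0∞, ∫⁻ x, φ x * h x ∂μ ≤ Lh * ∫⁻ x in Kh, φ x ∂μ := by
    intro φ
    calc ∫⁻ x, φ x * h x ∂μ ≤ ∫⁻ x, Kh.indicator (fun x => Lh * φ x) x ∂μ := by
          refine lintegral_mono fun x => ?_
          by_cases hx : x ∈ Kh
          · rw [indicator_of_mem hx, mul_comm]
            gcongr
            exact hLh x
          · simp [hKh0 x hx]
      _ = ∫⁻ x in Kh, Lh * φ x ∂μ := lintegral_indicator hKh.measurableSet _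
      _ = _ := lintegral_const_mul' _ _ ENNReal.coe_ne_top
  set D : ℝ≥0∞ := perimeter μ F univ + δ + Lh * μ Kh with hD
  have hDtop : D ≠ ⊤ := by
    simp [hD, hP.ne, hδtop, ENNReal.mul_eq_top, hKh.measure_lt_top.ne]
  obtain ⟨e, he0, he⟩ := ENNReal.exists_nnreal_pos_mul_lt hDtop hδ0
  have hlim1 : ∀ᶠ i in ω, ∫⁻ x, ENNReal.ofReal (η x) ∂ν ≤
      ∫⁻ x, ENNReal.ofReal (η x) ∂(μ.withDensity (g i)) + δ := by
    have hfin : ∫⁻ x, ENNReal.ofReal (η x) ∂ν ≠ ⊤ :=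
      ((hLη.continuous.integrable_of_hasCompactSupport hc.hasCompactSupport
        ).lintegral_lt_top).ne
    have := (hν η hLη.continuous hc.hasCompactSupport hc.nonneg).add_const δ
    filter_upwards [this.eventually_const_lt (ENNReal.lt_add_right hfin hδ0)] with i hi
    exact hi.le
  have hlim2 : ∀ᶠ i in ω, Lh *
      ∫⁻ x in Kh, ENNReal.ofReal |v i x - F.indicator (fun _ => (1 : ℝ)) x| ∂μ < δ := by
    have := ENNReal.Tendsto.const_mul (a := Lh) (hconv Kh hKh) (Or.inr ENNReal.coe_ne_top)
    rw [mul_zero] at this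
    exact this.eventually_lt_const (pos_iff_ne_zero.2 hδ0)
  obtain ⟨i, hi1, hi2, hi3, hi4⟩ := (hlim1.and (hlim2.and (((hconv K hK).eventually_lt_const
    (pos_iff_ne_zero.2 hδ0)).and (hgi δ hδ0)))).exists
  have hvc := (hv i).continuous
  have hgm := (hg i).1
  have hk : IsUpperGradient h (fun x => 1 - η x) := by
    refine hc.isUpperGradient.of_le hhm (fun _ _ => le_rfl) fun x _ y _ => ?_
    rw [show 1 - η x - (1 - η y) = -(η x - η y) by ring, abs_neg]
  have hUG := (hg i).mul hk hvc (continuous_const.sub hLη.continuous) (NNReal.coe_pos.2 he0)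
  refine ⟨_, _, (hv i).mul fun K _ _ => ⟨Lη, ?_⟩, hUG, ?_, ?_⟩
  · refine (LipschitzWith.of_dist_le_mul fun x y => ?_).lipschitzOnWith
    have := hLη.dist_le_mul x y
    rw [Real.dist_eq] at this ⊢
    rwa [show 1 - η x - (1 - η y) = -(η x - η y) by ring, abs_neg]
  · have hη0 : ∀ x, 0 ≤ 1 - η x := fun x => sub_nonneg.2 (hc.le_one x)
    have e1 : ∫⁻ x, ENNReal.ofReal (η x) ∂(μ.withDensity (g i)) =
        ∫⁻ x, ENNReal.ofReal (η x) * g i x ∂μ := by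
      rw [lintegral_withDensity_eq_lintegral_mul _ hgm hηm.ennreal_ofReal]
      simp [mul_comm]
    have e2 : ∫⁻ x, ENNReal.ofReal (1 - η x) * g i x ∂μ +
        ∫⁻ x, ENNReal.ofReal (η x) * g i x ∂μ = ∫⁻ x, g i x ∂μ := by
      have m0 : Measurable fun x => ENNReal.ofReal (η x) * g i x := hηm.ennreal_ofReal.mul hgm
      rw [← lintegral_add_right _ m0]
      refine lintegral_congr fun x => ?_
      rw [← add_mul, ← ENNReal.ofReal_add (hη0 x) (hc.nonneg x)]
      simp
    have e3 : ∫⁻ x, ENNReal.ofReal |v i x| * h x ∂μ ≤ b + δ := by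
      calc ∫⁻ x, ENNReal.ofReal |v i x| * h x ∂μ
          ≤ ∫⁻ x, (F.indicator h x +
            ENNReal.ofReal |v i x - F.indicator (fun _ => (1 : ℝ)) x| * h x) ∂μ := by
            refine lintegral_mono fun x => ?_
            by_cases hx : x ∈ F
            · simp only [hx, indicator_of_mem]
              calc _ ≤ ENNReal.ofReal (1 + |v i x - 1|) * h x := by
                    gcongr
                    have := abs_sub_abs_le_abs_sub (v i x) 1
                    rw [abs_one] at this
                    linarith
                _ = _ := by
                    rw [ENNReal.ofReal_add zero_le_one (abs_nonneg _), ENNReal.ofReal_one, add_mul,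
                      one_mul]
            · simp [hx]
        _ = ∫⁻ x in F, h x ∂μ +
            ∫⁻ x, ENNReal.ofReal |v i x - F.indicator (fun _ => (1 : ℝ)) x| * h x ∂μ := by
            rw [lintegral_add_left (hhm.indicator hF), lintegral_indicator hF]
        _ ≤ b + δ := add_le_add hη3 ((hhint _).trans hi2.le)
    have e4 : ∫⁻ x, h x ∂μ ≤ Lh * μ Kh := by simpa using hhint 1
    calc ∫⁻ x, (ENNReal.ofReal (|1 - η x| + e) * g i x +
          ENNReal.ofReal (|v i x| + e) * h x) ∂μ + a
        = (∫⁻ x, ENNReal.ofReal (1 - η x) * g i x ∂μ + e * ∫⁻ x, g i x ∂μ) +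
          (∫⁻ x, ENNReal.ofReal |v i x| * h x ∂μ + e * ∫⁻ x, h x ∂μ) + a := by
          congr 1
          have m1 : Measurable fun x => ENNReal.ofReal (1 - η x) * g i x :=
            (measurable_const.sub hηm).ennreal_ofReal.mul hgm
          have m2 : Measurable fun x => ENNReal.ofReal |v i x| * h x :=
            hvc.abs.measurable.ennreal_ofReal.mul hhm
          have m3 : Measurable fun x => ENNReal.ofReal (1 - η x) * g i x + e * g i x :=
            m1.add (hgm.const_mul _)
          rw [← lintegral_const_mul' _ _ ENNReal.coe_ne_top,
            ← lintegral_const_mul' _ _ ENNReal.coe_ne_top, ← lintegral_add_left m1,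
            ← lintegral_add_left m2, ← lintegral_add_left m3]
          refine lintegral_congr fun x => ?_
          rw [ENNReal.ofReal_add (abs_nonneg _) e.coe_nonneg,
            ENNReal.ofReal_add (abs_nonneg _) e.coe_nonneg, ENNReal.ofReal_coe_nnreal,
            abs_of_nonneg (hη0 x), add_mul, add_mul]
      _ ≤ (∫⁻ x, ENNReal.ofReal (1 - η x) * g i x ∂μ + e * (perimeter μ F univ + δ)) +
          ((b + δ) + e * (Lh * μ Kh)) + (∫⁻ x, ENNReal.ofReal (η x) * g i x ∂μ + δ) := by
          gcongr
          rw [← e1]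
          exact hη2.trans hi1
      _ = ∫⁻ x, g i x ∂μ + (b + δ) + e * D + δ := by
          rw [← e2, hD]; ring
      _ ≤ (perimeter μ F univ + δ) + (b + δ) + δ + δ := by gcongr
      _ = perimeter μ F univ + b + ε := by rw [← hδε]; ring
  · calc ∫⁻ x in K, ENNReal.ofReal |v i x * (1 - η x) - F.indicator (fun _ => (1 : ℝ)) x| ∂μ
        ≤ ∫⁻ x in K, (ENNReal.ofReal |v i x - F.indicator (fun _ => (1 : ℝ)) x| +
            F.indicator (fun x => ENNReal.ofReal (η x)) x) ∂μ := by
          refine lintegral_mono fun x => ?_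
          have h0 := hc.nonneg x
          have h1 := hc.le_one x
          by_cases hx : x ∈ F
          · simp only [hx, indicator_of_mem]
            rw [← ENNReal.ofReal_add (abs_nonneg _) h0]
            refine ENNReal.ofReal_le_ofReal ?_
            rw [show v i x * (1 - η x) - 1 = (v i x - 1) * (1 - η x) + -η x by ring]
            refine (abs_add_le _ _).trans ?_
            rw [abs_neg, abs_of_nonneg h0, abs_mul, abs_of_nonneg (sub_nonneg.2 h1)]
            gcongr
            exact mul_le_of_le_one_right (abs_nonneg _) (by linarith)
          · simp only [hx, not_false_eq_true, indicator_of_notMem, sub_zero, add_zero, abs_mul]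
            refine ENNReal.ofReal_le_ofReal (mul_le_of_le_one_right (abs_nonneg _) ?_)
            rw [abs_of_nonneg (sub_nonneg.2 h1)]
            linarith
      _ = ∫⁻ x in K, ENNReal.ofReal |v i x - F.indicator (fun _ => (1 : ℝ)) x| ∂μ +
            ∫⁻ x in K, F.indicator (fun x => ENNReal.ofReal (η x)) x ∂μ :=
          lintegral_add_left ((hvc.measurable.sub hm).norm).ennreal_ofReal _
      _ ≤ δ + δ := by
          refine add_le_add hi3.le ((setLIntegral_le_lintegral _ _).trans ?_)
          rwa [lintegral_indicator hF]
      _ ≤ ε := by rw [← hδε, add_assoc (δ + δ)]; exact le_self_add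

theorem exists_isPerimeterMeasure [ProperSpace X] [Nonempty X] [BorelSpace X] {μ : Measure X}
    {Cd : ℝ≥0} (hdbl : DoublingWith μ Cd) {CP lam : ℝ} (hlam : 1 ≤ lam)
    (hPI : PoincareIneq μ CP lam) {F : Set X} (hF : MeasurableSet F)
    (hP : perimeter μ F univ < ⊤) : ∃ ν : Measure X, IsPerimeterMeasure μ CP lam F ν := by
  have := hdbl.isLocallyFiniteMeasure
  obtain ⟨v, g, ω, ν, hv, hg, hgi, hconv, hω, hω', hfin, hν⟩ := exists_perimeter_approx μ hP
  have hgi' : ∀ ε : ℝ≥0∞, ε ≠ 0 → ∀ᶠ i in ω, ∫⁻ x, g i x ∂μ ≤ perimeter μ F univ + ε :=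
    fun ε hε => hω' (hgi ε hε)
  have hle : ν univ ≤ perimeter μ F univ := by
    obtain ⟨x₀⟩ := ‹Nonempty X›
    have hball : ∀ n : ℕ, ν (closedBall x₀ (n + 1)) ≤ perimeter μ F univ := by
      intro n
      have hn : (0 : ℝ) < n + 1 := by positivity
      refine (le_lintegral_ballCutoff ν x₀ hn).trans ?_
      refine ENNReal.le_of_forall_pos_le_add fun ε hε _ => ?_
      refine le_of_tendsto (hν _ (continuous_ballCutoff x₀ hn) (hasCompactSupport_ballCutoff x₀ hn)
        (ballCutoff_nonneg x₀ _)) ?_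
      filter_upwards [hgi' ε (by simpa using hε.ne')] with i hi
      refine le_trans ?_ hi
      calc _ ≤ ∫⁻ x, 1 ∂(μ.withDensity (g i)) :=
            lintegral_mono fun x => by simpa using ballCutoff_le_one x₀ _ x
        _ = _ := by simp
    have hmono : Monotone fun n : ℕ => closedBall x₀ (n + 1 : ℝ) := fun m n h =>
      closedBall_subset_closedBall (by gcongr)
    have hU : ⋃ n : ℕ, closedBall x₀ (n + 1 : ℝ) = univ := by
      refine eq_univ_of_forall fun x => mem_iUnion.2 ?_
      obtain ⟨n, hn⟩ := exists_nat_ge (dist x x₀)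
      exact ⟨n, by rw [mem_closedBall]; linarith⟩
    have hsup := hmono.measure_iUnion (μ := ν)
    rw [hU] at hsup
    exact hsup.trans_le (iSup_le hball)
  refine ⟨ν, ⟨hle.trans_lt hP⟩, hle, fun x r hr => ?_, fun a b hab => ?_⟩
  · exact isoperimetric_of_approx hdbl hlam hPI hF hv hg (fun K hK => (hconv K hK).mono_left hω')
      hν x hr
  · exact cutting_of_approx hF hP hv hg hgi' (fun K hK => (hconv K hK).mono_left hω') hν hab

end PerimeterMeasure

/-! ### Codimension one contents -/

section Content

variable {μ : Measure X}

lemma codimHContent_mono {R : ℝ} {A B : Set X} (h : A ⊆ B) :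
    codimHContent μ R A ≤ codimHContent μ R B :=
  le_iInf₂ fun c r => le_iInf₂ fun hr hB =>
    iInf₂_le_of_le c r (iInf₂_le_of_le hr (h.trans hB) le_rfl)

lemma codimHContent_anti {R R' : ℝ} (h : R ≤ R') (A : Set X) :
    codimHContent μ R' A ≤ codimHContent μ R A :=
  le_iInf₂ fun c r => le_iInf₂ fun hr hA =>
    iInf₂_le_of_le c r (iInf₂_le_of_le (fun i => ⟨(hr i).1, (hr i).2.trans h⟩) hA le_rfl)

lemma exists_cover_of_codimHContent_lt {R : ℝ} {A : Set X} {a : ℝ≥0∞}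
    (h : codimHContent μ R A < a) :
    ∃ (c : ℕ → X) (r : ℕ → ℝ), (∀ i, 0 < r i ∧ r i ≤ R) ∧ A ⊆ ⋃ i, ball (c i) (r i) ∧
      ∑' i, μ (ball (c i) (r i)) / ENNReal.ofReal (r i) < a := by
  simp only [codimHContent, iInf_lt_iff] at h
  obtain ⟨c, r, hr, hA, hlt⟩ := h
  exact ⟨c, r, hr, hA, hlt⟩

lemma codimHContent_iUnion_nat_le {R : ℝ} (A : ℕ → Set X) :
    codimHContent μ R (⋃ i, A i) ≤ ∑' i, codimHContent μ R (A i) := by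
  refine ENNReal.le_of_forall_pos_le_add fun ε hε hlt => ?_
  obtain ⟨δ, hδ, hδε⟩ := ENNReal.exists_pos_sum_of_countable (ENNReal.coe_pos.2 hε).ne' ℕ
  have hfin : ∀ i, codimHContent μ R (A i) ≠ ⊤ := fun i =>
    ne_top_of_le_ne_top hlt.ne (ENNReal.le_tsum i)
  choose c r hr hA hs using fun i => exists_cover_of_codimHContent_lt
    (ENNReal.lt_add_right (hfin i) (ENNReal.coe_pos.2 (hδ i)).ne')
  refine iInf₂_le_of_le (fun n => c n.unpair.1 n.unpair.2) (fun n => r n.unpair.1 n.unpair.2)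
    (iInf₂_le_of_le (fun n => hr _ _) ?_ ?_)
  · refine iUnion_subset fun i x hx => ?_
    obtain ⟨j, hj⟩ := mem_iUnion.1 (hA i hx)
    exact mem_iUnion.2 ⟨Nat.pair i j, by simpa using hj⟩
  · let f : ℕ × ℕ → ℝ≥0∞ := fun p => μ (ball (c p.1 p.2) (r p.1 p.2)) / ENNReal.ofReal (r p.1 p.2)
    calc ∑' n : ℕ, f n.unpair = ∑' p : ℕ × ℕ, f p := Nat.pairEquiv.symm.tsum_eq f
      _ = ∑' i, ∑' j, f (i, j) := ENNReal.tsum_prod' 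
      _ ≤ ∑' i, (codimHContent μ R (A i) + δ i) := ENNReal.tsum_le_tsum fun i => (hs i).le
      _ = ∑' i, codimHContent μ R (A i) + ∑' i, (δ i : ℝ≥0∞) := ENNReal.tsum_add
      _ ≤ _ := by gcongr

/-- The codimension one content, as an outer measure. -/
def contentOuter (μ : Measure X) (R : ℝ) (h : codimHContent μ R ∅ = 0) : OuterMeasure X where
  measureOf := codimHContent μ R
  empty := h
  mono := codimHContent_mono
  iUnion_nat := fun A _ => codimHContent_iUnion_nat_le A

lemma codimHContent_ball_le {R : ℝ} (h : codimHContent μ R ∅ = 0) (x : X) {r : ℝ} (hr : 0 < r)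
    (hrR : r ≤ R) : codimHContent μ R (ball x r) ≤ μ (ball x r) / ENNReal.ofReal r := by
  refine ENNReal.le_of_forall_pos_le_add fun ε hε _ => ?_
  obtain ⟨c, s, hs, -, hlt⟩ := exists_cover_of_codimHContent_lt
    (h.trans_lt (ENNReal.coe_pos.2 hε))
  refine iInf₂_le_of_le (fun n => Nat.casesOn n x c) (fun n => Nat.casesOn n r s)
    (iInf₂_le_of_le (fun n => ?_) ?_ ?_)
  · cases n with
    | zero => exact ⟨hr, hrR⟩
    | succ n => exact hs n
  · exact subset_iUnion_of_subset 0 subset_rfl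
  · rw [tsum_eq_zero_add' ENNReal.summable]
    exact add_le_add le_rfl hlt.le

lemma measure_le_mul_codimHContent {R : ℝ} (hR : 0 < R) (A : Set X) :
    μ A ≤ ENNReal.ofReal R * codimHContent μ R A := by
  simp only [codimHContent, ENNReal.mul_iInf_of_ne (ENNReal.ofReal_pos.2 hR).ne'
    ENNReal.ofReal_ne_top]
  refine le_iInf₂ fun c r => le_iInf₂ fun hr hA => ?_
  rw [← ENNReal.tsum_mul_left]
  refine (measure_mono hA).trans ((measure_iUnion_le _).trans (ENNReal.tsum_le_tsum fun i => ?_))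
  rw [← mul_div_assoc, ENNReal.le_div_iff_mul_le (by simp [(hr i).1]) (by simp), mul_comm]
  gcongr
  exact (hr i).2

lemma codimH_eq_zero_iff {A : Set X} :
    codimH μ A = 0 ↔ ∀ R : ℝ, 0 < R → codimHContent μ R A = 0 := by
  simp [codimH]

lemma codimH_mono_null {A B : Set X} (h : A ⊆ B) (hB : codimH μ B = 0) : codimH μ A = 0 :=
  codimH_eq_zero_iff.2 fun R hR =>
    le_antisymm ((codimHContent_mono h).trans (codimH_eq_zero_iff.1 hB R hR).le) zero_le

lemma codimH_iUnion_null {ι : Type*} [Countable ι] {A : ι → Set X}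
    (h0 : ∀ R : ℝ, 0 < R → codimHContent μ R ∅ = 0) (h : ∀ i, codimH μ (A i) = 0) :
    codimH μ (⋃ i, A i) = 0 :=
  codimH_eq_zero_iff.2 fun R hR =>
    (measure_iUnion_null (μ := contentOuter μ R (h0 R hR))) fun i => codimH_eq_zero_iff.1 (h i) R hR

lemma codimH_union_null {A B : Set X} (h0 : ∀ R : ℝ, 0 < R → codimHContent μ R ∅ = 0)
    (hA : codimH μ A = 0) (hB : codimH μ B = 0) : codimH μ (A ∪ B) = 0 := by
  rw [union_eq_iUnion]
  exact codimH_iUnion_null h0 fun b => by cases b <;> simpa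

/-- Vitali type covering by balls on which `ν` is not too small. -/
lemma exists_disjoint_covering [ProperSpace X] [BorelSpace X] (ν : Measure X) {K : ℝ≥0∞}
    {σ R : ℝ} (hσ : 1 ≤ σ) {W U : Set X}
    (h : ∀ y ∈ W, ∃ ρ : ℝ, 0 < ρ ∧ ρ ≤ R ∧
      μ (ball y ρ) ≤ K * ENNReal.ofReal ρ * ν (closedBall y (σ * ρ)) ∧ closedBall y (σ * ρ) ⊆ U) :
    ∃ (u : Set X) (ρ : X → ℝ), u ⊆ W ∧ u.Countable ∧ (∀ y ∈ u, 0 < ρ y ∧ ρ y ≤ R) ∧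
      W ⊆ ⋃ y ∈ u, ball y (6 * σ * ρ y) ∧
      ∑' y : u, μ (ball (y : X) (ρ y)) / ENNReal.ofReal (ρ y) ≤ K * ν U := by
  choose! ρ hρ0 hρR hρ hρU using h
  obtain ⟨u, huW, hdisj, hcov⟩ := Vitali.exists_disjoint_subfamily_covering_enlargement_closedBall
    W id (fun y => σ * ρ y) (σ * R) (fun y hy => by gcongr; exact hρR y hy) 5 (by norm_num)
  have hu : u.Countable := by
    refine hdisj.countable_of_nonempty_interior fun y hy => ?_
    have : 0 < σ * ρ y := mul_pos (by linarith) (hρ0 y (huW hy))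
    exact ⟨y, ball_subset_interior_closedBall (mem_ball_self this)⟩
  refine ⟨u, ρ, huW, hu, fun y hy => ⟨hρ0 y (huW hy), hρR y (huW hy)⟩, fun y hy => ?_, ?_⟩
  · obtain ⟨b, hb, hsub⟩ := hcov y hy
    have hb0 := hρ0 b (huW hb)
    have hy0 := hρ0 y hy
    refine mem_iUnion₂.2 ⟨b, hb, ?_⟩
    have := hsub (mem_closedBall_self (by positivity))
    simp only [id, mem_closedBall] at this
    rw [mem_ball]
    nlinarith [mul_pos (show (0 : ℝ) < σ by linarith) hb0]
  · have := hu.to_subtype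
    calc ∑' y : u, μ (ball (y : X) (ρ y)) / ENNReal.ofReal (ρ y)
        ≤ ∑' y : u, K * ν (closedBall (y : X) (σ * ρ y)) := by
          refine ENNReal.tsum_le_tsum fun y => ENNReal.div_le_of_le_mul ?_
          rw [mul_right_comm]
          exact hρ y (huW y.2)
      _ = K * ν (⋃ y : u, closedBall (y : X) (σ * ρ y)) := by
          rw [ENNReal.tsum_mul_left, measure_iUnion]
          · exact fun a b hab => hdisj a.2 b.2 (Subtype.coe_injective.ne hab)
          · exact fun _ => measurableSet_closedBall
      _ ≤ K * ν U := by
          gcongr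
          exact iUnion_subset fun y => hρU y (huW y.2)

lemma DoublingWith.exists_div_le {Cd : ℝ≥0} (hdbl : DoublingWith μ Cd) {A : ℝ} (hA : 1 ≤ A) :
    ∃ C : ℝ≥0, ∀ (x : X) (r : ℝ), 0 < r →
      μ (ball x (A * r)) / ENNReal.ofReal (A * r) ≤ C * (μ (ball x r) / ENNReal.ofReal r) := by
  obtain ⟨C, hC⟩ := hdbl.exists_ball_mul_le A
  refine ⟨C, fun x r hr => ?_⟩
  rw [← mul_div_assoc]
  exact ENNReal.div_le_div (hC x r hr) (ENNReal.ofReal_le_ofReal (by nlinarith))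

lemma exists_codimHContent_le [ProperSpace X] [BorelSpace X] {Cd : ℝ≥0}
    (hdbl : DoublingWith μ Cd) (h0 : ∀ R : ℝ, 0 < R → codimHContent μ R ∅ = 0) {σ : ℝ}
    (hσ : 1 ≤ σ) :
    ∃ C : ℝ≥0, ∀ (ν : Measure X) (K : ℝ≥0∞) (R : ℝ) (W U : Set X), 0 < R →
      (∀ y ∈ W, ∃ ρ : ℝ, 0 < ρ ∧ ρ ≤ R ∧
        μ (ball y ρ) ≤ K * ENNReal.ofReal ρ * ν (closedBall y (σ * ρ)) ∧
          closedBall y (σ * ρ) ⊆ U) →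
      codimHContent μ (6 * σ * R) W ≤ C * (K * ν U) := by
  obtain ⟨C, hC⟩ := hdbl.exists_div_le (A := 6 * σ) (by linarith)
  refine ⟨C, fun ν K R W U hR h => ?_⟩
  obtain ⟨u, ρ, -, hu, hρ, hcov, hsum⟩ := exists_disjoint_covering ν hσ h
  have hpad := h0 (6 * σ * R) (by positivity)
  calc codimHContent μ (6 * σ * R) W ≤ codimHContent μ (6 * σ * R)
        (⋃ y ∈ u, ball y (6 * σ * ρ y)) := codimHContent_mono hcov
    _ ≤ ∑' y : u, codimHContent μ (6 * σ * R) (ball (y : X) (6 * σ * ρ y)) :=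
        measure_biUnion_le (contentOuter μ _ hpad) hu _
    _ ≤ ∑' y : u, C * (μ (ball (y : X) (ρ y)) / ENNReal.ofReal (ρ y)) := by
        refine ENNReal.tsum_le_tsum fun y => ?_
        obtain ⟨h1, h2⟩ := hρ y y.2
        exact (codimHContent_ball_le hpad _ (by positivity) (by gcongr)).trans (hC _ _ h1)
    _ ≤ C * (K * ν U) := by rw [ENNReal.tsum_mul_left]; gcongr

end Content

/-! ### Radii selection and finite families of cutoffs -/

section Boxing

variable {μ ν : Measure X} {Cd : ℝ≥0} {CP lam : ℝ} {F : Set X}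

lemma IsPerimeterMeasure.exists_radius [BorelSpace X] (hν : IsPerimeterMeasure μ CP lam F ν)
    (hCd : 1 ≤ Cd) (hdbl : DoublingWith μ Cd) (hF : MeasurableSet F) (hCP : 0 < CP)
    {c : ℝ≥0∞} (hc0 : c ≠ 0) (hc : c ≤ 1 / 2) {y : X} {R : ℝ} (hR : 0 < R)
    (h1 : μ (ball y R ∩ F) ≤ c * μ (ball y R))
    (h2 : ∀ᶠ r in 𝓝[>] (0 : ℝ), c * μ (ball y r) < μ (ball y r ∩ F)) :
    ∃ ρ : ℝ, 0 < ρ ∧ ρ ≤ R ∧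
      μ (ball y ρ) ≤ (2 * ENNReal.ofReal CP * (Cd / c)) * ENNReal.ofReal ρ *
        ν (closedBall y (2 * lam * ρ)) := by
  classical
  have hctop : c ≠ ⊤ := ne_top_of_le_ne_top (by simp) hc
  have hex : ∃ k : ℕ, c * μ (ball y (R / 2 ^ k)) < μ (ball y (R / 2 ^ k) ∩ F) := by
    have : Tendsto (fun k : ℕ => R / 2 ^ k) atTop (𝓝[>] 0) := by
      refine tendsto_nhdsWithin_iff.2 ⟨?_, Eventually.of_forall fun k => mem_Ioi.2 (by positivity)⟩
      have := (tendsto_pow_atTop_nhds_zero_of_lt_one (r := (1 / 2 : ℝ)) (by norm_num)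
        (by norm_num)).const_mul R
      rw [mul_zero] at this
      exact this.congr fun k => by rw [one_div, inv_pow, div_eq_mul_inv]
    exact (this.eventually h2).exists
  obtain ⟨k, hk, hmin⟩ := Nat.findX hex
  have hk0 : k ≠ 0 := by
    rintro rfl
    simp only [pow_zero, div_one] at hk
    exact absurd hk (not_lt.2 h1)
  obtain ⟨j, rfl⟩ := Nat.exists_eq_succ_of_ne_zero hk0
  have hj := not_lt.1 (hmin j (Nat.lt_succ_self j))
  set r := R / 2 ^ j with hr
  have hr0 : 0 < r := by positivity
  have hr2 : R / 2 ^ (j + 1) = r / 2 := by rw [hr, pow_succ]; field_simp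
  rw [Nat.succ_eq_add_one, hr2] at hk
  refine ⟨r, hr0, div_le_self hR.le (one_le_pow₀ one_le_two), ?_⟩
  have hB0 := hdbl.measure_ball_ne_zero (x := y) hr0
  have hBt := hdbl.measure_ball_ne_top y r
  have hcd : μ (ball y r) ≤ Cd * μ (ball y (r / 2)) := by
    have := (hdbl y (r / 2) (by positivity)).2.1
    rwa [mul_div_cancel₀ r two_ne_zero] at this
  have hA : c * μ (ball y r) ≤ Cd * μ (ball y r ∩ F) := by
    calc c * μ (ball y r) ≤ c * (Cd * μ (ball y (r / 2))) := by gcongr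
      _ = Cd * (c * μ (ball y (r / 2))) := by ring
      _ ≤ Cd * μ (ball y r ∩ F) := by
        gcongr
        exact hk.le.trans (measure_mono
          (inter_subset_inter_left _ (ball_subset_ball (by linarith))))
  have hB : c * μ (ball y r) ≤ Cd * μ (ball y r \ F) := by
    have h3 : μ (ball y r) ≤ c * μ (ball y r) + μ (ball y r \ F) := by
      calc μ (ball y r) = μ (ball y r ∩ F) + μ (ball y r \ F) :=
            (measure_inter_add_sdiff _ hF).symm
        _ ≤ c * μ (ball y r) + μ (ball y r \ F) := by gcongr
    have h4 : c * μ (ball y r) + c * μ (ball y r) ≤ c * μ (ball y r) + μ (ball y r \ F) := by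
      refine le_trans ?_ h3
      rw [← add_mul]
      refine mul_le_of_le_one_left zero_le ?_
      calc c + c ≤ 1 / 2 + 1 / 2 := by gcongr
        _ = 1 := ENNReal.add_halves 1
    have h5 := (ENNReal.add_le_add_iff_left (ENNReal.mul_ne_top hctop hBt)).1 h4
    refine h5.trans (le_mul_of_one_le_left zero_le ?_)
    exact_mod_cast hCd
  have hmn : c * μ (ball y r) ≤ Cd * min (μ (ball y r ∩ F)) (μ (ball y r \ F)) := by
    rcases min_choice (μ (ball y r ∩ F)) (μ (ball y r \ F)) with h | h <;> rw [h]
    exacts [hA, hB]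
  have hfin := hmn.trans (mul_le_mul_right (hν.isoperimetric y r hr0) _)
  rw [mul_comm c] at hfin
  have hfin' := ENNReal.le_div_iff_mul_le (Or.inl hc0) (Or.inl hctop) |>.2 hfin
  refine hfin'.trans (le_of_eq ?_)
  rw [ENNReal.ofReal_mul hCP.le, div_eq_mul_inv, div_eq_mul_inv]
  ring

lemma exists_cutoff_finset [ProperSpace X] [BorelSpace X] (t : Finset X) (r : X → ℝ)
    (hr : ∀ y ∈ t, 0 < r y) :
    ∃ (η : X → ℝ) (h : X → ℝ≥0∞), IsCutoff η h ∧ (∀ y ∈ t, ∀ x ∈ closedBall y (r y), η x = 1) ∧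
      (∀ m : Measure X, ∫⁻ x, ENNReal.ofReal (η x) ∂m ≤ ∑ y ∈ t, m (ball y (2 * r y))) ∧
      ∀ m : Measure X, ∫⁻ x, h x ∂m ≤ ∑ y ∈ t, m (ball y (3 * r y)) / ENNReal.ofReal (r y) := by
  classical
  induction t using Finset.induction_on with
  | empty => exact ⟨_, _, isCutoff_zero, by simp, by simp, by simp⟩
  | insert a s ha ih =>
    obtain ⟨η, h, hc, h1, h2, h3⟩ := ih fun y hy => hr y (Finset.mem_insert_of_mem hy)
    have hra := hr a (Finset.mem_insert_self a s)
    have hca := isCutoff_ballCutoff a hra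
    refine ⟨_, _, hca.max hc, fun y hy x hx => ?_, fun m => ?_, fun m => ?_⟩
    · rcases Finset.mem_insert.1 hy with rfl | hy
      · rw [ballCutoff_eq_one hra hx, max_eq_left (hc.le_one x)]
      · rw [h1 y hy x hx, max_eq_right (hca.le_one x)]
    · rw [Finset.sum_insert ha]
      refine le_trans ?_ (add_le_add (lintegral_ballCutoff_le m a hra) (h2 m))
      rw [← lintegral_add_left (continuous_ballCutoff a hra).measurable.ennreal_ofReal]
      refine lintegral_mono fun x => ?_
      rw [← ENNReal.ofReal_add (hca.nonneg x) (hc.nonneg x)]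
      exact ENNReal.ofReal_le_ofReal (max_le_add_of_nonneg (hca.nonneg x) (hc.nonneg x))
    · rw [Finset.sum_insert ha, lintegral_add_left hca.isUpperGradient.1]
      refine add_le_add (le_of_eq ?_) (h3 m)
      rw [lintegral_indicator measurableSet_ball, setLIntegral_const, mul_comm, div_eq_mul_inv,
        ← ENNReal.ofReal_inv_of_pos hra]
      rfl

end Boxing

/-! ### Points of zero density -/

section ZeroDensity

variable {μ ν : Measure X} {Cd : ℝ≥0} {CP lam : ℝ} {F : Set X}

lemma tendsto_mul_nhdsGT_zero {k : ℝ} (hk : 0 < k) :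
    Tendsto (fun r : ℝ => k * r) (𝓝[>] 0) (𝓝[>] 0) := by
  refine tendsto_nhdsWithin_iff.2 ⟨?_, ?_⟩
  · have : Tendsto (fun r : ℝ => k * r) (𝓝 0) (𝓝 (k * 0)) := tendsto_id.const_mul k
    rw [mul_zero] at this
    exact this.mono_left nhdsWithin_le_nhds
  · filter_upwards [self_mem_nhdsWithin] with r hr
    exact mem_Ioi.2 (mul_pos hk hr)

/-- `F` has density zero at `x`. -/
def ZeroDensityAt (μ : Measure X) (F : Set X) (x : X) : Prop :=
  Tendsto (fun r : ℝ => μ (ball x r ∩ F) / μ (ball x r)) (𝓝[>] 0) (𝓝 0)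

lemma ZeroDensityAt.eventually_le (hdbl : DoublingWith μ Cd) {x : X} (h : ZeroDensityAt μ F x)
    {ε : ℝ≥0∞} (hε : ε ≠ 0) : ∀ᶠ r in 𝓝[>] (0 : ℝ), μ (ball x r ∩ F) ≤ ε * μ (ball x r) := by
  have h1 := (tendsto_order.1 h).2 ε (pos_iff_ne_zero.2 hε)
  filter_upwards [h1, self_mem_nhdsWithin] with r hr hr0
  exact (ENNReal.div_le_iff (hdbl.measure_ball_ne_zero hr0) (hdbl.measure_ball_ne_top x r)).1 hr.le

lemma ZeroDensityAt.mono {F G : Set X} {x : X} (hG : ZeroDensityAt μ G x) (h : F ⊆ G) :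
    ZeroDensityAt μ F x :=
  tendsto_of_tendsto_of_tendsto_of_le_of_le tendsto_const_nhds hG (fun _ => zero_le)
    fun _ => ENNReal.div_le_div_right (measure_mono (inter_subset_inter_right _ h)) _

lemma ZeroDensityAt.union {F G : Set X} {x : X} (hF : ZeroDensityAt μ F x)
    (hG : ZeroDensityAt μ G x) : ZeroDensityAt μ (F ∪ G) x := by
  have := Tendsto.add hF hG
  rw [add_zero] at this
  refine tendsto_of_tendsto_of_tendsto_of_le_of_le tendsto_const_nhds this (fun _ => zero_le)
    fun r => ?_
  simp only [← ENNReal.add_div, inter_union_distrib_left]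
  exact ENNReal.div_le_div_right (measure_union_le _ _) _

/-- At almost every point of `F`, the density of `F` is bounded below. -/
lemma ae_eventually_lt_measure_ball_inter [ProperSpace X] [BorelSpace X]
    (hCd : 1 ≤ Cd) (hdbl : DoublingWith μ Cd) (hF : MeasurableSet F) :
    ∀ᵐ y ∂μ.restrict F, ∀ᶠ r in 𝓝[>] (0 : ℝ),
      (4 * (Cd : ℝ≥0∞))⁻¹ * μ (ball y r) < μ (ball y r ∩ F) := by
  have := hdbl.isUnifLocDoublingMeasure
  have := hdbl.isLocallyFiniteMeasure
  filter_upwards [IsUnifLocDoublingMeasure.ae_tendsto_measure_inter_div μ F 1] with y hy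
  have hhalf : Tendsto (fun r : ℝ => r / 2) (𝓝[>] 0) (𝓝[>] 0) := by
    simpa only [inv_mul_eq_div] using tendsto_mul_nhdsGT_zero (k := 2⁻¹) (by norm_num)
  have h1 := hy (fun _ : ℝ => y) (fun r : ℝ => r / 2) hhalf (by
    filter_upwards [self_mem_nhdsWithin] with r hr
    exact mem_closedBall_self (by have : (0 : ℝ) < r := hr; linarith))
  have h2 := (tendsto_order.1 h1).1 (1 / 2) (by rw [one_div]; exact ENNReal.one_half_lt_one)
  filter_upwards [h2, self_mem_nhdsWithin] with r hr hr0
  have hr0' : (0 : ℝ) < r := hr0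
  have hcb : μ (closedBall y (r / 2)) ≠ ⊤ := hdbl.measure_closedBall_ne_top y _
  have hb0 : μ (ball y (r / 2)) ≠ 0 := hdbl.measure_ball_ne_zero (half_pos hr0')
  have hcb0 : μ (closedBall y (r / 2)) ≠ 0 := fun h =>
    hb0 (measure_mono_null ball_subset_closedBall h)
  have h3 : 1 / 2 * μ (closedBall y (r / 2)) ≤ μ (F ∩ closedBall y (r / 2)) :=
    (ENNReal.le_div_iff_mul_le (Or.inl hcb0) (Or.inl hcb)).1 hr.le
  have hcd : μ (ball y r) ≤ Cd * μ (ball y (r / 2)) := by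
    have := (hdbl y (r / 2) (by positivity)).2.1
    rwa [mul_div_cancel₀ r two_ne_zero] at this
  have hCd0 : (Cd : ℝ≥0∞) ≠ 0 := by
    have : Cd ≠ 0 := (lt_of_lt_of_le one_pos hCd).ne'
    exact_mod_cast this
  calc (4 * (Cd : ℝ≥0∞))⁻¹ * μ (ball y r)
      ≤ (4 * (Cd : ℝ≥0∞))⁻¹ * (Cd * μ (ball y (r / 2))) := by gcongr
    _ = 4⁻¹ * μ (ball y (r / 2)) := by
        rw [ENNReal.mul_inv (Or.inl (by norm_num)) (Or.inl (by norm_num)), mul_assoc, ← mul_assoc (Cd : ℝ≥0∞)⁻¹,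
          ENNReal.inv_mul_cancel hCd0 coe_ne_top, one_mul]
    _ < 2⁻¹ * μ (ball y (r / 2)) := by
        refine (ENNReal.mul_lt_mul_iff_left hb0 (hdbl.measure_ball_ne_top _ _)).2 ?_
        exact ENNReal.inv_lt_inv.2 (by norm_num)
    _ ≤ 1 / 2 * μ (closedBall y (r / 2)) := by
        rw [one_div]; gcongr; exact ball_subset_closedBall
    _ ≤ _ := h3
    _ ≤ μ (ball y r ∩ F) := by
        rw [inter_comm]
        exact measure_mono (inter_subset_inter_left _ (closedBall_subset_ball (by linarith)))

lemma IsPerimeterMeasure.eventually_measure_inter_le [ProperSpace X] [BorelSpace X]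
    (hν : IsPerimeterMeasure μ CP lam F ν) (hCd : 1 ≤ Cd) (hdbl : DoublingWith μ Cd)
    (hF : MeasurableSet F) (hCP : 0 < CP) (hlam : 1 ≤ lam)
    (h0 : ∀ R : ℝ, 0 < R → codimHContent μ R ∅ = 0) {x : X} (hx : ZeroDensityAt μ F x)
    {ε : ℝ≥0∞} (hε : ε ≠ 0) :
    ∀ᶠ r in 𝓝[>] (0 : ℝ), μ (ball x r ∩ F) ≤ ENNReal.ofReal r * ε := by
  have := hν.finite
  set c : ℝ≥0∞ := (4 * (Cd : ℝ≥0∞))⁻¹ with hc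
  have hc0 : c ≠ 0 := ENNReal.inv_ne_zero.2 (ENNReal.mul_ne_top (by simp) coe_ne_top)
  have hc2 : c ≤ 1 / 2 := by
    rw [hc, one_div]
    refine ENNReal.inv_le_inv.2 ?_
    have : (1 : ℝ≥0∞) ≤ Cd := by exact_mod_cast hCd
    calc (2 : ℝ≥0∞) ≤ 4 * 1 := by norm_num
      _ ≤ _ := by gcongr
  have hctop : c ≠ ⊤ := ne_top_of_le_ne_top (by simp) hc2
  obtain ⟨C, hC⟩ := exists_codimHContent_le hdbl h0 (σ := 2 * lam) (by linarith)
  set K : ℝ≥0∞ := 2 * ENNReal.ofReal CP * (Cd / c) with hK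
  have hKt : K ≠ ⊤ := ENNReal.mul_ne_top (ENNReal.mul_ne_top (by simp) ofReal_ne_top)
    (ENNReal.div_ne_top coe_ne_top hc0)
  set M : ℝ≥0∞ := C * (K * ν univ) with hM
  have hMt : M ≠ ⊤ := ENNReal.mul_ne_top coe_ne_top (ENNReal.mul_ne_top hKt (measure_ne_top _ _))
  obtain ⟨θ, hθ0, hθ1, hθ⟩ : ∃ θ : ℝ, 0 < θ ∧ θ ≤ 1 ∧
      ENNReal.ofReal (6 * (2 * lam) * θ) * M ≤ ε := by
    have : Tendsto (fun θ : ℝ => ENNReal.ofReal (6 * (2 * lam) * θ) * M) (𝓝[>] 0) (𝓝 0) := by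
      have h1 : Tendsto (fun θ : ℝ => ENNReal.ofReal (6 * (2 * lam) * θ)) (𝓝 0) (𝓝 0) := by
        have : Continuous fun θ : ℝ => ENNReal.ofReal (6 * (2 * lam) * θ) :=
          ENNReal.continuous_ofReal.comp (continuous_const.mul continuous_id)
        simpa using this.tendsto 0
      have h2 := ENNReal.Tendsto.mul_const h1 (b := M) (Or.inr hMt)
      rw [zero_mul] at h2
      exact h2.mono_left nhdsWithin_le_nhds
    have h1 := ENNReal.tendsto_nhds_zero.1 this ε (pos_iff_ne_zero.2 hε)
    have h2 : ∀ᶠ θ : ℝ in 𝓝[>] 0, θ ≤ 1 :=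
      (Iic_mem_nhds one_pos |> mem_nhdsWithin_of_mem_nhds : Iic (1 : ℝ) ∈ 𝓝[>] 0)
    obtain ⟨θ, ⟨h3, h4⟩, h5⟩ := ((h1.and h2).and self_mem_nhdsWithin).exists
    exact ⟨θ, h5, h4, h3⟩
  obtain ⟨D, hD⟩ := hdbl.exists_ball_mul_le (4 / θ)
  have hev := (tendsto_mul_nhdsGT_zero two_pos).eventually (hx.eventually_le hdbl (ε := c / (D + 1))
    (ENNReal.div_ne_zero.2 ⟨hc0, by finiteness⟩))
  filter_upwards [hev, self_mem_nhdsWithin] with r hr hr0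
  have hr0' : (0 : ℝ) < r := hr0
  have hθr : 0 < θ * r := mul_pos hθ0 hr0'
  set G := {y | ∀ᶠ s in 𝓝[>] (0 : ℝ), c * μ (ball y s) < μ (ball y s ∩ F)} with hG
  have hGae : ∀ᵐ y ∂μ.restrict F, y ∈ G := ae_eventually_lt_measure_ball_inter hCd hdbl hF
  have key : ∀ y ∈ ball x r ∩ G, ∃ ρ : ℝ, 0 < ρ ∧ ρ ≤ θ * r ∧
      μ (ball y ρ) ≤ K * ENNReal.ofReal ρ * ν (closedBall y (2 * lam * ρ)) ∧
        closedBall y (2 * lam * ρ) ⊆ univ := by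
    rintro y ⟨hyx, hyG⟩
    have hyx' : dist y x < r := hyx
    have h1 : μ (ball y (θ * r) ∩ F) ≤ c * μ (ball y (θ * r)) := by
      calc μ (ball y (θ * r) ∩ F) ≤ μ (ball x (2 * r) ∩ F) := by
            refine measure_mono (inter_subset_inter_left _ (ball_subset_ball' ?_))
            nlinarith
        _ ≤ c / (D + 1) * μ (ball x (2 * r)) := hr
        _ ≤ c / (D + 1) * μ (ball y (4 / θ * (θ * r))) := by
            gcongr
            refine ball_subset_ball' ?_
            rw [dist_comm]
            have : 4 / θ * (θ * r) = 4 * r := by field_simp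
            linarith
        _ ≤ c / (D + 1) * (D * μ (ball y (θ * r))) := by gcongr; exact hD y _ hθr
        _ ≤ c / (D + 1) * ((D + 1) * μ (ball y (θ * r))) := by gcongr; exact le_self_add
        _ = c * μ (ball y (θ * r)) := by
            rw [← mul_assoc, ENNReal.div_mul_cancel (by simp) (by finiteness)]
    obtain ⟨ρ, h2, h3, h4⟩ := hν.exists_radius hCd hdbl hF hCP hc0 hc2 hθr h1 hyG
    exact ⟨ρ, h2, h3, h4, subset_univ _⟩
  have h1 := hC ν K (θ * r) _ univ hθr key
  have h2 := measure_le_mul_codimHContent (μ := μ) (R := 6 * (2 * lam) * (θ * r))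
    (by positivity) (ball x r ∩ G)
  calc μ (ball x r ∩ F) ≤ μ (ball x r ∩ G) := by
        refine measure_mono_ae ?_
        filter_upwards [(ae_restrict_iff' hF).1 hGae] with y hy hyF
        exact ⟨hyF.1, hy hyF.2⟩
    _ ≤ ENNReal.ofReal (6 * (2 * lam) * (θ * r)) * M := h2.trans (by gcongr)
    _ = ENNReal.ofReal r * (ENNReal.ofReal (6 * (2 * lam) * θ) * M) := by
        rw [show 6 * (2 * lam) * (θ * r) = r * (6 * (2 * lam) * θ) by ring,
          ENNReal.ofReal_mul hr0'.le, mul_assoc]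
    _ ≤ _ := by gcongr

lemma IsPerimeterMeasure.measure_singleton_eq_zero [ProperSpace X] [BorelSpace X]
    (hν : IsPerimeterMeasure μ CP lam F ν) (hCd : 1 ≤ Cd) (hdbl : DoublingWith μ Cd)
    (hF : MeasurableSet F) (hCP : 0 < CP) (hlam : 1 ≤ lam)
    (h0 : ∀ R : ℝ, 0 < R → codimHContent μ R ∅ = 0) {x : X} (hx : ZeroDensityAt μ F x) :
    ν {x} = 0 := by
  refine le_antisymm (le_of_forall_gt_imp_ge_of_dense fun b hb => ?_) zero_le
  refine hν.cutting _ _ fun ε hε => ?_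
  have e1 := (tendsto_mul_nhdsGT_zero two_pos).eventually
    (hν.eventually_measure_inter_le hCd hdbl hF hCP hlam h0 hx hε)
  have e2 := (tendsto_mul_nhdsGT_zero three_pos).eventually
    (hν.eventually_measure_inter_le hCd hdbl hF hCP hlam h0 hx (ε := b / 3)
      (ENNReal.div_ne_zero.2 ⟨hb.ne', by simp⟩))
  have e3 : ∀ᶠ r : ℝ in 𝓝[>] 0, r ≤ 1 / 2 :=
    (Iic_mem_nhds (by norm_num) |> mem_nhdsWithin_of_mem_nhds : Iic (1 / 2 : ℝ) ∈ 𝓝[>] 0)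
  obtain ⟨r, ⟨⟨h1, h2⟩, h3⟩, hr0 : 0 < r⟩ := (((e1.and e2).and e3).and self_mem_nhdsWithin).exists
  refine ⟨_, _, isCutoff_ballCutoff x hr0, ?_, ?_, ?_⟩
  · refine (lintegral_ballCutoff_le _ x hr0).trans ?_
    rw [Measure.restrict_apply measurableSet_ball]
    refine h1.trans ?_
    calc ENNReal.ofReal (2 * r) * ε ≤ ENNReal.ofReal 1 * ε := by gcongr; linarith
      _ = ε := by simp
  · refine le_trans (measure_mono ?_) (le_lintegral_ballCutoff ν x hr0)
    exact singleton_subset_iff.2 (mem_closedBall_self hr0.le)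
  · rw [lintegral_indicator measurableSet_ball, setLIntegral_const,
      Measure.restrict_apply measurableSet_ball]
    calc _ ≤ ENNReal.ofReal r⁻¹ * (ENNReal.ofReal (3 * r) * (b / 3)) := by gcongr; rfl
      _ = b := by
        rw [← mul_assoc, ← ENNReal.ofReal_mul (by positivity),
          show r⁻¹ * (3 * r) = 3 by field_simp, show ENNReal.ofReal 3 = 3 by norm_num]
        exact ENNReal.mul_div_cancel (by simp) (by simp)




lemma exists_finset_lt_measure_biUnion {ι : Type*} {u : Set ι} (hu : u.Countable) (s : ι → Set X)
    {a : ℝ≥0∞} (h : a < ν (⋃ i ∈ u, s i)) : ∃ t : Finset u, a < ν (⋃ i ∈ t, s i) := by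
  have := hu.to_subtype
  have h1 : (⋃ i ∈ u, s i) = ⋃ t : Finset u, ⋃ i ∈ t, s i := by
    rw [biUnion_eq_iUnion]
    exact iUnion_eq_iUnion_finset fun i : u => s i
  rw [h1, Directed.measure_iUnion] at h
  · exact lt_iSup_iff.1 h
  · refine (Monotone.directed_le fun t t' ht => ?_)
    exact biUnion_subset_biUnion_left ht

lemma IsPerimeterMeasure.measure_le_of_density_le [ProperSpace X] [BorelSpace X]
    (hν : IsPerimeterMeasure μ CP lam F ν) (hdbl : DoublingWith μ Cd) (K : ℝ≥0) :
    ∃ M : ℝ≥0, ∀ (S : Set X) (ε : ℝ≥0∞) (δ : ℝ), 0 < δ →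
      (∀ x ∈ S, ∀ r : ℝ, 0 < r → r < δ → μ (ball x r ∩ F) ≤ ε * μ (ball x r)) →
      (∀ x ∈ S, ∃ᶠ r in 𝓝[>] (0 : ℝ),
        μ (ball x r) ≤ K * ENNReal.ofReal r * ν (closedBall x r)) → ν S ≤ ε * M := by
  have := hν.finite
  obtain ⟨C₁, hC₁⟩ := hdbl.exists_ball_mul_le 12
  obtain ⟨C₂, hC₂⟩ := hdbl.exists_ball_mul_le 18
  have hMt : (C₂ : ℝ≥0∞) * (K * ν univ) ≠ ⊤ := by finiteness
  refine ⟨(C₂ * (K * ν univ)).toNNReal, fun S ε δ hδ h1 h2 => ?_⟩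
  rw [ENNReal.coe_toNNReal hMt]
  refine le_of_forall_lt_imp_le_of_dense fun a ha => hν.cutting _ _ fun ε' hε' => ?_
  obtain ⟨R, hR0, hRδ, hR⟩ : ∃ R : ℝ, 0 < R ∧ R ≤ δ / 36 ∧
      ENNReal.ofReal R * (C₁ * (K * ν univ)) ≤ ε' := by
    have h3 := ENNReal.Tendsto.mul_const (b := C₁ * (K * ν univ))
      (ENNReal.continuous_ofReal.tendsto 0) (Or.inr (by finiteness))
    rw [ENNReal.ofReal_zero, zero_mul] at h3
    have h4 := ENNReal.tendsto_nhds_zero.1 (h3.mono_left (nhdsWithin_le_nhds (s := Ioi 0)))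
      ε' (pos_iff_ne_zero.2 hε')
    have h5 : ∀ᶠ R : ℝ in 𝓝[>] 0, R ≤ δ / 36 :=
      (Iic_mem_nhds (by positivity) |> mem_nhdsWithin_of_mem_nhds : Iic (δ / 36) ∈ 𝓝[>] 0)
    obtain ⟨R, ⟨h6, h7⟩, h8⟩ := ((h4.and h5).and self_mem_nhdsWithin).exists
    exact ⟨R, h8, h7, h6⟩
  obtain ⟨u, ρ, huS, huc, hρ, hcov, hsum⟩ := exists_disjoint_covering (μ := μ) ν (K := K) (σ := 1)
    (R := R) le_rfl (W := S) (U := univ) (by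
      intro y hy
      have h5 : ∀ᶠ r : ℝ in 𝓝[>] 0, r ≤ R :=
        (Iic_mem_nhds hR0 |> mem_nhdsWithin_of_mem_nhds : Iic R ∈ 𝓝[>] 0)
      obtain ⟨r, h6, h7, h8⟩ := ((h2 y hy).and_eventually (h5.and self_mem_nhdsWithin)).exists
      exact ⟨r, h8, h7, by rwa [one_mul], subset_univ _⟩)
  obtain ⟨t, ht⟩ := exists_finset_lt_measure_biUnion huc _ (ha.trans_le (measure_mono hcov))
  have hsumt : ∑ y ∈ t, μ (ball y (ρ y)) / ENNReal.ofReal (ρ y) ≤ K * ν univ :=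
    (ENNReal.sum_le_tsum t).trans hsum
  obtain ⟨η, h, hc, hη1, hη2, hh⟩ := exists_cutoff_finset (t.map (Function.Embedding.subtype _))
    (fun y => 6 * ρ y) (by
      intro y hy
      obtain ⟨z, -, rfl⟩ := Finset.mem_map.1 hy
      have := (hρ _ z.2).1
      simp only [Function.Embedding.subtype_apply]
      positivity)
  simp only [Finset.sum_map, Function.Embedding.subtype_apply] at hη2 hh
  refine ⟨η, h, hc, ?_, ?_, ?_⟩
  · calc _ ≤ _ := hη2 _
      _ ≤ ∑ y ∈ t, ENNReal.ofReal R * C₁ * (μ (ball y (ρ y)) / ENNReal.ofReal (ρ y)) := by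
        refine Finset.sum_le_sum fun y _ => ?_
        have hy := hρ y y.2
        calc μ.restrict F (ball y (2 * (6 * ρ y))) ≤ μ (ball y (12 * ρ y)) := by
              rw [show 2 * (6 * ρ y) = 12 * ρ y by ring]
              exact Measure.restrict_apply_le _ _
          _ ≤ C₁ * μ (ball y (ρ y)) := hC₁ _ _ hy.1
          _ = C₁ * (ENNReal.ofReal (ρ y) * (μ (ball y (ρ y)) / ENNReal.ofReal (ρ y))) := by
            rw [ENNReal.mul_div_cancel (by simpa using hy.1) (by simp)]
          _ ≤ C₁ * (ENNReal.ofReal R * (μ (ball y (ρ y)) / ENNReal.ofReal (ρ y))) := by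
            gcongr; exact hy.2
          _ = _ := by ring
      _ ≤ ENNReal.ofReal R * C₁ * (K * ν univ) := by
        rw [← Finset.mul_sum]; gcongr
      _ ≤ ε' := by rwa [mul_assoc]
  · refine ht.le.trans ?_
    have hm : MeasurableSet (⋃ y ∈ t, ball (y : X) (6 * 1 * ρ y)) :=
      t.measurableSet_biUnion fun y _ => measurableSet_ball
    calc ν (⋃ y ∈ t, ball (y : X) (6 * 1 * ρ y))
        = ∫⁻ x in ⋃ y ∈ t, ball (y : X) (6 * 1 * ρ y), ENNReal.ofReal (η x) ∂ν := by
          rw [setLIntegral_congr_fun (g := fun _ => 1) hm, setLIntegral_one]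
          intro x hx
          obtain ⟨y, hy, hxy⟩ := mem_iUnion₂.1 hx
          rw [mul_one] at hxy
          simp [hη1 y (Finset.mem_map_of_mem _ hy) x (ball_subset_closedBall hxy)]
      _ ≤ _ := setLIntegral_le_lintegral _ _
  · calc _ ≤ _ := hh _
      _ ≤ ∑ y ∈ t, ε * C₂ * (μ (ball y (ρ y)) / ENNReal.ofReal (ρ y)) := by
        refine Finset.sum_le_sum fun y _ => ?_
        have hy := hρ y y.2
        calc μ.restrict F (ball y (3 * (6 * ρ y))) / ENNReal.ofReal (6 * ρ y)
            ≤ ε * μ (ball y (18 * ρ y)) / ENNReal.ofReal (ρ y) := by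
              rw [Measure.restrict_apply measurableSet_ball, show 3 * (6 * ρ y) = 18 * ρ y by ring]
              refine ENNReal.div_le_div (h1 y (huS y.2) _ (by linarith) (by linarith)) ?_
              exact ENNReal.ofReal_le_ofReal (by linarith)
          _ ≤ ε * (C₂ * μ (ball y (ρ y))) / ENNReal.ofReal (ρ y) := by
              gcongr; exact hC₂ _ _ hy.1
          _ = _ := by rw [← mul_assoc, mul_div_assoc]
      _ ≤ ε * (C₂ * (K * ν univ)) := by
        rw [← Finset.mul_sum, mul_assoc]; gcongr

lemma IsPerimeterMeasure.codimH_eq_zero [ProperSpace X] [BorelSpace X]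
    (hν : IsPerimeterMeasure μ CP lam F ν) (hdbl : DoublingWith μ Cd)
    (h0 : ∀ R : ℝ, 0 < R → codimHContent μ R ∅ = 0) (K : ℝ≥0) :
    codimH μ {x | ZeroDensityAt μ F x ∧
      ∃ᶠ r in 𝓝[>] (0 : ℝ), μ (ball x r) ≤ K * ENNReal.ofReal r * ν (closedBall x r)} = 0 := by
  set S := {x | ZeroDensityAt μ F x ∧
      ∃ᶠ r in 𝓝[>] (0 : ℝ), μ (ball x r) ≤ K * ENNReal.ofReal r * ν (closedBall x r)} with hS
  have := hν.finite
  obtain ⟨M, hM⟩ := hν.measure_le_of_density_le hdbl K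
  have hνS : ν S = 0 := by
    have key : ∀ ε : ℝ≥0∞, ε ≠ 0 → ν S ≤ ε * M := by
      intro ε hε
      set T : ℕ → Set X := fun k => {x ∈ S | ∀ r : ℝ, 0 < r → r < 1 / (k + 1) →
        μ (ball x r ∩ F) ≤ ε * μ (ball x r)} with hT
      have hmono : Monotone T := by
        intro k l hkl x hx
        refine ⟨hx.1, fun r hr hr' => hx.2 r hr (hr'.trans_le ?_)⟩
        exact one_div_le_one_div_of_le (by positivity) (by gcongr)
      have hST : S ⊆ ⋃ k, T k := by
        intro x hx
        have h1 := (hx.1.eventually_le hdbl hε)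
        obtain ⟨δ, hδ, h2⟩ := mem_nhdsGT_iff_exists_Ioo_subset.1 h1
        obtain ⟨k, hk⟩ := exists_nat_one_div_lt (mem_Ioi.1 hδ)
        exact mem_iUnion.2 ⟨k, hx, fun r hr hr' => h2 ⟨hr, hr'.trans hk⟩⟩
      refine (measure_mono hST).trans ?_
      rw [hmono.measure_iUnion]
      exact iSup_le fun k => hM _ _ _ (by positivity) (fun x hx => hx.2) fun x hx => hx.1.2
    refine le_antisymm (ge_of_tendsto (x := 𝓝[>] (0 : ℝ≥0∞)) (f := fun ε : ℝ≥0∞ => ε * M) ?_ ?_) zero_le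
    · have := ENNReal.Tendsto.mul_const (b := (M : ℝ≥0∞)) (tendsto_id (x := 𝓝 (0 : ℝ≥0∞)))
        (Or.inr coe_ne_top)
      rw [zero_mul] at this
      exact this.mono_left nhdsWithin_le_nhds
    · filter_upwards [self_mem_nhdsWithin] with ε hε
      exact key ε (ne_of_gt hε)
  obtain ⟨C, hC⟩ := exists_codimHContent_le hdbl h0 (σ := 1) le_rfl
  refine codimH_eq_zero_iff.2 fun R hR => ?_
  refine le_antisymm (ge_of_tendsto (x := 𝓝[>] (0 : ℝ≥0∞)) (f := fun ε : ℝ≥0∞ => C * (K * ε)) ?_ ?_) zero_le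
  · have h1 := ENNReal.Tendsto.const_mul (a := (K : ℝ≥0∞)) (tendsto_id (x := 𝓝 (0 : ℝ≥0∞)))
      (Or.inr coe_ne_top)
    have h2 := ENNReal.Tendsto.const_mul (a := (C : ℝ≥0∞)) h1 (Or.inr coe_ne_top)
    rw [mul_zero, mul_zero] at h2
    exact h2.mono_left nhdsWithin_le_nhds
  · filter_upwards [self_mem_nhdsWithin] with ε hε
    obtain ⟨U, hSU, hUo, hU⟩ := S.exists_isOpen_lt_of_lt ε (hνS.trans_lt hε)
    have h1 := hC ν K (R / 6) S U (by positivity) (by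
      intro y hy
      have h5 : ∀ᶠ r : ℝ in 𝓝[>] 0, r ≤ R / 6 :=
        (Iic_mem_nhds (by positivity) |> mem_nhdsWithin_of_mem_nhds : Iic (R / 6) ∈ 𝓝[>] 0)
      obtain ⟨δ, hδ, hδU⟩ := Metric.isOpen_iff.1 hUo y (hSU hy)
      have h6 : ∀ᶠ r : ℝ in 𝓝[>] 0, r < δ :=
        (Iio_mem_nhds hδ |> mem_nhdsWithin_of_mem_nhds : Iio δ ∈ 𝓝[>] 0)
      obtain ⟨r, h7, ⟨h8, h9⟩, h10⟩ :=
        (hy.2.and_eventually ((h5.and h6).and self_mem_nhdsWithin)).exists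
      refine ⟨r, h10, h8, by rwa [one_mul], ?_⟩
      rw [one_mul]
      exact (closedBall_subset_ball h9).trans hδU)
    rw [show 6 * 1 * (R / 6) = R by ring] at h1
    exact h1.trans (by gcongr)

end ZeroDensity

/-! ### Removing small sets -/

section Removing

variable {μ ν : Measure X} {Cd : ℝ≥0} {CP lam : ℝ} {F : Set X}

lemma eventually_nhdsGT_zero_le {a : ℝ} (ha : 0 < a) : ∀ᶠ r : ℝ in 𝓝[>] 0, r ≤ a :=
  (mem_nhdsWithin_of_mem_nhds (Iic_mem_nhds ha) : Iic a ∈ 𝓝[>] 0)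

lemma exists_set_of_tendsto_content [BorelSpace X] (hdbl : DoublingWith μ Cd) {x : X}
    (D : ℕ → Set X)
    (hx : ∀ j, x ∉ D j)
    (h1 : ∀ j, Tendsto (fun r : ℝ => codimHContent μ 1 (D j ∩ ball x r)) (𝓝[>] 0) (𝓝 0))
    (h2 : ∀ j, Tendsto (fun r : ℝ =>
      ENNReal.ofReal r * codimHContent μ 1 (D j ∩ ball x r) / μ (ball x r)) (𝓝[>] 0) (𝓝 0)) :
    ∃ A : Set X, x ∈ A ∧
      Tendsto (fun r : ℝ =>
          ENNReal.ofReal r * codimHContent μ 1 (ball x r \ A) / μ (ball x r))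
        (𝓝[>] 0) (𝓝 0) ∧
      ∀ j, ∀ᶠ y in 𝓝[A] x, y ∉ D j := by
  obtain ⟨ε, hε0, hεs⟩ := ENNReal.exists_pos_sum_of_countable' (ε := 1) one_ne_zero ℕ
  have hρ : ∀ j, ∃ ρ : ℝ, 0 < ρ ∧ ∀ r : ℝ, 0 < r → r ≤ 1 →
      ENNReal.ofReal r * codimHContent μ 1 (D j ∩ ball x (min r ρ)) / μ (ball x r) ≤ ε j := by
    intro j
    obtain ⟨δ, hδ, hδ'⟩ := mem_nhdsGT_iff_exists_Ioc_subset.1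
      (ENNReal.tendsto_nhds_zero.1 (h2 j) (ε j) (hε0 j))
    have hδ0 : 0 < δ := hδ
    have hm0 := hdbl.measure_ball_ne_zero (x := x) hδ0
    have hmt := hdbl.measure_ball_ne_top x δ
    obtain ⟨ρ, ⟨h3, h4⟩, h5⟩ := (((ENNReal.tendsto_nhds_zero.1 (h1 j) (ε j * μ (ball x δ))
      (ENNReal.mul_pos (hε0 j).ne' hm0)).and (eventually_nhdsGT_zero_le hδ0)).and
        self_mem_nhdsWithin).exists
    refine ⟨ρ, h5, fun r hr hr1 => ?_⟩
    rcases le_total r δ with hrδ | hrδ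
    · refine le_trans ?_ (hδ' ⟨hr, hrδ⟩)
      gcongr
      refine codimHContent_mono (inter_subset_inter_right _ (ball_subset_ball (min_le_left _ _)))
    · refine ENNReal.div_le_of_le_mul ?_
      calc ENNReal.ofReal r * codimHContent μ 1 (D j ∩ ball x (min r ρ))
          ≤ ENNReal.ofReal 1 * codimHContent μ 1 (D j ∩ ball x ρ) := by
            gcongr
            exact codimHContent_mono
              (inter_subset_inter_right _ (ball_subset_ball (min_le_right _ _)))
        _ ≤ ε j * μ (ball x δ) := by simpa using h3
        _ ≤ ε j * μ (ball x r) := by gcongr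
  choose ρ hρ0 hρ using hρ
  refine ⟨(⋃ j, D j ∩ ball x (ρ j))ᶜ, ?_, ?_, fun j => ?_⟩
  · simp only [mem_compl_iff, mem_iUnion, not_exists]
    exact fun j hj => hx j hj.1
  · have key : Tendsto (fun r : ℝ => ∑' j,
        ENNReal.ofReal r * codimHContent μ 1 (D j ∩ ball x (min r (ρ j))) / μ (ball x r))
        (𝓝[>] 0) (𝓝 0) := by
      have := tendsto_lintegral_filter_of_dominated_convergence (μ := Measure.count)
        (l := 𝓝[>] (0 : ℝ)) (F := fun r j => ENNReal.ofReal r *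
          codimHContent μ 1 (D j ∩ ball x (min r (ρ j))) / μ (ball x r)) (f := fun _ => 0) ε
        (Eventually.of_forall fun r => measurable_of_countable _)
        (by
          filter_upwards [self_mem_nhdsWithin, eventually_nhdsGT_zero_le one_pos] with r hr hr1
          exact Eventually.of_forall fun j => hρ j r hr hr1)
        (by rw [lintegral_count]; exact (hεs.trans one_lt_top).ne)
        (Eventually.of_forall fun j => by
          refine (h2 j).congr' ?_
          filter_upwards [eventually_nhdsGT_zero_le (hρ0 j)] with r hr
          rw [min_eq_left hr])
      simpa only [lintegral_count, tsum_zero] using this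
    refine tendsto_of_tendsto_of_tendsto_of_le_of_le tendsto_const_nhds key (fun _ => zero_le)
      fun r => ?_
    simp only [div_eq_mul_inv, ENNReal.tsum_mul_right, ENNReal.tsum_mul_left]
    gcongr
    refine le_trans (codimHContent_mono ?_) (codimHContent_iUnion_nat_le _)
    rintro y ⟨hy, hyA⟩
    obtain ⟨j, hj⟩ := mem_iUnion.1 (not_not.1 hyA)
    exact mem_iUnion.2 ⟨j, hj.1, mem_ball.2 (lt_min hy hj.2)⟩
  · filter_upwards [self_mem_nhdsWithin, mem_nhdsWithin_of_mem_nhds (ball_mem_nhds x (hρ0 j))]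
      with y hyA hy hyD
    exact hyA (mem_iUnion.2 ⟨j, hyD, hy⟩)

lemma IsPerimeterMeasure.tendsto_content [ProperSpace X] [BorelSpace X]
    (hν : IsPerimeterMeasure μ CP lam F ν) (hCd : 1 ≤ Cd) (hdbl : DoublingWith μ Cd)
    (hF : MeasurableSet F) (hCP : 0 < CP) (hlam : 1 ≤ lam)
    (h0 : ∀ R : ℝ, 0 < R → codimHContent μ R ∅ = 0) {x : X} (hx : ZeroDensityAt μ F x)
    (hxS : ∀ K : ℕ, ¬ ∃ᶠ r in 𝓝[>] (0 : ℝ),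
      μ (ball x r) ≤ (K : ℝ≥0) * ENNReal.ofReal r * ν (closedBall x r))
    {c : ℝ≥0∞} (hc0 : c ≠ 0) (hc : c ≤ 1 / 2) {D N : Set X} (hN : codimH μ N = 0)
    (hD : ∀ y ∈ D, y ∉ N → ∀ᶠ r in 𝓝[>] (0 : ℝ), c * μ (ball y r) < μ (ball y r ∩ F)) :
    Tendsto (fun r : ℝ => codimHContent μ 1 (D ∩ ball x r)) (𝓝[>] 0) (𝓝 0) ∧
    Tendsto (fun r : ℝ =>
      ENNReal.ofReal r * codimHContent μ 1 (D ∩ ball x r) / μ (ball x r)) (𝓝[>] 0) (𝓝 0) := by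
  have := hν.finite
  have hctop : c ≠ ⊤ := ne_top_of_le_ne_top (by simp) hc
  obtain ⟨C, hC⟩ := exists_codimHContent_le hdbl h0 (σ := 2 * lam) (by linarith)
  set K : ℝ≥0∞ := 2 * ENNReal.ofReal CP * (Cd / c) with hK
  have hKt : K ≠ ⊤ := ENNReal.mul_ne_top (ENNReal.mul_ne_top (by simp) ofReal_ne_top)
    (ENNReal.div_ne_top coe_ne_top hc0)
  have hCK : (C : ℝ≥0∞) * K ≠ ⊤ := ENNReal.mul_ne_top coe_ne_top hKt
  have hl0 : 0 < lam := one_pos.trans_le hlam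
  have key : ∀ᶠ r in 𝓝[>] (0 : ℝ),
      codimHContent μ 1 (D ∩ ball x r) ≤ C * K * ν (closedBall x (2 * r)) := by
    obtain ⟨A', hA'⟩ := hdbl.exists_ball_mul_le (6 * lam)
    have hev := (tendsto_mul_nhdsGT_zero two_pos).eventually (hx.eventually_le hdbl
      (ε := c / (A' + 1)) (ENNReal.div_ne_zero.2 ⟨hc0, by finiteness⟩))
    filter_upwards [hev, self_mem_nhdsWithin, eventually_nhdsGT_zero_le (a := 1 / 6) (by norm_num)]
      with r hr hr0 hr1
    have hr0' : (0 : ℝ) < r := hr0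
    have hR : 0 < r / (2 * lam) := by positivity
    have hRr : r / (2 * lam) ≤ r := div_le_self hr0'.le (by linarith)
    have hb := hC ν K (r / (2 * lam)) ((D \ N) ∩ ball x r) (closedBall x (2 * r)) hR (by
      rintro y ⟨⟨hyD, hyN⟩, hyx⟩
      have hyx' : dist y x < r := hyx
      have h1 : μ (ball y (r / (2 * lam)) ∩ F) ≤ c * μ (ball y (r / (2 * lam))) := by
        calc μ (ball y (r / (2 * lam)) ∩ F) ≤ μ (ball x (2 * r) ∩ F) := by
              refine measure_mono (inter_subset_inter_left _ (ball_subset_ball' ?_))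
              linarith
          _ ≤ c / (A' + 1) * μ (ball x (2 * r)) := hr
          _ ≤ c / (A' + 1) * μ (ball y (6 * lam * (r / (2 * lam)))) := by
              gcongr
              refine ball_subset_ball' ?_
              rw [dist_comm]
              have : 6 * lam * (r / (2 * lam)) = 3 * r := by field_simp; ring
              linarith
          _ ≤ c / (A' + 1) * (A' * μ (ball y (r / (2 * lam)))) := by gcongr; exact hA' y _ hR
          _ ≤ c / (A' + 1) * ((A' + 1) * μ (ball y (r / (2 * lam)))) := by
              gcongr; exact le_self_add
          _ = c * μ (ball y (r / (2 * lam))) := by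
              rw [← mul_assoc, ENNReal.div_mul_cancel (by simp) (by finiteness)]
      obtain ⟨ρ, h2, h3, h4⟩ := hν.exists_radius hCd hdbl hF hCP hc0 hc hR h1 (hD y hyD hyN)
      refine ⟨ρ, h2, h3, h4, closedBall_subset_closedBall' ?_⟩
      have : 2 * lam * ρ ≤ r := by
        calc 2 * lam * ρ ≤ 2 * lam * (r / (2 * lam)) := by gcongr
          _ = r := by field_simp
      linarith)
    have e : 6 * (2 * lam) * (r / (2 * lam)) = 6 * r := by field_simp
    rw [e] at hb
    have hN1 : codimHContent μ 1 N = 0 := codimH_eq_zero_iff.1 hN 1 one_pos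
    have hsub : D ∩ ball x r ⊆ N ∪ ((D \ N) ∩ ball x r) := by
      rintro y ⟨hy, hyr⟩
      by_cases hyN : y ∈ N
      exacts [Or.inl hyN, Or.inr ⟨⟨hy, hyN⟩, hyr⟩]
    calc codimHContent μ 1 (D ∩ ball x r)
        ≤ contentOuter μ 1 (h0 1 one_pos) (N ∪ ((D \ N) ∩ ball x r)) := codimHContent_mono hsub
      _ ≤ codimHContent μ 1 N + codimHContent μ 1 ((D \ N) ∩ ball x r) := measure_union_le _ _
      _ ≤ codimHContent μ (6 * r) ((D \ N) ∩ ball x r) := by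
        rw [hN1, zero_add]
        exact codimHContent_anti (by linarith) _
      _ ≤ _ := hb.trans_eq (mul_assoc _ _ _).symm
  constructor
  · have h1 : Tendsto (fun r : ℝ => ν (closedBall x (2 * r))) (𝓝[>] 0) (𝓝 0) := by
      have h2 := tendsto_measure_cthickening_of_isClosed (μ := ν) (s := {x})
        ⟨1, one_pos, measure_ne_top _ _⟩ isClosed_singleton
      rw [hν.measure_singleton_eq_zero hCd hdbl hF hCP hlam h0 hx] at h2
      refine ((h2.mono_left nhdsWithin_le_nhds).comp (tendsto_mul_nhdsGT_zero two_pos)).congr' ?_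
      filter_upwards [self_mem_nhdsWithin] with r hr
      have hr' : (0 : ℝ) < r := hr
      simp only [Function.comp_apply]
      rw [cthickening_singleton _ (by linarith)]
    have h2 := ENNReal.Tendsto.const_mul h1 (Or.inr hCK)
    rw [mul_zero] at h2
    exact tendsto_of_tendsto_of_tendsto_of_le_of_le' tendsto_const_nhds h2
      (Eventually.of_forall fun _ => zero_le) key
  · refine ENNReal.tendsto_nhds_zero.2 fun ε hε => ?_
    obtain ⟨k, hk⟩ := ENNReal.exists_nat_gt (r := C * K * Cd / ε)
      (ENNReal.div_ne_top (by finiteness) hε.ne')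
    have hev := (tendsto_mul_nhdsGT_zero two_pos).eventually (not_frequently.1 (hxS k))
    filter_upwards [key, hev, self_mem_nhdsWithin] with r h1 h2 hr0
    have hr0' : (0 : ℝ) < r := hr0
    have hm0 := hdbl.measure_ball_ne_zero (x := x) hr0'
    have hmt := hdbl.measure_ball_ne_top x r
    have h3 : k * (ENNReal.ofReal r * ν (closedBall x (2 * r))) ≤ Cd * μ (ball x r) := by
      calc _ = k * ENNReal.ofReal r * ν (closedBall x (2 * r)) := by ring
        _ ≤ (k : ℝ≥0) * ENNReal.ofReal (2 * r) * ν (closedBall x (2 * r)) := by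
          push_cast
          gcongr
          linarith
        _ ≤ μ (ball x (2 * r)) := (not_le.1 h2).le
        _ ≤ _ := (hdbl x r hr0').2.1
    refine ENNReal.div_le_of_le_mul ?_
    have hk0 : (k : ℝ≥0∞) ≠ 0 := (zero_le.trans_lt hk).ne'
    calc ENNReal.ofReal r * codimHContent μ 1 (D ∩ ball x r)
        ≤ ENNReal.ofReal r * (C * K * ν (closedBall x (2 * r))) := by gcongr
      _ = C * K * (ENNReal.ofReal r * ν (closedBall x (2 * r))) := by ring
      _ ≤ C * K * (Cd * μ (ball x r) / k) := by
        gcongr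
        rw [ENNReal.le_div_iff_mul_le (Or.inl hk0) (Or.inl (by simp)), mul_comm]
        exact h3
      _ = (C * K * Cd / k) * μ (ball x r) := by
        simp only [div_eq_mul_inv]; ring
      _ ≤ ε * μ (ball x r) := by
        gcongr
        rw [ENNReal.div_le_iff_le_mul (Or.inl hk0) (Or.inl (by simp))]
        rw [ENNReal.div_lt_iff (Or.inl hε.ne') (Or.inr (by finiteness))] at hk
        rw [mul_comm ε]
        exact hk.le

end Removing

section Fine

variable {μ ν : Measure X} {Cd : ℝ≥0} {CP lam γ : ℝ} {F : Set X}

lemma GammaDensityProperty.codimHContent_empty [ProperSpace X] [Nonempty X]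
    (hγ : GammaDensityProperty μ γ) :
    ∀ R : ℝ, 0 < R → codimHContent μ R ∅ = 0 := by
  have h := hγ ∅ MeasurableSet.empty (by rw [perimeter_empty]; exact zero_lt_top)
  exact codimH_eq_zero_iff.1 (codimH_mono_null (empty_subset _) h)

/-- The lower density of `F` at `x` is at least `γ`. -/
def LowerDensityAtLeast (μ : Measure X) (γ : ℝ) (F : Set X) (x : X) : Prop :=
  ENNReal.ofReal γ ≤ liminf (fun r : ℝ => μ (ball x r ∩ F) / μ (ball x r)) (𝓝[>] 0)

lemma zeroDensityAt_of_limsup_le {x : X}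
    (h : limsup (fun r : ℝ => μ (ball x r ∩ F) / μ (ball x r)) (𝓝[>] 0) ≤ 0) :
    ZeroDensityAt μ F x :=
  tendsto_of_le_liminf_of_limsup_le zero_le h

lemma ZeroDensityAt.le_liminf_compl (hdbl : DoublingWith μ Cd) (hF : MeasurableSet F) {x : X}
    (h : ZeroDensityAt μ Fᶜ x) :
    1 ≤ liminf (fun r : ℝ => μ (ball x r ∩ F) / μ (ball x r)) (𝓝[>] 0) := by
  have h1 : Tendsto (fun r : ℝ => 1 - μ (ball x r ∩ Fᶜ) / μ (ball x r)) (𝓝[>] 0) (𝓝 (1 - 0)) :=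
    ENNReal.Tendsto.sub tendsto_const_nhds h (Or.inl one_ne_top)
  rw [tsub_zero] at h1
  rw [← h1.liminf_eq]
  refine liminf_le_liminf ?_
  filter_upwards [self_mem_nhdsWithin] with r hr
  have hr' : (0 : ℝ) < r := hr
  rw [tsub_le_iff_right, ← ENNReal.add_div, ← sdiff_eq, measure_inter_add_sdiff _ hF,
    ENNReal.div_self (hdbl.measure_ball_ne_zero hr') (hdbl.measure_ball_ne_top x r)]

lemma GammaDensityProperty.codimH_eq_zero (hγ : GammaDensityProperty μ γ) (hγ1 : γ ≤ 1)
    (hdbl : DoublingWith μ Cd) (hF : MeasurableSet F) (hP : perimeter μ F univ < ⊤) :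
    codimH μ {x | ¬ (ZeroDensityAt μ F x ∨ LowerDensityAtLeast μ γ F x)} = 0 := by
  refine codimH_mono_null ?_ (hγ F hF hP)
  intro x hx
  simp only [mem_ofPred_eq, not_or] at hx
  refine ⟨⟨?_, ?_⟩, fun h => hx.2 h.1⟩
  · by_contra h
    exact hx.1 (zeroDensityAt_of_limsup_le (not_lt.1 h))
  · by_contra h
    have h1 : ZeroDensityAt μ Fᶜ x := zeroDensityAt_of_limsup_le (not_lt.1 h)
    refine hx.2 (le_trans ?_ (h1.le_liminf_compl hdbl hF))
    rw [← ENNReal.ofReal_one]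
    exact ENNReal.ofReal_le_ofReal hγ1

lemma LowerDensityAtLeast.eventually_lt (hdbl : DoublingWith μ Cd) {x : X}
    (h : LowerDensityAtLeast μ γ F x) {c : ℝ≥0∞} (hc : c < ENNReal.ofReal γ) :
    ∀ᶠ r in 𝓝[>] (0 : ℝ), c * μ (ball x r) < μ (ball x r ∩ F) := by
  filter_upwards [eventually_lt_of_lt_liminf (hc.trans_le h), self_mem_nhdsWithin] with r h1 hr
  have hr' : (0 : ℝ) < r := hr
  exact (ENNReal.lt_div_iff_mul_lt (Or.inl (hdbl.measure_ball_ne_zero hr'))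
    (Or.inl (hdbl.measure_ball_ne_top x r))).1 h1

/-- At `H`-almost every point, a countable family of sets of finite perimeter has density zero
near the point along a set with small complement whenever it has density zero at the point. -/
lemma exists_set_zeroDensityAt_nat [ProperSpace X] [Nonempty X] [BorelSpace X] (hCd : 1 ≤ Cd)
    (hdbl : DoublingWith μ Cd) (hCP : 0 < CP) (hlam : 1 ≤ lam) (hPI : PoincareIneq μ CP lam)
    (hγ0 : 0 < γ) (hγhalf : γ ≤ 1 / 2) (hγ : GammaDensityProperty μ γ)
    (F : ℕ → Set X) (hF : ∀ i, MeasurableSet (F i)) (hP : ∀ i, perimeter μ (F i) univ < ⊤) :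
    codimH μ {x | ¬ ((∀ i, ZeroDensityAt μ (F i) x ∨ LowerDensityAtLeast μ γ (F i) x) ∧
      ∃ A : Set X, x ∈ A ∧
      Tendsto (fun r : ℝ =>
          ENNReal.ofReal r * codimHContent μ 1 (ball x r \ A) / μ (ball x r))
        (𝓝[>] 0) (𝓝 0) ∧
      ∀ i, ZeroDensityAt μ (F i) x → ∀ᶠ y in 𝓝[A] x, ZeroDensityAt μ (F i) y)} = 0 := by
  have h0 := hγ.codimHContent_empty
  choose ν hν using fun i => exists_isPerimeterMeasure hdbl hlam hPI (hF i) (hP i)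
  have h1 : codimH μ (⋃ i, {x | ¬ (ZeroDensityAt μ (F i) x ∨ LowerDensityAtLeast μ γ (F i) x)})
      = 0 :=
    codimH_iUnion_null h0 fun i => hγ.codimH_eq_zero (by linarith) hdbl (hF i) (hP i)
  have h2 : codimH μ (⋃ i, ⋃ K : ℕ, {x | ZeroDensityAt μ (F i) x ∧
      ∃ᶠ r in 𝓝[>] (0 : ℝ), μ (ball x r) ≤ (K : ℝ≥0) * ENNReal.ofReal r *
        ν i (closedBall x r)}) = 0 :=
    codimH_iUnion_null h0 fun i => codimH_iUnion_null h0 fun K =>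
      (hν i).codimH_eq_zero hdbl h0 K
  refine codimH_mono_null ?_ (codimH_union_null h0 h1 h2)
  intro x hx
  by_contra hcon
  simp only [mem_union, mem_iUnion, not_or, not_exists, mem_ofPred_eq, not_and, not_not] at hcon
  obtain ⟨hg, hs⟩ := hcon
  refine hx ⟨fun i => or_iff_not_imp_left.2 (hg i), ?_⟩
  classical
  set D : ℕ → Set X := fun i => if ZeroDensityAt μ (F i) x then {y | ¬ ZeroDensityAt μ (F i) y}
    else ∅ with hDdef
  have hD : ∀ i, Tendsto (fun r : ℝ => codimHContent μ 1 (D i ∩ ball x r)) (𝓝[>] 0) (𝓝 0) ∧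
    Tendsto (fun r : ℝ =>
      ENNReal.ofReal r * codimHContent μ 1 (D i ∩ ball x r) / μ (ball x r)) (𝓝[>] 0) (𝓝 0) := by
    intro i
    by_cases hi : ZeroDensityAt μ (F i) x
    · have hc : ENNReal.ofReal (γ / 2) ≤ 1 / 2 := by
        rw [← ENNReal.ofReal_one, show (2 : ℝ≥0∞) = ENNReal.ofReal 2 by simp,
          ← ENNReal.ofReal_div_of_pos two_pos]
        exact ENNReal.ofReal_le_ofReal (by linarith)
      refine (hν i).tendsto_content hCd hdbl (hF i) hCP hlam h0 hi (fun K => hs i K hi)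
        (c := ENNReal.ofReal (γ / 2)) (by simpa using hγ0) hc
        (hγ.codimH_eq_zero (by linarith) hdbl (hF i) (hP i)) fun y hy hyN => ?_
      simp only [hDdef, hi, if_true, mem_ofPred_eq] at hy
      have h3 := (not_not.1 hyN).resolve_left hy
      exact h3.eventually_lt hdbl ((ENNReal.ofReal_lt_ofReal_iff hγ0).2 (by linarith))
    · simp only [hDdef, hi, if_false, empty_inter, h0 1 one_pos, mul_zero, ENNReal.zero_div]
      exact ⟨tendsto_const_nhds, tendsto_const_nhds⟩
  obtain ⟨A, hxA, hA1, hA2⟩ := exists_set_of_tendsto_content hdbl D (x := x) (fun j hj => by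
    simp only [hDdef] at hj
    split_ifs at hj with h
    exacts [hj h, hj]) (fun j => (hD j).1) (fun j => (hD j).2)
  refine ⟨A, hxA, hA1, fun i hi => ?_⟩
  filter_upwards [hA2 i] with y hy
  simpa only [hDdef, hi, if_true, mem_ofPred_eq, not_not] using hy

end Fine

/-! ### The coarea inequality -/

section Coarea

variable {μ : Measure X} {Cd : ℝ≥0}

/-- The piecewise linear function of `b` that is `0` for `b ≤ t` and `1` for `b ≥ t + h`. -/
def ramp (h b t : ℝ) : ℝ := max 0 (min 1 ((b - t) / h))

lemma ramp_nonneg (h b t : ℝ) : 0 ≤ ramp h b t := le_max_left _ _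

lemma ramp_le_one (h b t : ℝ) : ramp h b t ≤ 1 := max_le zero_le_one (min_le_left _ _)

lemma ramp_eq_zero {h b t : ℝ} (hh : 0 < h) (hb : b ≤ t) : ramp h b t = 0 :=
  max_eq_left ((min_le_right _ _).trans (div_nonpos_of_nonpos_of_nonneg (by linarith) hh.le))

lemma ramp_eq_one {h b t : ℝ} (hh : 0 < h) (hb : t + h ≤ b) : ramp h b t = 1 := by
  have : 1 ≤ (b - t) / h := by rw [le_div_iff₀ hh]; linarith
  rw [ramp, min_eq_left this, max_eq_right zero_le_one]

lemma abs_ramp_sub_le {h : ℝ} (hh : 0 < h) (b b' t : ℝ) :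
    |ramp h b t - ramp h b' t| ≤ h⁻¹ * |b - b'| := by
  have h1 : |ramp h b t - ramp h b' t| ≤ |(b - t) / h - (b' - t) / h| := by
    refine (abs_max_sub_max_le_max _ _ _ _).trans (max_le (by simp) ?_)
    refine (abs_min_sub_min_le_max _ _ _ _).trans (max_le (by simp) le_rfl)
  refine h1.trans (le_of_eq ?_)
  rw [← _root_.sub_div, abs_div, abs_of_pos hh, sub_sub_sub_cancel_right, div_eq_inv_mul]

lemma measurable_ramp (h : ℝ) : Measurable fun p : ℝ × ℝ => ramp h p.1 p.2 := by
  unfold ramp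
  fun_prop

lemma lintegral_abs_ramp_sub_le {h : ℝ} (hh : 0 < h) (a b : ℝ) :
    ∫⁻ t, ENNReal.ofReal |ramp h b t - if t < a then 1 else 0| ≤
      ENNReal.ofReal |b - a| + ENNReal.ofReal h := by
  have h1 : ∀ t, ENNReal.ofReal |ramp h b t - if t < a then 1 else 0| ≤
      (Ioo (b - h) a ∪ Ico a b).indicator (fun _ => 1) t := by
    intro t
    have hle : |ramp h b t - if t < a then 1 else 0| ≤ 1 := by
      have h0 := ramp_nonneg h b t
      have h2 := ramp_le_one h b t
      rw [abs_le]
      split_ifs <;> constructor <;> linarith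
    by_cases ht : t ∈ Ioo (b - h) a ∪ Ico a b
    · rw [indicator_of_mem ht]
      exact ENNReal.ofReal_le_one.2 hle
    · rw [indicator_of_notMem ht]
      simp only [mem_union, mem_Ioo, mem_Ico, not_or, not_and, not_lt] at ht
      split_ifs with hta
      · have : t ≤ b - h := by
          by_contra hcon
          exact absurd (ht.1 (not_le.1 hcon)) (not_le.2 hta)
        rw [ramp_eq_one hh (by linarith)]
        simp
      · rw [ramp_eq_zero hh (ht.2 (not_lt.1 hta))]
        simp
  refine (lintegral_mono h1).trans ?_
  rw [lintegral_indicator (measurableSet_Ioo.union measurableSet_Ico), setLIntegral_const, one_mul]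
  refine (measure_union_le _ _).trans ?_
  rw [Real.volume_Ioo, Real.volume_Ico, ← ENNReal.ofReal_add (abs_nonneg _) hh.le]
  rcases le_total a b with hab | hab
  · rw [abs_of_nonneg (by linarith), add_comm]
    have : ENNReal.ofReal (a - (b - h)) ≤ ENNReal.ofReal h := ENNReal.ofReal_le_ofReal (by linarith)
    rw [ENNReal.ofReal_add (by linarith) hh.le]
    gcongr
  · rw [abs_of_nonpos (by linarith), ENNReal.ofReal_of_nonpos (p := b - a) (by linarith), add_zero]
    exact ENNReal.ofReal_le_ofReal (by linarith)

lemma isUpperGradient_ramp [BorelSpace X] {v : X → ℝ} {g : X → ℝ≥0∞} (hv : Continuous v)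
    (hg : IsUpperGradient g v) {h : ℝ} (hh : 0 < h) (t : ℝ) :
    IsUpperGradient (fun x => Real.toNNReal h⁻¹ *
      (v ⁻¹' Ioo (t - h) (t + 2 * h)).indicator g x) fun x => ramp h (v x) t := by
  have hm : Measurable fun x => (Real.toNNReal h⁻¹ : ℝ≥0∞) *
      (v ⁻¹' Ioo (t - h) (t + 2 * h)).indicator g x :=
    (hg.1.indicator (hv.measurable measurableSet_Ioo)).const_mul _
  refine isUpperGradient_of_locally hm fun x => ?_
  by_cases hx : v x ∈ Ioo (t - h) (t + 2 * h)
  · obtain ⟨ρ, hρ, hρs⟩ := Metric.isOpen_iff.1 (isOpen_Ioo.preimage hv) x hx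
    refine ⟨ρ, hρ, ?_⟩
    have h1 : IsUpperGradientOn (fun x => (Real.toNNReal h⁻¹ : ℝ≥0∞) * g x)
        (fun x => ramp h (v x) t) (ball x ρ) := by
      refine (hg.mono_set (subset_univ _)).const_mul _ fun y _ z _ => ?_
      rw [Real.coe_toNNReal _ (by positivity)]
      exact abs_ramp_sub_le hh _ _ _
    refine h1.of_le hm (fun y hy => ?_) fun _ _ _ _ => le_rfl
    rw [indicator_of_mem (hρs hy)]
  · rcases le_or_gt (v x) (t - h) with hx1 | hx1
    · obtain ⟨ρ, hρ, hρs⟩ := Metric.isOpen_iff.1 (isOpen_Iio.preimage hv) x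
        (show v x ∈ Iio t from mem_Iio.2 (by linarith))
      exact ⟨ρ, hρ, isUpperGradientOn_const hm (c := 0) fun y hy =>
        ramp_eq_zero hh (le_of_lt (hρs hy))⟩
    · have hx2 : t + 2 * h ≤ v x := by
        by_contra hcon
        exact hx ⟨hx1, not_le.1 hcon⟩
      obtain ⟨ρ, hρ, hρs⟩ := Metric.isOpen_iff.1 (isOpen_Ioi.preimage hv) x
        (show v x ∈ Ioi (t + h) from mem_Ioi.2 (by linarith))
      exact ⟨ρ, hρ, isUpperGradientOn_const hm (c := 1) fun y hy =>
        ramp_eq_one hh (le_of_lt (hρs hy))⟩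

lemma lintegral_lintegral_ramp_gradient_le [BorelSpace X] [SFinite μ] {v : X → ℝ} {g : X → ℝ≥0∞}
    (hv : Continuous v) (hg : Measurable g) {h : ℝ} (hh : 0 < h) :
    Measurable (fun t : ℝ => ∫⁻ x, Real.toNNReal h⁻¹ *
      (v ⁻¹' Ioo (t - h) (t + 2 * h)).indicator g x ∂μ) ∧
    ∫⁻ t : ℝ, ∫⁻ x, Real.toNNReal h⁻¹ *
      (v ⁻¹' Ioo (t - h) (t + 2 * h)).indicator g x ∂μ ≤ 3 * ∫⁻ x, g x ∂μ := by
  have hvm := hv.measurable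
  have hmeas : Measurable fun p : ℝ × X => (Real.toNNReal h⁻¹ : ℝ≥0∞) *
      (v ⁻¹' Ioo (p.1 - h) (p.1 + 2 * h)).indicator g p.2 := by
    have hset : MeasurableSet {p : ℝ × X | v p.2 ∈ Ioo (p.1 - h) (p.1 + 2 * h)} := by
      have h1 : Measurable fun p : ℝ × X => v p.2 := hvm.comp measurable_snd
      have h2 : Measurable fun p : ℝ × X => p.1 := measurable_fst
      exact (measurableSet_lt (h2.sub_const h) h1).inter
        (measurableSet_lt h1 (h2.add_const (2 * h)))
    exact ((hg.comp measurable_snd).indicator hset).const_mul _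
  refine ⟨hmeas.lintegral_prod_right', ?_⟩
  rw [lintegral_lintegral_swap hmeas.aemeasurable, ← lintegral_const_mul _ hg]
  refine lintegral_mono fun x => ?_
  calc ∫⁻ t : ℝ, Real.toNNReal h⁻¹ * (v ⁻¹' Ioo (t - h) (t + 2 * h)).indicator g x
      = ∫⁻ t : ℝ, (Ioo (v x - 2 * h) (v x + h)).indicator
          (fun _ => Real.toNNReal h⁻¹ * g x) t := by
        refine lintegral_congr fun t => ?_
        by_cases ht : t ∈ Ioo (v x - 2 * h) (v x + h)
        · rw [indicator_of_mem ht, indicator_of_mem]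
          exact ⟨by linarith [ht.2], by linarith [ht.1]⟩
        · rw [indicator_of_notMem ht, indicator_of_notMem, mul_zero]
          exact fun h' => ht ⟨by linarith [h'.2], by linarith [h'.1]⟩
    _ = 3 * g x := by
        rw [lintegral_indicator measurableSet_Ioo, setLIntegral_const, Real.volume_Ioo,
          show v x + h - (v x - 2 * h) = 3 * h by ring, mul_right_comm,
          show (Real.toNNReal h⁻¹ : ℝ≥0∞) = ENNReal.ofReal h⁻¹ from rfl,
          ← ENNReal.ofReal_mul (by positivity), show h⁻¹ * (3 * h) = 3 by field_simp]
        simp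
    _ ≤ _ := le_rfl

lemma exists_coarea [ProperSpace X] [Nonempty X] [BorelSpace X] (hdbl : DoublingWith μ Cd)
    {u : X → ℝ} (hu : Measurable u) (hTV : totalVariation μ u univ < ⊤) :
    ∃ q : ℝ → ℝ≥0∞, ∫⁻ t, q t ≠ ⊤ ∧ ∀ᵐ t : ℝ, perimeter μ {x | t < u x} univ ≤ q t := by
  obtain ⟨x₀⟩ := ‹Nonempty X›
  have := hdbl.isLocallyFiniteMeasure
  obtain ⟨ε, hε0, hεs⟩ := ENNReal.exists_pos_sum_of_countable' (ε := 1) one_ne_zero ℕ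
  set c : ℝ≥0∞ := totalVariation μ u univ + 1 with hc
  have hct : c ≠ ⊤ := by finiteness
  have hTVc : totalVariation μ u univ < c := ENNReal.lt_add_right hTV.ne one_ne_zero
  choose v g hv hg hgi hvi using fun i : ℕ =>
    exists_of_totalVariation_lt hTVc (isCompact_closedBall x₀ i) (hε0 i).ne'
  have hh : ∀ i : ℕ, ∃ h : ℝ, 0 < h ∧ ENNReal.ofReal h * μ (closedBall x₀ i) ≤ ε i := by
    intro i
    have h3 := ENNReal.Tendsto.mul_const (b := μ (closedBall x₀ i))
      (ENNReal.continuous_ofReal.tendsto 0) (Or.inr (hdbl.measure_closedBall_ne_top _ _))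
    rw [ENNReal.ofReal_zero, zero_mul] at h3
    have h4 := ENNReal.tendsto_nhds_zero.1 (h3.mono_left (nhdsWithin_le_nhds (s := Ioi 0)))
      (ε i) (hε0 i)
    obtain ⟨h, h5, h6⟩ := (h4.and self_mem_nhdsWithin).exists
    exact ⟨h, h6, h5⟩
  choose h hh0 hhε using hh
  have hvc := fun i => (hv i).continuous
  set G : ℕ → ℝ → X → ℝ≥0∞ := fun i t x => Real.toNNReal (h i)⁻¹ *
      (v i ⁻¹' Ioo (t - h i) (t + 2 * h i)).indicator (g i) x with hG
  have hGI := fun i => lintegral_lintegral_ramp_gradient_le (μ := μ) (hvc i) (hg i).1 (hh0 i)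
  refine ⟨fun t => liminf (fun i => ∫⁻ x, G i t x ∂μ) atTop, ?_, ?_⟩
  · refine ne_top_of_le_ne_top (b := 3 * c) (by finiteness) ?_
    refine (lintegral_liminf_le fun i => (hGI i).1).trans ?_
    refine (liminf_le_liminf (Eventually.of_forall fun i => (hGI i).2.trans
      (mul_le_mul_right (hgi i).le 3))).trans ?_
    rw [liminf_const]
  · set e : ℕ → ℝ → ℝ≥0∞ := fun i t => ∫⁻ x in closedBall x₀ i,
      ENNReal.ofReal |ramp (h i) (v i x) t - if t < u x then 1 else 0| ∂μ with he
    have hmeas : ∀ i, Measurable fun p : ℝ × X =>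
        ENNReal.ofReal |ramp (h i) (v i p.2) p.1 - if p.1 < u p.2 then 1 else 0| := by
      intro i
      have h1 : Measurable fun p : ℝ × X => ramp (h i) (v i p.2) p.1 :=
        (measurable_ramp (h i)).comp
          (((hvc i).measurable.comp measurable_snd).prodMk measurable_fst)
      have h2 : Measurable fun p : ℝ × X => if p.1 < u p.2 then (1 : ℝ) else 0 :=
        Measurable.ite (measurableSet_lt measurable_fst (hu.comp measurable_snd))
          measurable_const measurable_const
      have h3 : Measurable fun p : ℝ × X =>
          ramp (h i) (v i p.2) p.1 - if p.1 < u p.2 then 1 else 0 := h1.sub h2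
      exact (continuous_abs.measurable.comp h3).ennreal_ofReal
    have hem : ∀ i, Measurable (e i) := fun i => (hmeas i).lintegral_prod_right'
    have heI : ∀ i, ∫⁻ t, e i t ≤ 2 * ε i := by
      intro i
      rw [he, lintegral_lintegral_swap (hmeas i).aemeasurable]
      calc _ ≤ ∫⁻ x in closedBall x₀ i, (ENNReal.ofReal |v i x - u x| + ENNReal.ofReal (h i)) ∂μ :=
            lintegral_mono fun x => lintegral_abs_ramp_sub_le (hh0 i) _ _
        _ = (∫⁻ x in closedBall x₀ i, ENNReal.ofReal |v i x - u x| ∂μ) +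
            ENNReal.ofReal (h i) * μ (closedBall x₀ i) := by
            rw [lintegral_add_right _ measurable_const, setLIntegral_const]
        _ ≤ ε i + ε i := add_le_add (hvi i).le (hhε i)
        _ = _ := (two_mul _).symm
    have hes : ∫⁻ t, ∑' i, e i t ≠ ⊤ := by
      rw [lintegral_tsum fun i => (hem i).aemeasurable]
      refine ne_top_of_le_ne_top (b := 2 * 1) (by finiteness) ?_
      refine (ENNReal.tsum_le_tsum heI).trans ?_
      rw [ENNReal.tsum_mul_left]
      gcongr
    filter_upwards [ae_lt_top (Measurable.tsum hem) hes] with t ht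
    have ht0 : Tendsto (fun i => e i t) atTop (𝓝 0) :=
      ENNReal.tendsto_atTop_zero_of_tsum_ne_top ht.ne
    refine iInf_le_of_le (fun i x => ramp (h i) (v i x) t) (iInf_le_of_le (fun i => G i t)
      (iInf_le_of_le (fun i => ?_) (iInf_le_of_le (fun i => ?_) (iInf_le_of_le ?_ ?_))))
    · refine (hv i).comp_lipschitz (φ := fun s => ramp (h i) s t) (L := Real.toNNReal (h i)⁻¹)
        (LipschitzWith.of_dist_le_mul fun a b => ?_)
      rw [Real.coe_toNNReal _ (by have := hh0 i; positivity)]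
      exact abs_ramp_sub_le (hh0 i) a b t
    · exact isUpperGradient_ramp (hvc i) (hg i) (hh0 i) t
    · intro K _ hK
      refine tendsto_of_tendsto_of_tendsto_of_le_of_le' tendsto_const_nhds ht0
        (Eventually.of_forall fun _ => zero_le) ?_
      obtain ⟨R, hR⟩ := hK.isBounded.subset_closedBall x₀
      filter_upwards [eventually_ge_atTop ⌈R⌉₊] with i hi
      have hRi : R ≤ (i : ℝ) := (Nat.le_ceil R).trans (by exact_mod_cast hi)
      refine le_trans (lintegral_mono_set (hR.trans (closedBall_subset_closedBall hRi)))
        (le_of_eq ?_)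
      refine lintegral_congr fun x => ?_
      simp only [indicator_apply, mem_ofPred_eq]
    · simp only [Measure.restrict_univ]
      exact le_rfl

end Coarea

/-! ### Finiteness of the approximate limits -/

section Finiteness

variable {μ : Measure X} {Cd : ℝ≥0} {CP lam γ : ℝ}

lemma codimH_forall_not_zeroDensityAt [ProperSpace X] [Nonempty X] [BorelSpace X] (hCd : 1 ≤ Cd)
    (hdbl : DoublingWith μ Cd) (hCP : 0 < CP) (hlam : 1 ≤ lam) (hPI : PoincareIneq μ CP lam)
    (hγ0 : 0 < γ) (hγhalf : γ ≤ 1 / 2) (hγ : GammaDensityProperty μ γ)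
    (F : ℕ → Set X) (hF : ∀ i, MeasurableSet (F i)) (hP : ∀ i, perimeter μ (F i) univ < ⊤)
    (hP0 : Tendsto (fun i => perimeter μ (F i) univ) atTop (𝓝 0))
    (hμ0 : Tendsto (fun i => μ (F i)) atTop (𝓝 0)) :
    codimH μ {x | ∀ i, ¬ ZeroDensityAt μ (F i) x} = 0 := by
  have h0 := hγ.codimHContent_empty
  obtain ⟨x₀⟩ := ‹Nonempty X›
  have := Nonempty.intro x₀
  choose ν hν using fun i => exists_isPerimeterMeasure hdbl hlam hPI (hF i) (hP i)
  have h1 : codimH μ (⋃ i, {x | ¬ (ZeroDensityAt μ (F i) x ∨ LowerDensityAtLeast μ γ (F i) x)})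
      = 0 :=
    codimH_iUnion_null h0 fun i => hγ.codimH_eq_zero (by linarith) hdbl (hF i) (hP i)
  set c : ℝ≥0∞ := ENNReal.ofReal (γ / 2) with hcdef
  have hc : c ≤ 1 / 2 := by
    rw [hcdef, ← ENNReal.ofReal_one, show (2 : ℝ≥0∞) = ENNReal.ofReal 2 by simp,
      ← ENNReal.ofReal_div_of_pos two_pos]
    exact ENNReal.ofReal_le_ofReal (by linarith)
  have hc0 : c ≠ 0 := by simpa [hcdef] using hγ0
  set W : ℕ → Set X := fun M => {x | ∀ i, LowerDensityAtLeast μ γ (F i) x} ∩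
    closedBall x₀ (M + 1) with hW
  have h2 : codimH μ (⋃ M, W M) = 0 := by
    refine codimH_iUnion_null h0 fun M => codimH_eq_zero_iff.2 fun R hR => ?_
    obtain ⟨C, hC⟩ := exists_codimHContent_le hdbl h0 (σ := 2 * lam) (by linarith)
    set R' : ℝ := R / (6 * (2 * lam)) with hR'
    have hR'0 : 0 < R' := by positivity
    obtain ⟨m, hm0, hm⟩ := hdbl.exists_le_measure_ball x₀ (M := M + 1) (s := R') (by positivity)
      hR'0
    set K : ℝ≥0∞ := 2 * ENNReal.ofReal CP * (Cd / c) with hK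
    have hKt : K ≠ ⊤ := by
      have : (Cd : ℝ≥0∞) / c ≠ ⊤ := ENNReal.div_ne_top ENNReal.coe_ne_top hc0
      finiteness
    have hev : ∀ᶠ i in atTop, codimHContent μ R (W M) ≤ C * (K * perimeter μ (F i) univ) := by
      filter_upwards [ENNReal.tendsto_nhds_zero.1 hμ0 (c * m)
        (pos_iff_ne_zero.2 (mul_ne_zero hc0 hm0))] with i hi
      have h3 := hC (ν i) K R' (W M) univ hR'0 fun y hy => by
        obtain ⟨ρ, hρ0, hρR, hρ⟩ := (hν i).exists_radius hCd hdbl (hF i) hCP hc0 hc hR'0 (y := y)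
          ((measure_mono inter_subset_right).trans (hi.trans (mul_le_mul_right (hm y hy.2) c)))
          ((hy.1 i).eventually_lt hdbl ((ENNReal.ofReal_lt_ofReal_iff hγ0).2 (by linarith)))
        exact ⟨ρ, hρ0, hρR, hρ, subset_univ _⟩
      rw [hR', mul_div_cancel₀ _ (by positivity)] at h3
      exact h3.trans (by gcongr; exact (hν i).univ_le)
    have hlim : Tendsto (fun i => C * (K * perimeter μ (F i) univ)) atTop (𝓝 0) := by
      have := ENNReal.Tendsto.const_mul (a := (C : ℝ≥0∞))
        (ENNReal.Tendsto.const_mul (a := K) hP0 (Or.inr hKt)) (Or.inr ENNReal.coe_ne_top)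
      simpa using this
    exact le_antisymm (ge_of_tendsto hlim hev) zero_le
  refine codimH_mono_null ?_ (codimH_union_null h0 h1 h2)
  intro x hx
  by_contra hcon
  simp only [mem_union, mem_iUnion, not_or, not_exists, mem_ofPred_eq, not_and, not_not] at hcon
  obtain ⟨M, hM⟩ := exists_nat_ge (dist x x₀)
  refine hcon.2 M ⟨fun i => ?_, mem_closedBall.2 (by linarith)⟩
  have := hcon.1 i
  exact this (hx i)

lemma exists_mem_perimeter_lt {u : X → ℝ} {q : ℝ → ℝ≥0∞} (hq : ∫⁻ t, q t ≠ ⊤)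
    (hPq : ∀ᵐ t : ℝ, perimeter μ {x | t < u x} univ ≤ q t) {s : Set ℝ} {c : ℝ≥0∞}
    (hsm : MeasurableSet s) (hs : c * volume s = ⊤) : ∃ t ∈ s, perimeter μ {x | t < u x} univ < c := by
  by_contra! hcon
  refine hq (top_le_iff.1 ?_)
  calc ⊤ = ∫⁻ _ in s, c := by rw [setLIntegral_const, hs]
    _ ≤ ∫⁻ t in s, q t := by
        refine lintegral_mono_ae ?_
        filter_upwards [ae_restrict_of_ae hPq, ae_restrict_mem hsm] with t h1 h2
        exact (hcon t h2).trans h1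
    _ ≤ _ := setLIntegral_le_lintegral _ _

lemma tendsto_measure_of_natCast_le_abs {u : X → ℝ} (hu : Integrable u μ) {F : ℕ → Set X}
    (hF : ∀ i, ∀ x ∈ F i, (i : ℝ) ≤ |u x|) : Tendsto (fun i => μ (F i)) atTop (𝓝 0) := by
  have hI : ∫⁻ x, ENNReal.ofReal |u x| ∂μ ≠ ⊤ := by
    have := ((hasFiniteIntegral_iff_norm u).1 hu.2).ne
    simpa only [Real.norm_eq_abs] using this
  have h1 : ∀ i : ℕ, i ≠ 0 → μ (F i) ≤ (∫⁻ x, ENNReal.ofReal |u x| ∂μ) / i := by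
    intro i hi
    refine (measure_mono fun x hx => ?_).trans (meas_ge_le_lintegral_div (μ := μ)
      (f := fun x => ENNReal.ofReal |u x|) (ε := (i : ℝ≥0∞))
      (continuous_abs.measurable.comp_aemeasurable hu.1.aemeasurable).ennreal_ofReal (by simpa)
      (ENNReal.natCast_ne_top i))
    rw [mem_ofPred_eq, ← ENNReal.ofReal_natCast]
    exact ENNReal.ofReal_le_ofReal (hF i x hx)
  have h2 : Tendsto (fun i : ℕ => (∫⁻ x, ENNReal.ofReal |u x| ∂μ) / i) atTop (𝓝 0) := by
    have := ENNReal.Tendsto.const_mul (a := ∫⁻ x, ENNReal.ofReal |u x| ∂μ)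
      ENNReal.tendsto_inv_nat_nhds_zero (Or.inr hI)
    simpa [div_eq_mul_inv] using this
  refine tendsto_of_tendsto_of_tendsto_of_le_of_le' tendsto_const_nhds h2
    (Eventually.of_forall fun _ => zero_le) ?_
  filter_upwards [eventually_ne_atTop 0] with i hi using h1 i hi

lemma codimH_forall_not_zeroDensityAt_level [ProperSpace X] [Nonempty X] [BorelSpace X]
    (hCd : 1 ≤ Cd)
    (hdbl : DoublingWith μ Cd) (hCP : 0 < CP) (hlam : 1 ≤ lam) (hPI : PoincareIneq μ CP lam)
    (hγ0 : 0 < γ) (hγhalf : γ ≤ 1 / 2) (hγ : GammaDensityProperty μ γ)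
    {u : X → ℝ} (hum : Measurable u) (hu : Integrable u μ) {q : ℝ → ℝ≥0∞} (hq : ∫⁻ t, q t ≠ ⊤)
    (hPq : ∀ᵐ t : ℝ, perimeter μ {x | t < u x} univ ≤ q t) :
    codimH μ {x | ¬ ((∃ t : ℝ, ZeroDensityAt μ {y | t < u y} x) ∧
      ∃ t : ℝ, ZeroDensityAt μ {y | u y ≤ t} x)} = 0 := by
  have h0 := hγ.codimHContent_empty
  have hε : ∀ i : ℕ, ((i : ℝ≥0∞) + 1)⁻¹ ≠ 0 := fun i => by simp
  have hεt : Tendsto (fun i : ℕ => ((i : ℝ≥0∞) + 1)⁻¹) atTop (𝓝 0) := by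
    have := (tendsto_add_atTop_iff_nat 1).2 ENNReal.tendsto_inv_nat_nhds_zero
    simpa using this
  have hεtop : ∀ i : ℕ, ((i : ℝ≥0∞) + 1)⁻¹ < ⊤ := fun i => by simp
  choose s hs hsP using fun i : ℕ => exists_mem_perimeter_lt hq hPq (s := Ioi (i : ℝ))
    (c := ((i : ℝ≥0∞) + 1)⁻¹) measurableSet_Ioi (by rw [Real.volume_Ioi, ENNReal.mul_top (hε i)])
  choose t ht htP using fun i : ℕ => exists_mem_perimeter_lt hq hPq (s := Iio (-(i : ℝ)))
    (c := ((i : ℝ≥0∞) + 1)⁻¹) measurableSet_Iio (by rw [Real.volume_Iio, ENNReal.mul_top (hε i)])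
  have hA := codimH_forall_not_zeroDensityAt hCd hdbl hCP hlam hPI hγ0 hγhalf hγ
    (fun i => {x | s i < u x}) (fun i => measurableSet_lt measurable_const hum)
    (fun i => (hsP i).trans (hεtop i))
    (tendsto_of_tendsto_of_tendsto_of_le_of_le tendsto_const_nhds hεt (fun _ => zero_le)
      fun i => (hsP i).le)
    (tendsto_measure_of_natCast_le_abs hu fun i x hx =>
      (le_of_lt (lt_trans (hs i) hx)).trans (le_abs_self _))
  have htP' : ∀ i, perimeter μ {x | u x ≤ t i} univ ≤ ((i : ℝ≥0∞) + 1)⁻¹ := fun i => by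
    have h1 : {x | u x ≤ t i} = {x | t i < u x}ᶜ := by ext; simp
    rw [h1]
    exact (perimeter_compl_le μ _).trans (htP i).le
  have hB := codimH_forall_not_zeroDensityAt hCd hdbl hCP hlam hPI hγ0 hγhalf hγ
    (fun i => {x | u x ≤ t i}) (fun i => measurableSet_le hum measurable_const)
    (fun i => (htP' i).trans_lt (hεtop i))
    (tendsto_of_tendsto_of_tendsto_of_le_of_le tendsto_const_nhds hεt (fun _ => zero_le) htP')
    (tendsto_measure_of_natCast_le_abs hu fun i x hx => by
      have h1 : t i < -(i : ℝ) := ht i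
      have h2 : u x ≤ t i := hx
      exact (by linarith : (i : ℝ) ≤ - u x).trans (neg_le_abs _))
  refine codimH_mono_null (fun x hx => ?_) (codimH_union_null h0 hA hB)
  rw [mem_ofPred_eq, not_and_or] at hx
  rcases hx with hx | hx
  · exact Or.inl fun i hi => hx ⟨_, hi⟩
  · exact Or.inr fun i hi => hx ⟨_, hi⟩

end Finiteness

/-! ### Jump values -/

section Jump

variable {μ : Measure X} {Cd : ℝ≥0} {u : X → ℝ} {x : X}

lemma not_zeroDensityAt_univ (hdbl : DoublingWith μ Cd) (x : X) : ¬ ZeroDensityAt μ univ x := by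
  intro h
  obtain ⟨r, h1, hr⟩ := ((h.eventually_le hdbl (ε := 2⁻¹) (by simp)).and
    self_mem_nhdsWithin).exists
  rw [inter_univ] at h1
  have h2 : μ (ball x r) < μ (ball x r) := by
    refine h1.trans_lt ?_
    rw [mul_comm, ← div_eq_mul_inv]
    exact ENNReal.half_lt_self (hdbl.measure_ball_ne_zero hr) (hdbl.measure_ball_ne_top x r)
  exact lt_irrefl _ h2

lemma zeroDensityAt_le_of_lt_lowerApprox {s : ℝ} (h : (s : EReal) < lowerApprox μ u x) :
    ZeroDensityAt μ {y | u y ≤ s} x := by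
  obtain ⟨t, ht, hst⟩ := lt_sSup_iff.1 h
  have ht' : ZeroDensityAt μ {y | (u y : EReal) < t} x := ht
  exact ht'.mono fun y hy => lt_of_le_of_lt (EReal.coe_le_coe_iff.2 hy) hst

lemma not_zeroDensityAt_le_of_lowerApprox_lt {t : ℝ} (h : lowerApprox μ u x < t) :
    ¬ ZeroDensityAt μ {y | u y ≤ t} x := fun hz =>
  h.not_ge (le_sSup (hz.mono fun _ hy => (EReal.coe_lt_coe_iff.1 hy).le))

lemma zeroDensityAt_lt_of_upperApprox_lt {t : ℝ} (h : upperApprox μ u x < t) :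
    ZeroDensityAt μ {y | t < u y} x := by
  obtain ⟨s, hs, hst⟩ := sInf_lt_iff.1 h
  have hs' : ZeroDensityAt μ {y | s < (u y : EReal)} x := hs
  exact hs'.mono fun y hy => hst.trans (EReal.coe_lt_coe_iff.2 hy)

lemma not_zeroDensityAt_lt_of_lt_upperApprox {s : ℝ} (h : (s : EReal) < upperApprox μ u x) :
    ¬ ZeroDensityAt μ {y | s < u y} x := fun hz =>
  h.not_ge (sInf_le (hz.mono fun _ hy => EReal.coe_lt_coe_iff.1 hy))

lemma lowerApprox_le_upperApprox (hdbl : DoublingWith μ Cd) :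
    lowerApprox μ u x ≤ upperApprox μ u x := by
  by_contra! hcon
  obtain ⟨t, h1, h2⟩ := EReal.lt_iff_exists_real_btwn.1 hcon
  refine not_zeroDensityAt_univ hdbl x (((zeroDensityAt_le_of_lt_lowerApprox h2).union
    (zeroDensityAt_lt_of_upperApprox_lt h1)).mono fun y _ => ?_)
  exact le_or_gt (u y) t

lemma zeroDensityAt_of_lt_jumpNext {p : EReal} {s δ : ℝ} (hδ : 0 < δ)
    (h : (s : EReal) < jumpNext μ u p x) :
    ZeroDensityAt μ {y | p + (δ : EReal) < (u y : EReal) ∧ u y ≤ s} x := by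
  obtain ⟨t, ht, hst⟩ := lt_sSup_iff.1 h
  have ht' : ZeroDensityAt μ {y | p + (δ : EReal) < (u y : EReal) ∧ (u y : EReal) < t} x := ht δ hδ
  exact ht'.mono fun y hy => ⟨hy.1, lt_of_le_of_lt (EReal.coe_le_coe_iff.2 hy.2) hst⟩

lemma exists_not_zeroDensityAt_of_jumpNext_lt {p : EReal} {t : ℝ} (h : jumpNext μ u p x < t) :
    ∃ δ : ℝ, 0 < δ ∧ ¬ ZeroDensityAt μ {y | p + (δ : EReal) < (u y : EReal) ∧ u y < t} x := by
  by_contra! hcon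
  exact h.not_ge (le_sSup fun δ hδ => (hcon δ hδ).mono fun y hy =>
    ⟨hy.1, EReal.coe_lt_coe_iff.1 hy.2⟩)

lemma le_jumpNext (p : EReal) : p ≤ jumpNext μ u p x := by
  refine le_sSup fun δ hδ => ?_
  have h1 : {y | p + (δ : EReal) < (u y : EReal) ∧ (u y : EReal) < p} = ∅ := by
    refine eq_empty_of_forall_notMem fun y hy => ?_
    have h2 : p ≤ p + (δ : EReal) := le_add_of_nonneg_right (by exact_mod_cast hδ.le)
    exact absurd (hy.1.trans hy.2) (not_lt.2 h2)
  simp [h1]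

lemma exists_add_le {p : EReal} {s : ℝ} (h : p < s) : ∃ δ : ℝ, 0 < δ ∧ p + (δ : EReal) ≤ s := by
  induction p with
  | bot => exact ⟨1, one_pos, by simp⟩
  | top => simp at h
  | coe p =>
    have h' := EReal.coe_lt_coe_iff.1 h
    exact ⟨s - p, by linarith, by rw [← EReal.coe_add]; exact EReal.coe_le_coe_iff.2 (by linarith)⟩

lemma zeroDensityAt_Ioc_of_lt_jumpNext {p : EReal} {s t : ℝ} (hps : p < s)
    (h : (t : EReal) < jumpNext μ u p x) : ZeroDensityAt μ {y | s < u y ∧ u y ≤ t} x := by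
  obtain ⟨δ, hδ, hle⟩ := exists_add_le hps
  exact (zeroDensityAt_of_lt_jumpNext hδ h).mono fun y hy =>
    ⟨hle.trans_lt (EReal.coe_lt_coe_iff.2 hy.1), hy.2⟩

lemma jumpNext_le_upperApprox {p : EReal} (hp : p < upperApprox μ u x) :
    jumpNext μ u p x ≤ upperApprox μ u x := by
  by_contra! hcon
  obtain ⟨t, h1, h2⟩ := EReal.lt_iff_exists_real_btwn.1 hcon
  obtain ⟨s, h3, h4⟩ := EReal.lt_iff_exists_real_btwn.1 hp
  refine not_zeroDensityAt_lt_of_lt_upperApprox h4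
    (((zeroDensityAt_Ioc_of_lt_jumpNext h3 h2).union
      (zeroDensityAt_lt_of_upperApprox_lt h1)).mono fun y hy => ?_)
  rcases le_or_gt (u y) t with h | h
  exacts [Or.inl ⟨hy, h⟩, Or.inr h]

/-- `v` lies between the approximate limits of `u` at `x`, and every neighborhood of `v` is
charged by `u` at `x`. -/
structure IsApproxValue (μ : Measure X) (u : X → ℝ) (x : X) (v : EReal) : Prop where
  lower_le : lowerApprox μ u x ≤ v
  le_upper : v ≤ upperApprox μ u x
  not_zeroDensityAt : ∀ s t : ℝ, (s : EReal) < v → v < (t : EReal) →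
    ¬ ZeroDensityAt μ {y | s < u y ∧ u y ≤ t} x

lemma isApproxValue_lowerApprox (hdbl : DoublingWith μ Cd) :
    IsApproxValue μ u x (lowerApprox μ u x) where
  lower_le := le_rfl
  le_upper := lowerApprox_le_upperApprox hdbl
  not_zeroDensityAt s t hs ht hz := by
    refine not_zeroDensityAt_le_of_lowerApprox_lt ht
      (((zeroDensityAt_le_of_lt_lowerApprox hs).union hz).mono fun y hy => ?_)
    rcases le_or_gt (u y) s with h | h
    exacts [Or.inl h, Or.inr ⟨h, hy⟩]

lemma isApproxValue_upperApprox (hdbl : DoublingWith μ Cd) :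
    IsApproxValue μ u x (upperApprox μ u x) where
  lower_le := lowerApprox_le_upperApprox hdbl
  le_upper := le_rfl
  not_zeroDensityAt s t hs ht hz := by
    refine not_zeroDensityAt_lt_of_lt_upperApprox hs
      ((hz.union (zeroDensityAt_lt_of_upperApprox_lt ht)).mono fun y hy => ?_)
    rcases le_or_gt (u y) t with h | h
    exacts [Or.inl ⟨hy, h⟩, Or.inr h]

lemma isApproxValue_jumpNext {p : EReal} (hp : lowerApprox μ u x ≤ p)
    (hp' : p < upperApprox μ u x) : IsApproxValue μ u x (jumpNext μ u p x) where
  lower_le := hp.trans (le_jumpNext p)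
  le_upper := jumpNext_le_upperApprox hp'
  not_zeroDensityAt s t hs ht hz := by
    obtain ⟨δ, hδ, hn⟩ := exists_not_zeroDensityAt_of_jumpNext_lt ht
    refine hn (((zeroDensityAt_of_lt_jumpNext hδ hs).union hz).mono fun y hy => ?_)
    rcases le_or_gt (u y) s with h | h
    exacts [Or.inl ⟨hy.1, h⟩, Or.inr ⟨h, hy.2.le⟩]

lemma isApproxValue_jumpAux (hdbl : DoublingWith μ Cd) (l : ℕ) :
    IsApproxValue μ u x (jumpAux μ u l x) := by
  induction l with
  | zero => exact isApproxValue_lowerApprox hdbl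
  | succ l ih =>
    simp only [jumpAux]
    split_ifs with h
    · exact isApproxValue_jumpNext ih.lower_le h
    · exact isApproxValue_upperApprox hdbl

lemma isApproxValue_jumpVal (hdbl : DoublingWith μ Cd) (n l : ℕ) :
    IsApproxValue μ u x (jumpVal μ u n l x) := by
  rw [jumpVal]
  split_ifs
  · exact isApproxValue_upperApprox hdbl
  · exact isApproxValue_jumpAux hdbl _

lemma LowerDensityAtLeast.union [BorelSpace X] {F G : Set X} {a b : ℝ} (ha : 0 < a) (hb : 0 < b)
    (hF : LowerDensityAtLeast μ a F x) (hG : LowerDensityAtLeast μ b G x) (hFG : Disjoint F G)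
    (hGm : MeasurableSet G) : LowerDensityAtLeast μ (a + b) (F ∪ G) x := by
  unfold LowerDensityAtLeast at *
  rw [ENNReal.ofReal_add ha.le hb.le]
  refine le_of_forall_lt fun c hc => ?_
  obtain ⟨a', ha', b', hb', hc'⟩ := ENNReal.exists_lt_add_of_lt_add hc
    (ENNReal.ofReal_pos.2 ha).ne' (ENNReal.ofReal_pos.2 hb).ne'
  refine hc'.trans_le (le_liminf_of_le (by isBoundedDefault) ?_)
  filter_upwards [eventually_lt_of_lt_liminf (ha'.trans_le hF),
    eventually_lt_of_lt_liminf (hb'.trans_le hG)] with r h1 h2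
  rw [inter_union_distrib_left, measure_union (hFG.mono inter_subset_right inter_subset_right)
    (measurableSet_ball.inter hGm), ENNReal.add_div]
  exact add_le_add h1.le h2.le

lemma LowerDensityAtLeast.mono {F G : Set X} {a : ℝ} (hF : LowerDensityAtLeast μ a F x)
    (h : F ⊆ G) : LowerDensityAtLeast μ a G x :=
  hF.trans (liminf_le_liminf (Eventually.of_forall fun _ =>
    ENNReal.div_le_div_right (measure_mono (inter_subset_inter_right _ h)) _))

lemma LowerDensityAtLeast.le_one (hdbl : DoublingWith μ Cd) {F : Set X} {a : ℝ}
    (h : LowerDensityAtLeast μ a F x) : a ≤ 1 := by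
  rw [← ENNReal.ofReal_le_one]
  refine h.trans (liminf_le_of_frequently_le (Eventually.frequently ?_))
  filter_upwards with r
  exact ENNReal.div_le_of_le_mul (by rw [one_mul]; exact measure_mono inter_subset_left)

/-- The superlevel sets, sublevel sets and layers of `u` for levels in `T`. -/
def levelSets (u : X → ℝ) (T : Set ℝ) : Set (Set X) :=
  (fun t => {y | t < u y}) '' T ∪ (fun t => {y | u y ≤ t}) '' T ∪
    (fun p : ℝ × ℝ => {y | p.1 < u y ∧ u y ≤ p.2}) '' (T ×ˢ T)

lemma lt_mem_levelSets {T : Set ℝ} {t : ℝ} (ht : t ∈ T) : {y | t < u y} ∈ levelSets u T :=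
  Or.inl (Or.inl ⟨t, ht, rfl⟩)

lemma le_mem_levelSets {T : Set ℝ} {t : ℝ} (ht : t ∈ T) : {y | u y ≤ t} ∈ levelSets u T :=
  Or.inl (Or.inr ⟨t, ht, rfl⟩)

lemma layer_mem_levelSets {T : Set ℝ} {s t : ℝ} (hs : s ∈ T) (ht : t ∈ T) :
    {y | s < u y ∧ u y ≤ t} ∈ levelSets u T :=
  Or.inr ⟨(s, t), ⟨hs, ht⟩, rfl⟩

lemma exists_mem_btwn_of_dense {T : Set ℝ} (hT : Dense T) {a b : EReal} (h : a < b) :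
    ∃ t ∈ T, a < (t : EReal) ∧ (t : EReal) < b := by
  obtain ⟨c, h1, h2⟩ := EReal.lt_iff_exists_real_btwn.1 h
  obtain ⟨d, h3, h4⟩ := EReal.lt_iff_exists_real_btwn.1 h2
  obtain ⟨t, ht, h5, h6⟩ := hT.exists_between (EReal.coe_lt_coe_iff.1 h3)
  exact ⟨t, ht, h1.trans (EReal.coe_lt_coe_iff.2 h5), (EReal.coe_lt_coe_iff.2 h6).trans h4⟩

lemma zeroDensityAt_layer_of_no_jump [BorelSpace X] (hdbl : DoublingWith μ Cd) {γ : ℝ} (hγ0 : 0 < γ)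
    (hγhalf : γ ≤ 1 / 2) (hu : Measurable u) {T : Set ℝ} (hT : Dense T)
    (hgood : ∀ F ∈ levelSets u T, ZeroDensityAt μ F x ∨ LowerDensityAtLeast μ γ F x)
    (hbot : lowerApprox μ u x ≠ ⊥) {s t : ℝ} (hs : s ∈ T) (ht : t ∈ T)
    (hls : lowerApprox μ u x < s) (htu : (t : EReal) < upperApprox μ u x) (hst : s < t)
    (hJ : ∀ l ∈ Finset.Icc 1 ⌊1 / γ⌋₊, jumpVal μ u ⌊1 / γ⌋₊ l x ∉ Icc (s : EReal) t) :
    ZeroDensityAt μ {y | s < u y ∧ u y ≤ t} x := by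
  by_contra hcon
  have hlay : ∀ a b : ℝ, MeasurableSet {y | a < u y ∧ u y ≤ b} := fun a b =>
    (measurableSet_lt measurable_const hu).inter (measurableSet_le hu measurable_const)
  have hn : 2 ≤ ⌊1 / γ⌋₊ := Nat.le_floor (by rw [le_div_iff₀ hγ0]; push_cast; linarith)
  obtain ⟨m, hm⟩ := Nat.exists_eq_add_of_le' hn
  rw [hm] at hJ
  have hJ' : ∀ l ≤ m, jumpAux μ u l x ∉ Icc (s : EReal) t := by
    intro l hl
    have := hJ (l + 1) (Finset.mem_Icc.2 ⟨by omega, by omega⟩)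
    rwa [jumpVal, if_neg (by omega), Nat.add_sub_cancel] at this
  have hstu : (s : EReal) < upperApprox μ u x := (EReal.coe_lt_coe_iff.2 hst).trans htu
  have key : ∀ l ≤ m, jumpAux μ u l x < s ∧ ∀ s' ∈ T, jumpAux μ u l x < s' → s' ≤ s →
      LowerDensityAtLeast μ ((l + 1) * γ) {y | u y ≤ s'} x := by
    intro l
    induction l with
    | zero =>
      intro _
      refine ⟨hls, fun s' hs' h1 _ => ?_⟩
      have := (hgood _ (le_mem_levelSets hs')).resolve_left
        (not_zeroDensityAt_le_of_lowerApprox_lt h1)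
      simpa using this
    | succ l ih =>
      intro hl
      obtain ⟨h1, h2⟩ := ih (by omega)
      have hjump : jumpAux μ u (l + 1) x = jumpNext μ u (jumpAux μ u l x) x :=
        if_pos (h1.trans hstu)
      have h3 : jumpAux μ u (l + 1) x < s := by
        by_contra! h4
        have h5 : (t : EReal) < jumpAux μ u (l + 1) x := by
          by_contra! h6
          exact hJ' (l + 1) hl ⟨h4, h6⟩
        rw [hjump] at h5
        exact hcon (zeroDensityAt_Ioc_of_lt_jumpNext h1 h5)
      refine ⟨h3, fun s' hs' h4 hs's => ?_⟩
      have h4' := h4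
      rw [hjump] at h4'
      obtain ⟨δ, hδ, hn⟩ := exists_not_zeroDensityAt_of_jumpNext_lt h4'
      set p := jumpAux μ u l x with hp
      have hpb : p ≠ ⊥ := fun h => hbot (le_bot_iff.1 (h ▸ (isApproxValue_jumpAux hdbl l).lower_le))
      have hps' : p < s' := (le_jumpNext p).trans_lt h4'
      have hpδ : p < p + (δ : EReal) := by
        obtain ⟨p', hp'⟩ : ∃ p' : ℝ, (p' : EReal) = p := ⟨_, EReal.coe_toReal hps'.ne_top hpb⟩
        rw [← hp', ← EReal.coe_add]
        exact EReal.coe_lt_coe_iff.2 (by linarith)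
      obtain ⟨r, hr, h5, h6⟩ := exists_mem_btwn_of_dense hT (lt_min hpδ hps')
      have hrs' : r < s' := EReal.coe_lt_coe_iff.1 (h6.trans_le (min_le_right _ _))
      have h7 : LowerDensityAtLeast μ γ {y | r < u y ∧ u y ≤ s'} x :=
        (hgood _ (layer_mem_levelSets hr hs')).resolve_left fun hz => hn (hz.mono fun y hy =>
          ⟨EReal.coe_lt_coe_iff.1 ((h6.trans_le (min_le_left _ _)).trans hy.1), hy.2.le⟩)
      have h8 := (h2 r hr h5 (hrs'.le.trans hs's)).union (by positivity) hγ0 h7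
        (Set.disjoint_left.2 fun y hy hy' => not_lt.2 hy hy'.1) (hlay _ _)
      rw [show ((l + 1 : ℕ) + 1 : ℝ) * γ = (l + 1) * γ + γ by push_cast; ring]
      exact h8.mono (union_subset (fun y hy => le_trans hy hrs'.le) fun y hy => hy.2)
  obtain ⟨h1, h2⟩ := key m le_rfl
  have h3 := (h2 s hs h1 le_rfl).union (by positivity) hγ0
    ((hgood _ (layer_mem_levelSets hs ht)).resolve_left hcon)
    (Set.disjoint_left.2 fun y hy hy' => not_lt.2 hy hy'.1) (hlay _ _)
  have h4 := h3.union (by positivity) hγ0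
    ((hgood _ (lt_mem_levelSets ht)).resolve_left (not_zeroDensityAt_lt_of_lt_upperApprox htu))
    (Set.disjoint_left.2 fun y hy hy' => not_lt.2
      (hy.elim (fun h => le_trans h hst.le) fun h => h.2) hy')
    (measurableSet_lt measurable_const hu)
  have h5 := h4.le_one hdbl
  have h6 := Nat.lt_floor_add_one (1 / γ)
  rw [hm, div_lt_iff₀ hγ0] at h6
  push_cast at h6
  linarith

lemma eventually_mem_of_isOpen [BorelSpace X] (hdbl : DoublingWith μ Cd) {γ : ℝ} (hγ0 : 0 < γ)
    (hγhalf : γ ≤ 1 / 2) (hu : Measurable u) {T : Set ℝ} (hT : Dense T)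
    (hgood : ∀ F ∈ levelSets u T, ZeroDensityAt μ F x ∨ LowerDensityAtLeast μ γ F x)
    (hbot : lowerApprox μ u x ≠ ⊥) {A : Set X}
    (hA : ∀ F ∈ levelSets u T, ZeroDensityAt μ F x → ∀ᶠ y in 𝓝[A] x, ZeroDensityAt μ F y)
    {O : Set EReal} (hO : IsOpen O)
    (hJ : ∀ l ∈ Finset.Icc 1 ⌊1 / γ⌋₊, jumpVal μ u ⌊1 / γ⌋₊ l x ∈ O) :
    ∀ᶠ y in 𝓝[A] x, ∀ v, IsApproxValue μ u y v → v ∈ O := by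
  have hn : 2 ≤ ⌊1 / γ⌋₊ := Nat.le_floor (by rw [le_div_iff₀ hγ0]; push_cast; linarith)
  have hK : IsCompact Oᶜ := hO.isClosed_compl.isCompact
  suffices h : ∀ᶠ y in 𝓝[A] x, ∀ v, IsApproxValue μ u y v → v ∉ Oᶜ by
    filter_upwards [h] with y hy v hv using not_not.1 (hy v hv)
  refine hK.induction_on (p := fun S => ∀ᶠ y in 𝓝[A] x, ∀ v, IsApproxValue μ u y v → v ∉ S)
    (by simp) (fun S S' hSS' h => h.mono fun y hy v hv hvS => hy v hv (hSS' hvS))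
    (fun S S' h h' => (h.and h').mono fun y hy v hv hvS =>
      hvS.elim (hy.1 v hv) (hy.2 v hv)) fun v hv => ?_
  have hlow : lowerApprox μ u x ∈ O := by
    have := hJ 1 (Finset.mem_Icc.2 ⟨le_rfl, by omega⟩)
    rwa [jumpVal, if_neg (by omega)] at this
  have hupp : upperApprox μ u x ∈ O := by
    have := hJ _ (Finset.mem_Icc.2 ⟨by omega, le_rfl⟩)
    rwa [jumpVal, if_pos rfl] at this
  rcases lt_trichotomy v (lowerApprox μ u x) with h1 | h1 | h1
  · obtain ⟨t, ht, h2, h3⟩ := exists_mem_btwn_of_dense hT h1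
    refine ⟨Iio (t : EReal), mem_nhdsWithin_of_mem_nhds (Iio_mem_nhds h2), ?_⟩
    filter_upwards [hA _ (le_mem_levelSets ht) (zeroDensityAt_le_of_lt_lowerApprox h3)]
      with y hy w hw hwt
    exact not_zeroDensityAt_le_of_lowerApprox_lt (hw.lower_le.trans_lt hwt) hy
  · exact absurd hlow (h1 ▸ hv)
  rcases lt_trichotomy (upperApprox μ u x) v with h2 | h2 | h2
  · obtain ⟨t, ht, h3, h4⟩ := exists_mem_btwn_of_dense hT h2
    refine ⟨Ioi (t : EReal), mem_nhdsWithin_of_mem_nhds (Ioi_mem_nhds h4), ?_⟩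
    filter_upwards [hA _ (lt_mem_levelSets ht) (zeroDensityAt_lt_of_upperApprox_lt h3)]
      with y hy w hw hwt
    exact not_zeroDensityAt_lt_of_lt_upperApprox (lt_of_lt_of_le hwt hw.le_upper) hy
  · exact absurd hupp (h2 ▸ hv)
  set J : Set EReal := (fun l => jumpVal μ u ⌊1 / γ⌋₊ l x) '' Finset.Icc 1 ⌊1 / γ⌋₊ with hJdef
  have hJfin : J.Finite := (Finset.finite_toSet _).image _
  have hvJ : v ∉ J := by
    rintro ⟨l, hl, rfl⟩
    exact hv (hJ l hl)
  have hnhds : Jᶜ ∩ Ioo (lowerApprox μ u x) (upperApprox μ u x) ∈ 𝓝 v :=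
    inter_mem (hJfin.isClosed.isOpen_compl.mem_nhds hvJ) (Ioo_mem_nhds h1 h2)
  obtain ⟨a, b, hab, hsub⟩ := (mem_nhds_iff_exists_Ioo_subset' ⟨_, h1⟩ ⟨_, h2⟩).1 hnhds
  obtain ⟨s, hs, h3, h4⟩ := exists_mem_btwn_of_dense hT hab.1
  obtain ⟨t, ht, h5, h6⟩ := exists_mem_btwn_of_dense hT hab.2
  have hst : (s : EReal) < t := h4.trans h5
  have hz := zeroDensityAt_layer_of_no_jump hdbl hγ0 hγhalf hu hT hgood hbot hs ht
    (hsub ⟨h3, hst.trans h6⟩).2.1 (hsub ⟨h3.trans hst, h6⟩).2.2 (EReal.coe_lt_coe_iff.1 hst)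
    (fun l hl hm => (hsub ⟨h3.trans_le hm.1, hm.2.trans_lt h6⟩).1 ⟨l, hl, rfl⟩)
  refine ⟨Ioo (s : EReal) t, mem_nhdsWithin_of_mem_nhds (Ioo_mem_nhds h4 h5), ?_⟩
  filter_upwards [hA _ (layer_mem_levelSets hs ht) hz] with y hy w hw hwt
  exact hw.not_zeroDensityAt s t hwt.1 hwt.2 hy

end Jump

/-! ### Dependence on the representative -/

section Representative

variable {μ : Measure X} {u v : X → ℝ}

lemma measure_inter_congr_ae (h : u =ᵐ[μ] v) (B : Set X) (P : ℝ → Prop) :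
    μ (B ∩ {y | P (u y)}) = μ (B ∩ {y | P (v y)}) := by
  refine measure_congr ?_
  filter_upwards [h] with y hy
  show (y ∈ B ∧ P (u y)) = (y ∈ B ∧ P (v y))
  rw [hy]

lemma lowerApprox_congr_ae (h : u =ᵐ[μ] v) : lowerApprox μ u = lowerApprox μ v := by
  funext x
  have h1 : ∀ B (t : EReal), μ (B ∩ {y | (u y : EReal) < t}) = μ (B ∩ {y | (v y : EReal) < t}) :=
    fun B t => measure_inter_congr_ae h B fun a => (a : EReal) < t
  simp only [lowerApprox, h1]

lemma upperApprox_congr_ae (h : u =ᵐ[μ] v) : upperApprox μ u = upperApprox μ v := by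
  funext x
  have h1 : ∀ B (t : EReal), μ (B ∩ {y | t < (u y : EReal)}) = μ (B ∩ {y | t < (v y : EReal)}) :=
    fun B t => measure_inter_congr_ae h B fun a => t < (a : EReal)
  simp only [upperApprox, h1]

lemma jumpNext_congr_ae (h : u =ᵐ[μ] v) : jumpNext μ u = jumpNext μ v := by
  funext p x
  have h1 : ∀ B (s t : EReal), μ (B ∩ {y | s < (u y : EReal) ∧ (u y : EReal) < t}) =
      μ (B ∩ {y | s < (v y : EReal) ∧ (v y : EReal) < t}) :=
    fun B s t => measure_inter_congr_ae h B fun a => s < (a : EReal) ∧ (a : EReal) < t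
  simp only [jumpNext, h1]

lemma jumpAux_congr_ae (h : u =ᵐ[μ] v) (l : ℕ) : jumpAux μ u l = jumpAux μ v l := by
  induction l with
  | zero => exact lowerApprox_congr_ae h
  | succ l ih => simp only [jumpAux, ih, upperApprox_congr_ae h, jumpNext_congr_ae h]

lemma jumpVal_congr_ae (h : u =ᵐ[μ] v) (n l : ℕ) : jumpVal μ u n l = jumpVal μ v n l := by
  simp only [jumpVal, jumpAux_congr_ae h, upperApprox_congr_ae h]

lemma totalVariation_congr_ae (h : u =ᵐ[μ] v) (Ω : Set X) :
    totalVariation μ u Ω = totalVariation μ v Ω := by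
  have h1 : ∀ (w : X → ℝ) (K : Set X), ∫⁻ x in K, ENNReal.ofReal |w x - u x| ∂μ =
      ∫⁻ x in K, ENNReal.ofReal |w x - v x| ∂μ := fun w K =>
    lintegral_congr_ae (ae_restrict_of_ae (h.mono fun x hx => by simp only [hx]))
  simp only [totalVariation, h1]

end Representative

section Main

variable {μ : Measure X} {Cd : ℝ≥0} {CP lam γ : ℝ} {u : X → ℝ} {x : X}

lemma eAbsDiff_le_of_mem_Ioo {a ε : ℝ} {v : EReal}
    (h : v ∈ Ioo ((a - ε : ℝ) : EReal) ((a + ε : ℝ) : EReal)) :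
    eAbsDiff v a ≤ ENNReal.ofReal ε := by
  obtain ⟨w, rfl⟩ : ∃ w : ℝ, (w : EReal) = v := ⟨_, EReal.coe_toReal h.2.ne_top h.1.ne_bot⟩
  have h1 := EReal.coe_lt_coe_iff.1 h.1
  have h2 := EReal.coe_lt_coe_iff.1 h.2
  simp only [eAbsDiff, EReal.coe_ne_top, EReal.coe_ne_bot, or_self, if_false, EReal.toReal_coe]
  split_ifs
  · exact zero_le
  · exact ENNReal.ofReal_le_ofReal (abs_le.2 ⟨by linarith, by linarith⟩)

lemma tendsto_inf_eAbsDiff (hdbl : DoublingWith μ Cd) {n : ℕ} {A : Set X}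
    (hbot : lowerApprox μ u x ≠ ⊥) (htop : upperApprox μ u x ≠ ⊤)
    (h : ∀ O : Set EReal, IsOpen O → (∀ l ∈ Finset.Icc 1 n, jumpVal μ u n l x ∈ O) →
      ∀ᶠ y in 𝓝[A] x, ∀ v, IsApproxValue μ u y v → v ∈ O) (l₁ : ℕ) :
    Tendsto (fun y => (Finset.Icc 1 n).inf fun l₂ =>
      eAbsDiff (jumpVal μ u n l₁ y) (jumpVal μ u n l₂ x)) (𝓝[A] x) (𝓝 0) := by
  have hreal : ∀ l, ∃ a : ℝ, (a : EReal) = jumpVal μ u n l x := fun l =>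
    have hv := isApproxValue_jumpVal (u := u) (x := x) hdbl n l
    ⟨_, EReal.coe_toReal (fun e => htop (top_le_iff.1 (e ▸ hv.le_upper)))
      fun e => hbot (le_bot_iff.1 (e ▸ hv.lower_le))⟩
  choose a ha using hreal
  refine ENNReal.tendsto_nhds_zero.2 fun ε hε => ?_
  obtain ⟨δ, hδ0, hδ⟩ : ∃ δ : ℝ, 0 < δ ∧ ENNReal.ofReal δ ≤ ε := by
    obtain ⟨δ, h1, h2⟩ := ENNReal.lt_iff_exists_nnreal_btwn.1 hε
    exact ⟨δ, by exact_mod_cast h1, by simpa using h2.le⟩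
  have hO := h (⋃ l ∈ Finset.Icc 1 n, Ioo ((a l - δ : ℝ) : EReal) ((a l + δ : ℝ) : EReal))
    (isOpen_biUnion fun _ _ => isOpen_Ioo) fun l hl => by
      refine mem_biUnion hl ?_
      rw [← ha l]
      exact ⟨EReal.coe_lt_coe_iff.2 (by linarith), EReal.coe_lt_coe_iff.2 (by linarith)⟩
  filter_upwards [hO] with y hy
  have h1 := hy _ (isApproxValue_jumpVal hdbl n l₁)
  simp only [mem_iUnion] at h1
  obtain ⟨l, hl, h2⟩ := h1
  refine (Finset.inf_le hl).trans (le_trans ?_ hδ)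
  rw [← ha l]
  exact eAbsDiff_le_of_mem_Ioo h2

lemma perimeter_lt_top_of_mem_levelSets [ProperSpace X] [Nonempty X] [BorelSpace X]
    (hu : Measurable u) {F : Set X}
    (hF : F ∈ levelSets u {t | perimeter μ {y | t < u y} univ < ⊤}) :
    perimeter μ F univ < ⊤ := by
  have hle : ∀ t, perimeter μ {y | t < u y} univ < ⊤ → perimeter μ {y | u y ≤ t} univ < ⊤ := by
    intro t ht
    have h1 : {x | u x ≤ t} = {x | t < u x}ᶜ := by ext; simp
    rw [h1]
    exact (perimeter_compl_le μ _).trans_lt ht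
  rcases hF with (⟨t, ht, rfl⟩ | ⟨t, ht, rfl⟩) | ⟨⟨s, t⟩, ⟨hs, ht⟩, rfl⟩
  · exact ht
  · exact hle t ht
  · exact (perimeter_inter_le μ _ _ (measurableSet_lt measurable_const hu)).trans_lt
      (ENNReal.add_lt_top.2 ⟨hs, hle t ht⟩)

lemma measurableSet_of_mem_levelSets (hu : Measurable u) {T : Set ℝ} {F : Set X}
    (hF : F ∈ levelSets u T) : MeasurableSet F := by
  rcases hF with (⟨t, -, rfl⟩ | ⟨t, -, rfl⟩) | ⟨⟨s, t⟩, -, rfl⟩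
  · exact measurableSet_lt measurable_const hu
  · exact measurableSet_le hu measurable_const
  · exact (measurableSet_lt measurable_const hu).inter (measurableSet_le hu measurable_const)

lemma levelSets_mono {S T : Set ℝ} (h : S ⊆ T) : levelSets u S ⊆ levelSets u T :=
  union_subset_union (union_subset_union (image_mono h) (image_mono h))
    (image_mono (prod_mono h h))

lemma countable_levelSets {T : Set ℝ} (h : T.Countable) : (levelSets u T).Countable :=
  ((h.image _).union (h.image _)).union ((h.prod h).image _)

end Main

/-- **Proposition.** For `u ∈ BV(X)` and `H`-a.e. `x ∈ X` there is a set
`A_x ∋ x` with `r · H₁(B(x,r) ∖ A_x)/μ(B(x,r)) → 0` as `r → 0⁺`, such that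
`min_{l₂} |u^{l₁}(y_k) − u^{l₂}(x)| → 0` along every sequence `y_k → x`
with `y_k ∈ A_x`. -/
theorem bv_convergence_along_small_surface_area_sets
    {X : Type*} [MetricSpace X] [CompleteSpace X] [Nontrivial X]
    [MeasurableSpace X] [BorelSpace X] (μ : Measure X)
    (Cd : ℝ≥0) (hCd : 1 ≤ Cd) (hdbl : DoublingWith μ Cd)
    (CP lam : ℝ) (hCP : 0 < CP) (hlam : 1 ≤ lam) (hPI : PoincareIneq μ CP lam)
    (γ : ℝ) (hγ0 : 0 < γ) (hγhalf : γ ≤ 1 / 2) (hγ : GammaDensityProperty μ γ)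
    (u : X → ℝ) (hu : MemBV μ u) :
    codimH μ {x : X | ¬ ∃ A : Set X, x ∈ A ∧
      Tendsto (fun r : ℝ =>
          ENNReal.ofReal r * codimHContent μ 1 (ball x r \ A) / μ (ball x r))
        (𝓝[>] 0) (𝓝 0) ∧
      ∀ y : ℕ → X, (∀ k, y k ∈ A) → Tendsto y atTop (𝓝 x) →
        ∀ l₁ ∈ Finset.Icc 1 ⌊1 / γ⌋₊,
          Tendsto (fun k =>
              (Finset.Icc 1 ⌊1 / γ⌋₊).inf fun l₂ =>
                eAbsDiff (jumpVal μ u ⌊1 / γ⌋₊ l₁ (y k)) (jumpVal μ u ⌊1 / γ⌋₊ l₂ x))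
            atTop (𝓝 0)} = 0 := by
  have := hdbl.properSpace
  have := hdbl.isLocallyFiniteMeasure
  have h0 := hγ.codimHContent_empty
  obtain ⟨v, hvm, huv⟩ := hu.1.1.aemeasurable
  have hv : Integrable v μ := hu.1.congr huv
  have hTV : totalVariation μ v univ < ⊤ := totalVariation_congr_ae huv univ ▸ hu.2
  simp only [jumpVal_congr_ae huv]
  obtain ⟨q, hq, hPq⟩ := exists_coarea hdbl hvm hTV
  have hdense : Dense {t | perimeter μ {y | t < v y} univ < ⊤} := by
    refine dense_of_exists_between fun a b hab => ?_
    obtain ⟨t, ht, hPt⟩ := exists_mem_perimeter_lt hq hPq (s := Ioo a b) (c := ⊤)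
      measurableSet_Ioo (by
        rw [Real.volume_Ioo]
        exact ENNReal.top_mul (ENNReal.ofReal_pos.2 (by linarith)).ne')
    exact ⟨t, hPt, ht.1, ht.2⟩
  obtain ⟨T, hTs, hTc, hT⟩ := hdense.exists_countable_dense_subset
  obtain ⟨t₀, ht₀⟩ := hT.nonempty
  obtain ⟨F, hF⟩ := (countable_levelSets (u := v) hTc).exists_eq_range
    ⟨_, lt_mem_levelSets ht₀⟩
  have hFmem : ∀ i, F i ∈ levelSets v T := fun i => hF ▸ mem_range_self i
  have h1 := exists_set_zeroDensityAt_nat hCd hdbl hCP hlam hPI hγ0 hγhalf hγ F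
    (fun i => measurableSet_of_mem_levelSets hvm (hFmem i))
    (fun i => perimeter_lt_top_of_mem_levelSets hvm (levelSets_mono hTs (hFmem i)))
  have h2 := codimH_forall_not_zeroDensityAt_level hCd hdbl hCP hlam hPI hγ0 hγhalf hγ hvm hv
    hq hPq
  refine codimH_mono_null (fun x hx => ?_) (codimH_union_null h0 h1 h2)
  by_contra hcon
  simp only [mem_union, mem_ofPred_eq, not_or, not_not] at hcon
  obtain ⟨⟨hgood, A, hxA, hA, hAF⟩, ⟨a, ha⟩, b, hb⟩ := hcon
  refine hx ⟨A, hxA, hA, fun y hyA hy l₁ _ => ?_⟩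
  have hbot : lowerApprox μ v x ≠ ⊥ := fun h =>
    not_zeroDensityAt_le_of_lowerApprox_lt (h ▸ EReal.bot_lt_coe b) hb
  have htop : upperApprox μ v x ≠ ⊤ := fun h =>
    not_zeroDensityAt_lt_of_lt_upperApprox (h ▸ EReal.coe_lt_top a) ha
  have hlim := tendsto_inf_eAbsDiff (n := ⌊1 / γ⌋₊) hdbl hbot htop (fun O hO hJ =>
    eventually_mem_of_isOpen hdbl hγ0 hγhalf hvm hT
      (fun G hG => by
        obtain ⟨i, rfl⟩ := hF ▸ hG
        exact hgood i) hbot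
      (fun G hG => by
        obtain ⟨i, rfl⟩ := hF ▸ hG
        exact hAF i) hO hJ) l₁
  exact hlim.comp (tendsto_nhdsWithin_iff.2 ⟨hy, Eventually.of_forall hyA⟩)

end FineBV
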